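/- arXiv:1509.02145 — 2 statements merged into one kernel-verified Lean document; each statement's English description precedes it below -/
import Mathlib

section
/- Let G be a flat, finitely presented group scheme over a scheme B, let X be a G-scheme, let Z ⊆ X be a closed subscheme, and let U = X ∖ Z be its open complement. Then U is G-invariant if and only if Z admits a G-invariant thickening. Moreover, if X and U are quasi-compact and quasi-separated, the G-invariant thickening may be chosen to be finitely presented over X. -/
open CategoryTheory CategoryTheory.Limits AlgebraicGeometry

noncomputable section

namespace EquivariantSix

universe u

instance (B : Scheme.{u}) : HasFiniteProducts (Over B) :=
  CategoryTheory.Over.ConstructProducts.over_finiteProducts_of_finiteWidePullbacks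

/-- A morphism of schemes is flat if all of its stalk maps are flat ring homomorphisms. -/
def FlatHom {X Y : Scheme.{u}} (f : X ⟶ Y) : Prop :=
  ∀ x : X, RingHom.Flat (f.stalkMap x).hom

/-- A morphism of schemes is of finite presentation if it is locally of finite presentation,
quasi-compact and quasi-separated. -/
def FinPresHom {X Y : Scheme.{u}} (f : X ⟶ Y) : Prop :=
  LocallyOfFinitePresentation f ∧ QuasiCompact f ∧ QuasiSeparated f

/-- A scheme is quasi-compact and quasi-separated. -/
def QCQS (X : Scheme.{u}) : Prop :=
  CompactSpace X ∧ QuasiSeparatedSpace X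

/-- A group scheme over a base scheme `B`, i.e. a group object in the category of
`B`-schemes (with its cartesian monoidal structure given by fibre products over `B`). -/
structure GrpOver (B : Scheme.{u}) where
  carrier : Over B
  mul : carrier ⨯ carrier ⟶ carrier
  one : ⊤_ (Over B) ⟶ carrier
  inv : carrier ⟶ carrier
  mul_assoc : prod.map mul (𝟙 carrier) ≫ mul =
    (prod.associator carrier carrier carrier).hom ≫ prod.map (𝟙 carrier) mul ≫ mul
  one_mul : prod.lift (terminal.from carrier ≫ one) (𝟙 carrier) ≫ mul = 𝟙 carrier
  mul_one : prod.lift (𝟙 carrier) (terminal.from carrier ≫ one) ≫ mul = 𝟙 carrier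
  mul_left_inv : prod.lift inv (𝟙 carrier) ≫ mul = terminal.from carrier ≫ one

/-- The underlying scheme of a group scheme. -/
def GrpOver.sch {B : Scheme.{u}} (G : GrpOver B) : Scheme.{u} := G.carrier.left

/-- The structure morphism of a group scheme. -/
def GrpOver.π {B : Scheme.{u}} (G : GrpOver B) : G.sch ⟶ B := G.carrier.hom

/-- The group scheme `G` over `B` is flat and of finite presentation. -/
def GrpOver.FlatFinPres {B : Scheme.{u}} (G : GrpOver B) : Prop :=
  FlatHom G.π ∧ FinPresHom G.π

variable {B : Scheme.{u}} {G : GrpOver B}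

/-- A `G`-scheme: a `B`-scheme equipped with an action of the group scheme `G`. -/
structure GScheme (B : Scheme.{u}) (G : GrpOver B) where
  carrier : Over B
  act : G.carrier ⨯ carrier ⟶ carrier
  one_act : prod.lift (terminal.from carrier ≫ G.one) (𝟙 carrier) ≫ act = 𝟙 carrier
  mul_act : prod.map G.mul (𝟙 carrier) ≫ act =
    (prod.associator G.carrier G.carrier carrier).hom ≫ prod.map (𝟙 G.carrier) act ≫ act

/-- The underlying scheme of a `G`-scheme. -/
def GScheme.sch (x : GScheme B G) : Scheme.{u} := x.carrier.left

/-- The structure morphism of a `G`-scheme. -/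
def GScheme.str (x : GScheme B G) : x.sch ⟶ B := x.carrier.hom

/-- A `G`-morphism, i.e. a `G`-equivariant morphism of `G`-schemes over `B`. -/
structure GHom (x y : GScheme B G) where
  hom : x.carrier ⟶ y.carrier
  equivariant : x.act ≫ hom = prod.map (𝟙 G.carrier) hom ≫ y.act

/-- The underlying morphism of schemes of a `G`-morphism. -/
def GHom.sch {x y : GScheme B G} (f : GHom x y) : x.sch ⟶ y.sch := f.hom.left

/-- The identity `G`-morphism. -/
def GHom.id (x : GScheme B G) : GHom x x where
  hom := 𝟙 x.carrier
  equivariant := by simp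

/-- Composition of `G`-morphisms. -/
def GHom.comp {x y z : GScheme B G} (f : GHom x y) (g : GHom y z) : GHom x z where
  hom := f.hom ≫ g.hom
  equivariant := by
    rw [← Category.assoc, f.equivariant, Category.assoc, g.equivariant,
      ← Category.assoc, prod.map_map, Category.comp_id]

/-- The object of `Over B` underlying a subscheme `ι : V ⟶ X` of a `G`-scheme `x`. -/
def subOver (x : GScheme B G) {V : Scheme.{u}} (ι : V ⟶ x.sch) : Over B :=
  Over.mk (ι ≫ x.str)

/-- The morphism in `Over B` underlying a subscheme of a `G`-scheme. -/
def subHom (x : GScheme B G) {V : Scheme.{u}} (ι : V ⟶ x.sch) : subOver x ι ⟶ x.carrier :=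
  Over.homMk ι rfl

/-- A subscheme `ι : V ⟶ X` of a `G`-scheme is `G`-invariant if the action
`G ×_B X → X` restricts to a morphism `G ×_B V → V`. -/
def IsInvariantSub (x : GScheme B G) {V : Scheme.{u}} (ι : V ⟶ x.sch) : Prop :=
  ∃ r : (G.carrier ⨯ subOver x ι) ⟶ subOver x ι,
    r ≫ subHom x ι = prod.map (𝟙 G.carrier) (subHom x ι) ≫ x.act

/-- An open subscheme of a `G`-scheme is `G`-invariant if the action restricts to it. -/
def IsInvariantOpen (x : GScheme B G) (U : x.sch.Opens) : Prop :=
  IsInvariantSub x U.ι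

end EquivariantSix

namespace EqvThick

universe u

open Scheme.IdealSheafData

/-- ideal of sheaf on Spec -/
def sI {C : CommRingCat.{u}} (I : (Spec C).IdealSheafData) : Ideal C :=
  (I.ideal ⟨⊤, isAffineOpen_top _⟩).comap (Scheme.ΓSpecIso C).inv.hom

/-- sheaf of an ideal -/
def shf (C : CommRingCat.{u}) (J : Ideal C) : (Spec C).IdealSheafData :=
  ofIdealTop (J.comap (Scheme.ΓSpecIso C).hom.hom)

lemma comap_comap_iso {C D : CommRingCat.{u}} (e : C ≅ D) (J : Ideal C) :
    (J.comap e.inv.hom).comap e.hom.hom = J := by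
  rw [Ideal.comap_comap, ← CommRingCat.hom_comp]; simp

lemma comap_comap_iso' {C D : CommRingCat.{u}} (e : C ≅ D) (J : Ideal D) :
    (J.comap e.hom.hom).comap e.inv.hom = J := by
  rw [Ideal.comap_comap, ← CommRingCat.hom_comp]; simp

lemma sI_shf {C : CommRingCat.{u}} (J : Ideal C) : sI (shf C J) = J := by
  have := comap_comap_iso' (Scheme.ΓSpecIso C) J
  simp only [sI, shf, ofIdealTop_ideal]
  convert this
  simp

lemma sI_le_iff {C : CommRingCat.{u}} {I J : (Spec C).IdealSheafData} : sI I ≤ sI J ↔ I ≤ J := by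
  refine ⟨fun h => le_of_isAffine ?_, fun h => Ideal.comap_mono (h _)⟩
  have := Ideal.comap_mono (f := (Scheme.ΓSpecIso C).hom.hom) h
  simpa only [sI, comap_comap_iso] using this

lemma sI_inj {C : CommRingCat.{u}} {I J : (Spec C).IdealSheafData} (h : sI I = sI J) : I = J :=
  le_antisymm (sI_le_iff.1 h.le) (sI_le_iff.1 h.ge)

lemma shf_sI {C : CommRingCat.{u}} (I : (Spec C).IdealSheafData) : shf C (sI I) = I :=
  sI_inj (sI_shf _)

lemma sI_map {A C : CommRingCat.{u}} (φ : A ⟶ C) (I : (Spec C).IdealSheafData) :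
    sI (I.map (Spec.map φ)) = (sI I).comap φ.hom := by
  simp only [sI]
  rw [ideal_map_of_isAffineHom, Ideal.comap_comap, Ideal.comap_comap, ← CommRingCat.hom_comp,
    ← CommRingCat.hom_comp]
  have := Scheme.ΓSpecIso_inv_naturality φ
  rw [this]
  rfl

lemma sI_comap {A C : CommRingCat.{u}} (φ : A ⟶ C) (J : (Spec A).IdealSheafData) :
    sI (J.comap (Spec.map φ)) = (sI J).map φ.hom := by
  apply eq_of_forall_ge_iff
  intro K
  obtain ⟨K, rfl⟩ : ∃ K', K = sI K' := ⟨_, (sI_shf K).symm⟩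
  rw [sI_le_iff, ← le_map_iff_comap_le, ← sI_le_iff, sI_map, Ideal.map_le_iff_le_comap]

/-- evaluation -/
def ev {X : Scheme.{u}} (I : X.IdealSheafData) {C : CommRingCat.{u}} (f : Spec C ⟶ X) : Ideal C :=
  sI (I.comap f)

variable {X Y : Scheme.{u}} {A C : CommRingCat.{u}}

lemma ev_mono {I J : X.IdealSheafData} (h : I ≤ J) (f : Spec C ⟶ X) : ev I f ≤ ev J f :=
  sI_le_iff.2 (comap_mono f h)

lemma ev_comap (I : Y.IdealSheafData) (g : X ⟶ Y) (f : Spec C ⟶ X) :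
    ev (I.comap g) f = ev I (f ≫ g) := by
  rw [ev, ev, comap_comp]

lemma ev_specMap (I : X.IdealSheafData) (φ : A ⟶ C) (f : Spec A ⟶ X) :
    ev I (Spec.map φ ≫ f) = (ev I f).map φ.hom := by
  rw [ev, comap_comp, sI_comap, ev]

lemma ev_id (I : (Spec C).IdealSheafData) : ev I (𝟙 _) = sI I := by
  rw [ev, comap_id]

lemma ev_sup (I J : X.IdealSheafData) (f : Spec C ⟶ X) : ev (I ⊔ J) f = ev I f ⊔ ev J f := by
  apply eq_of_forall_ge_iff
  intro K
  obtain ⟨K, rfl⟩ : ∃ K', K = sI K' := ⟨_, (sI_shf K).symm⟩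
  simp only [ev, sup_le_iff, sI_le_iff, comap_sup]

lemma ev_bot (f : Spec C ⟶ X) : ev ⊥ f = ⊥ := by
  rw [eq_bot_iff]
  obtain ⟨K, hK⟩ : ∃ K', (⊥ : Ideal C) = sI K' := ⟨_, (sI_shf _).symm⟩
  rw [hK, ev, sI_le_iff, comap_bot]; exact bot_le

lemma ev_top (f : Spec C ⟶ X) : ev ⊤ f = ⊤ := by
  rw [eq_top_iff]
  obtain ⟨K, hK⟩ : ∃ K', (⊤ : Ideal C) = sI K' := ⟨_, (sI_shf _).symm⟩
  rw [hK, ev, sI_le_iff, comap_top]; exact le_top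

lemma ev_fromSpec (I : X.IdealSheafData) {W : X.Opens} (hW : IsAffineOpen W) :
    ev I hW.fromSpec = I.ideal ⟨W, hW⟩ := by
  have h1 : hW.fromSpec ''ᵁ ⊤ = W := by
    rw [Scheme.Hom.image_top_eq_opensRange, hW.opensRange_fromSpec]
  have hW' := (isAffineOpen_top (Spec Γ(X, W))).image_of_isOpenImmersion hW.fromSpec
  have h3 : hW.fromSpec.appLE W ⊤ hW.fromSpec_preimage_self.ge =
      (Scheme.ΓSpecIso Γ(X, W)).inv := by
    rw [Scheme.Hom.appLE, hW.fromSpec_app_self, Category.assoc, ← Functor.map_comp]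
    exact (congrArg _ ((Spec Γ(X, W)).presheaf.map_id _)).trans (Category.comp_id _)
  have h2 : (Scheme.ΓSpecIso Γ(X, W)).inv ≫ (hW.fromSpec.appIso ⊤).inv =
      X.presheaf.map (homOfLE h1.le).op := by
    rw [← h3, Scheme.Hom.appLE_appIso_inv]
  have h4 : sI (I.comap hW.fromSpec) =
      (I.ideal ⟨_, hW'⟩).comap (X.presheaf.map (homOfLE h1.le).op).hom := by
    rw [← h2, CommRingCat.hom_comp, ← Ideal.comap_comap]
    unfold sI
    congr 1
    exact ideal_comap_of_isOpenImmersion I hW.fromSpec ⟨⊤, isAffineOpen_top _⟩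
  rw [ev, h4]
  have key : ∀ (W' : X.Opens) (hW' : IsAffineOpen W') (h : W' = W),
     (I.ideal ⟨_, hW'⟩).comap (X.presheaf.map (homOfLE h.le).op).hom = I.ideal ⟨W, hW⟩ := by
    rintro W' hW' rfl
    have : (homOfLE (le_refl W')) = 𝟙 _ := rfl
    rw [this, op_id, X.presheaf.map_id]
    rfl
  exact key _ hW' h1

lemma le_of_ev {I J : X.IdealSheafData}
    (h : ∀ (W : X.Opens) (hW : IsAffineOpen W), ev I hW.fromSpec ≤ ev J hW.fromSpec) : I ≤ J := by
  rintro ⟨W, hW⟩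
  exact (ev_fromSpec I hW).ge.trans ((h W hW).trans (ev_fromSpec J hW).le)

/-- evaluation compatibility -/
lemma comap_ideal {I : Y.IdealSheafData} (f : X ⟶ Y) {U : X.Opens} {V : Y.Opens}
    (hU : IsAffineOpen U) (hV : IsAffineOpen V) (e : U ≤ f ⁻¹ᵁ V) :
    (I.comap f).ideal ⟨U, hU⟩ = (I.ideal ⟨V, hV⟩).map (f.appLE V U e).hom := by
  rw [← ev_fromSpec, ← ev_fromSpec, ev_comap, ← ev_specMap, hV.SpecMap_appLE_fromSpec f hU]

end EqvThick

namespace EqvThick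

universe u

open Scheme.IdealSheafData

section alg
variable {A D : Type*} [CommRing A] [CommRing D]

lemma mem_map_exists {f : A →+* D} {I : Ideal A} {x : D} (hx : x ∈ I.map f) :
    ∃ (n : ℕ) (d : Fin n → D) (a : Fin n → A), (∀ i, a i ∈ I) ∧ ∑ i, d i * f (a i) = x := by
  rw [Ideal.map, Ideal.span, Submodule.mem_span_set'] at hx
  obtain ⟨n, d, g, h⟩ := hx
  choose a ha ha' using fun i => (g i).2
  exact ⟨n, d, a, ha, by rw [← h]; exact Finset.sum_congr rfl fun i _ => by rw [ha', smul_eq_mul]⟩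

lemma flat_map_inf' [Algebra A D] [Module.Flat A D] (I J : Ideal A) :
    (I ⊓ J).map (algebraMap A D) = I.map (algebraMap A D) ⊓ J.map (algebraMap A D) := by
  refine le_antisymm (le_inf (Ideal.map_mono inf_le_left) (Ideal.map_mono inf_le_right)) ?_
  rintro x ⟨hx, hy⟩
  obtain ⟨n, d, a, ha, h⟩ := mem_map_exists hx
  obtain ⟨m, e, b, hb, h'⟩ := mem_map_exists hy
  have : ∑ i : Fin n ⊕ Fin m, (Sum.elim a (fun j => - b j) i) • (Sum.elim d e i) = 0 := by
    simp only [Fintype.sum_sum_type, Sum.elim_inl, Sum.elim_inr, Algebra.smul_def]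
    simp only [map_neg, mul_neg, Finset.sum_neg_distrib, mul_comm _ (d _), mul_comm _ (e _)]
    rw [← sub_eq_add_neg, sub_eq_zero]
    exact h.trans h'.symm
  obtain ⟨k, c, y, h1, h2⟩ := Module.Flat.isTrivialRelation_of_sum_smul_eq_zero (R := A) (M := D) this
  have h3 : x = ∑ j, algebraMap A D (∑ i, a i * c (Sum.inl i) j) * y j := by
    rw [← h]
    simp only [map_sum, Finset.sum_mul]
    rw [Finset.sum_comm]
    refine Finset.sum_congr rfl fun i _ => ?_
    have := h1 (Sum.inl i)
    simp only [Sum.elim_inl] at this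
    rw [this, Finset.sum_mul]
    refine Finset.sum_congr rfl fun j _ => ?_
    rw [Algebra.smul_def, map_mul]
    ring
  rw [h3]
  refine Ideal.sum_mem _ fun j _ => Ideal.mul_mem_right _ _ (Ideal.mem_map_of_mem _ ⟨?_, ?_⟩)
  · exact Ideal.sum_mem _ fun i _ => Ideal.mul_mem_right _ _ (ha i)
  · have := h2 j
    simp only [Fintype.sum_sum_type, Sum.elim_inl, Sum.elim_inr, neg_mul,
      Finset.sum_neg_distrib] at this
    rw [← sub_eq_add_neg, sub_eq_zero] at this
    rw [this]
    exact Ideal.sum_mem _ fun i _ => Ideal.mul_mem_right _ _ (hb i)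

lemma flat_map_inf {f : A →+* D} (hf : f.Flat) (I J : Ideal A) :
    (I ⊓ J).map f = I.map f ⊓ J.map f := by
  let _ := f.toAlgebra
  have : Module.Flat A D := hf
  exact flat_map_inf' I J

lemma flat_colon' [Algebra A D] [Module.Flat A D] (J : Ideal A) (a : A)
    (h : algebraMap A D a ∈ J.map (algebraMap A D)) :
    ∃ (n : ℕ) (y : Fin n → D) (b : Fin n → A), (∀ i, b i * a ∈ J) ∧
      ∑ i, y i * algebraMap A D (b i) = 1 := by
  obtain ⟨m, e, b, hb, h'⟩ := mem_map_exists h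
  have : ∑ i : Unit ⊕ Fin m, (Sum.elim (fun _ => a) (fun j => - b j) i) • (Sum.elim (fun _ => 1) e i) = 0 := by
    simp only [Fintype.sum_sum_type, Sum.elim_inl, Sum.elim_inr, Algebra.smul_def]
    simp only [map_neg, mul_neg, Finset.sum_neg_distrib, mul_comm _ (e _)]
    rw [← sub_eq_add_neg, sub_eq_zero]
    simpa using h'.symm
  obtain ⟨k, c, y, h1, h2⟩ := Module.Flat.isTrivialRelation_of_sum_smul_eq_zero (R := A) (M := D) this
  refine ⟨k, y, c (Sum.inl ()), fun j => ?_, ?_⟩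
  · have := h2 j
    simp only [Fintype.sum_sum_type, Sum.elim_inl, Sum.elim_inr, neg_mul,
      Finset.sum_neg_distrib, Finset.univ_unique, Finset.sum_singleton] at this
    rw [← sub_eq_add_neg, sub_eq_zero] at this
    rw [mul_comm]
    exact this ▸ Ideal.sum_mem _ fun i _ => Ideal.mul_mem_right _ _ (hb i)
  · have := h1 (Sum.inl ())
    simp only [Sum.elim_inl] at this
    rw [this]
    refine Finset.sum_congr rfl fun j _ => ?_
    rw [Algebra.smul_def, mul_comm]

lemma flat_colon {f : A →+* D} (hf : f.Flat) (J : Ideal A) (a : A) (h : f a ∈ J.map f) :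
    ∃ (n : ℕ) (y : Fin n → D) (b : Fin n → A), (∀ i, b i * a ∈ J) ∧ ∑ i, y i * f (b i) = 1 := by
  let _ := f.toAlgebra
  have : Module.Flat A D := hf
  exact flat_colon' J a h

lemma flat_descent {ι : Type*} {D : ι → Type*} [∀ i, CommRing (D i)] (f : ∀ i, A →+* D i)
    (hf : ∀ i, (f i).Flat) (hs : ∀ P : Ideal A, P.IsPrime → ∃ i, ∃ Q : Ideal (D i),
      Q ≠ ⊤ ∧ P ≤ Q.comap (f i)) (I J : Ideal A)
    (h : ∀ i, I.map (f i) ≤ J.map (f i)) : I ≤ J := by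
  intro a ha
  let K : Ideal A := 
    { carrier := {b | b * a ∈ J}
      add_mem' := fun {x y} hx hy => by
        simpa only [Set.mem_ofPred_eq, add_mul] using J.add_mem hx hy
      zero_mem' := by simp
      smul_mem' := fun c x hx => by
        simpa only [Set.mem_ofPred_eq, smul_eq_mul, mul_assoc] using J.mul_mem_left c hx }
  by_cases hK : K = ⊤
  · have : (1 : A) ∈ K := hK ▸ trivial
    simpa [K] using this
  · obtain ⟨P, hP, hKP⟩ := Ideal.exists_le_maximal K hK
    obtain ⟨i, Q, hQ, hPQ⟩ := hs P hP.isPrime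
    obtain ⟨n, y, b, hb, h1⟩ := flat_colon (hf i) J a (h i (Ideal.mem_map_of_mem _ ha))
    refine absurd ((Ideal.eq_top_iff_one Q).2 ?_) hQ
    rw [← h1]
    exact Ideal.sum_mem _ fun j _ => Ideal.mul_mem_left _ _ (hPQ (hKP (hb j)))
end alg

end EqvThick

namespace EqvThick

universe u

open Scheme.IdealSheafData

variable {X Y P R : Scheme.{u}}

lemma le_of_point {I J : X.IdealSheafData}
    (h : ∀ x : X, ∃ (V : X.Opens) (hV : IsAffineOpen V), x ∈ V ∧ I.ideal ⟨V, hV⟩ ≤ J.ideal ⟨V, hV⟩) :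
    I ≤ J := by
  choose V hV hx hI using h
  refine le_of_iSup_eq_top (fun x => ⟨V x, hV x⟩) ?_ hI
  rw [eq_top_iff]
  intro x _
  exact TopologicalSpace.Opens.mem_iSup.2 ⟨x, hx x⟩

lemma exists_affine_pair (f : X ⟶ Y) (x : X) : ∃ (V : X.Opens) (_ : IsAffineOpen V) (W : Y.Opens)
    (_ : IsAffineOpen W), x ∈ V ∧ V ≤ f ⁻¹ᵁ W := by
  obtain ⟨W, hW, hxW, -⟩ := exists_isAffineOpen_mem_and_subset (X := Y) (x := f x) (U := ⊤) trivial
  obtain ⟨V, hV, hxV, hVW⟩ := exists_isAffineOpen_mem_and_subset (X := X) (x := x) (U := f ⁻¹ᵁ W) hxW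
  exact ⟨V, hV, W, hW, hxV, hVW⟩

lemma le_of_pair (f : X ⟶ Y) {I J : X.IdealSheafData}
    (h : ∀ (V : X.Opens) (hV : IsAffineOpen V) (W : Y.Opens) (_ : IsAffineOpen W) (_ : V ≤ f ⁻¹ᵁ W),
      I.ideal ⟨V, hV⟩ ≤ J.ideal ⟨V, hV⟩) : I ≤ J := by
  refine le_of_point fun x => ?_
  obtain ⟨V, hV, W, hW, hxV, hVW⟩ := exists_affine_pair f x
  exact ⟨V, hV, hxV, h V hV W hW hVW⟩

lemma comap_inf (f : X ⟶ Y) [Flat f] (I J : Y.IdealSheafData) :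
    (I ⊓ J).comap f = I.comap f ⊓ J.comap f := by
  refine le_antisymm (le_inf (comap_mono _ inf_le_left) (comap_mono _ inf_le_right)) ?_
  refine le_of_pair f fun V hV W hW e => ?_
  rw [comap_ideal f hV hW e, ideal_inf, ideal_inf, Pi.inf_apply, Pi.inf_apply,
    comap_ideal f hV hW e, comap_ideal f hV hW e, flat_map_inf (f.flat_appLE hW hV e)]

lemma comap_mul (f : X ⟶ Y) (I J : Y.IdealSheafData) :
    (I * J).comap f = I.comap f * J.comap f := by
  refine le_antisymm ?_ ?_
  all_goals
    refine le_of_pair f fun V hV W hW e => ?_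
    rw [comap_ideal f hV hW e, ideal_mul, ideal_mul, Pi.mul_apply, Pi.mul_apply,
      comap_ideal f hV hW e, comap_ideal f hV hW e, Ideal.map_mul]

lemma comap_le_of_flat_surj (q : P ⟶ X) [Flat q] [Surjective q] {I J : X.IdealSheafData}
    (h : I.comap q ≤ J.comap q) : I ≤ J := by
  rintro ⟨W, hW⟩
  change IsAffineOpen W at hW
  refine flat_descent (ι := {V : P.Opens // IsAffineOpen V ∧ V ≤ q ⁻¹ᵁ W})
    (fun V => (q.appLE W V.1 V.2.2).hom) (fun V => q.flat_appLE hW V.2.1 V.2.2) ?_ _ _ ?_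
  · intro p hp
    let x := hW.fromSpec ⟨p, hp⟩
    have hx : x ∈ W := by
      have := hW.range_fromSpec
      exact this.le ⟨_, rfl⟩
    obtain ⟨z, hz⟩ := q.surjective x
    have hzW : z ∈ q ⁻¹ᵁ W := by
      change q z ∈ W
      rw [hz]; exact hx
    obtain ⟨V, hV, hzV, hVW⟩ := exists_isAffineOpen_mem_and_subset hzW
    refine ⟨⟨V, hV, hVW⟩, ?_⟩
    obtain ⟨y, hy⟩ : z ∈ Set.range hV.fromSpec := by rw [hV.range_fromSpec]; exact hzV
    have h1 := hW.SpecMap_appLE_fromSpec q hV hVW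
    have h2 : hW.fromSpec (Spec.map (q.appLE W V hVW) y) = hW.fromSpec ⟨p, hp⟩ := by
      rw [← Scheme.Hom.comp_apply, h1, Scheme.Hom.comp_apply, hy, hz]
    have h3 := hW.fromSpec.injective h2
    refine ⟨y.asIdeal, y.2.ne_top, ?_⟩
    have h4 := congrArg PrimeSpectrum.asIdeal h3
    exact h4.ge
  · rintro ⟨V, hV, hVW⟩
    have := h ⟨V, hV⟩
    rwa [comap_ideal q hV hW hVW, comap_ideal q hV hW hVW] at this

lemma ker_toImage (f : X ⟶ Y) [QuasiCompact f] : f.toImage.ker = ⊥ := by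
  rw [eq_bot_iff]
  refine le_of_point fun x => ?_
  obtain ⟨W, hW, hxW, -⟩ := exists_isAffineOpen_mem_and_subset (X := Y) (x := f.imageι x)
    (U := ⊤) trivial
  refine ⟨f.imageι ⁻¹ᵁ W, hW.preimage _, hxW, ?_⟩
  rw [Scheme.Hom.ker_apply]
  exact ((RingHom.injective_iff_ker_eq_bot _).1 (f.toImage_app_injective ⟨W, hW⟩)).le

lemma map_base_change {f : P ⟶ R} {b : P ⟶ Y} {a : R ⟶ X} {g : Y ⟶ X}
    (H : IsPullback f b a g) [Flat g] [QuasiCompact a] (I : R.IdealSheafData) :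
    (I.map a).comap g = (I.comap f).map b := by
  refine le_antisymm ?_ ?_
  · rw [le_map_iff_comap_le, ← comap_comp, ← H.w, comap_comp]
    exact comap_mono _ (comap_map_le _ _)
  let φ := I.subschemeι ≫ a
  have H1 : IsPullback (pullback.snd f I.subschemeι) (pullback.fst f I.subschemeι ≫ b)
      φ g :=
    ((IsPullback.of_hasPullback f I.subschemeι).flip.paste_vert H)
  have H2 : IsPullback (pullback.snd g φ.imageι) (pullback.fst g φ.imageι) φ.imageι g :=
    (IsPullback.of_hasPullback g φ.imageι).flip
  have H3 : IsPullback (pullback.snd f I.subschemeι) (pullback.fst f I.subschemeι ≫ b)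
      (φ.toImage ≫ φ.imageι) g := by rw [φ.toImage_imageι]; exact H1
  have H4 := H3.of_bot' H2
  have : Flat (pullback.snd g φ.imageι) := inferInstance
  have : IsSchemeTheoreticallyDominant φ.toImage := ⟨ker_toImage φ⟩
  have h5 := IsSchemeTheoreticallyDominant.of_isPullback H4
  have h6 := h5.ker_eq_bot
  have h7 : (I.comap f).map b = (pullback.fst f I.subschemeι ≫ b).ker := by
    rw [Scheme.IdealSheafData.comap, map_ker]
  have h8 := H2.lift_snd (pullback.snd f I.subschemeι ≫ φ.toImage)
    (pullback.fst f I.subschemeι ≫ b) (by rw [Category.assoc, H3.w])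
  rw [h7, ← h8, ← map_ker, h6, map_bot]
  exact (ker_fst_of_isClosedImmersion φ.imageι g).le.trans (by rw [ker_subschemeι]; rfl)

end EqvThick

namespace EqvThick

universe u

open Scheme.IdealSheafData

variable {X Y P R : Scheme.{u}}

/-- local containment -/
def LeAt (I J : X.IdealSheafData) (x : X) : Prop :=
  ∃ (V : X.Opens) (hV : IsAffineOpen V), x ∈ V ∧ I.ideal ⟨V, hV⟩ ≤ J.ideal ⟨V, hV⟩

/-- containment on a set -/
def LeOn (I J : X.IdealSheafData) (S : Set X) : Prop := ∀ x ∈ S, LeAt I J x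

lemma leAt_of_le {I J : X.IdealSheafData} (h : I ≤ J) (x : X) : LeAt I J x := by
  obtain ⟨W, hW, hxW, -⟩ := exists_isAffineOpen_mem_and_subset (X := X) (x := x) (U := ⊤) trivial
  exact ⟨W, hW, hxW, h _⟩

lemma LeAt.mono_right {I J K : X.IdealSheafData} {x : X} (h : LeAt I J x) (h' : J ≤ K) :
    LeAt I K x := by
  obtain ⟨V, hV, hx, h⟩ := h
  exact ⟨V, hV, hx, h.trans (h' _)⟩

lemma LeAt.mono_left {I J K : X.IdealSheafData} {x : X} (h : LeAt I J x) (h' : K ≤ I) :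
    LeAt K J x := by
  obtain ⟨V, hV, hx, h⟩ := h
  exact ⟨V, hV, hx, le_trans (h' _) h⟩

lemma LeAt.nhds {I J : X.IdealSheafData} {x : X} (h : LeAt I J x) {O : X.Opens} (hO : x ∈ O) :
    ∃ (V : X.Opens) (hV : IsAffineOpen V), x ∈ V ∧ V ≤ O ∧ I.ideal ⟨V, hV⟩ ≤ J.ideal ⟨V, hV⟩ := by
  obtain ⟨V, hV, hx, h⟩ := h
  obtain ⟨V', hV', hx', h'⟩ := exists_isAffineOpen_mem_and_subset (X := X) (x := x) (U := V ⊓ O) ⟨hx, hO⟩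
  have hVV : (⟨V', hV'⟩ : X.affineOpens) ≤ ⟨V, hV⟩ := fun z hz => (h' hz).1
  refine ⟨V', hV', hx', fun z hz => (h' hz).2, ?_⟩
  rw [← map_ideal I hVV, ← map_ideal J hVV]
  exact Ideal.map_mono h

lemma leAt_comap {I J : Y.IdealSheafData} (f : X ⟶ Y) {x : X} (h : LeAt I J (f x)) :
    LeAt (I.comap f) (J.comap f) x := by
  obtain ⟨V, hV, hx, h⟩ := h
  obtain ⟨W, hW, hxW, hWV⟩ := exists_isAffineOpen_mem_and_subset (X := X) (x := x) (U := f ⁻¹ᵁ V) hx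
  refine ⟨W, hW, hxW, ?_⟩
  rw [comap_ideal f hW hV hWV, comap_ideal f hW hV hWV]
  exact Ideal.map_mono h

lemma le_of_leAt {I J : X.IdealSheafData} (h : ∀ x, LeAt I J x) : I ≤ J := le_of_point h

lemma comap_le_of_leOn {I J : Y.IdealSheafData} (f : X ⟶ Y) (h : LeOn I J (Set.range f)) :
    I.comap f ≤ J.comap f :=
  le_of_leAt fun x => leAt_comap f (h _ ⟨x, rfl⟩)

lemma le_of_leOn_affine {I J : X.IdealSheafData} {W : X.Opens} (hW : IsAffineOpen W)
    (h : LeOn I J W) : I.ideal ⟨W, hW⟩ ≤ J.ideal ⟨W, hW⟩ := by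
  rw [← ev_fromSpec, ← ev_fromSpec]
  refine sI_le_iff.2 (comap_le_of_leOn _ ?_)
  rw [hW.range_fromSpec]; exact h

lemma exists_lift_affine (j : P ⟶ X) [IsOpenImmersion j] (z : P) :
    ∃ (W : X.Opens) (hW : IsAffineOpen W) (l : Spec Γ(X, W) ⟶ P), j z ∈ W ∧ l ≫ j = hW.fromSpec := by
  obtain ⟨W, hW, hxW, hWV⟩ := exists_isAffineOpen_mem_and_subset (X := X) (x := j z)
    (U := j.opensRange) ⟨z, rfl⟩
  refine ⟨W, hW, IsOpenImmersion.lift j hW.fromSpec ?_, hxW, IsOpenImmersion.lift_fac _ _ _⟩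
  rw [hW.range_fromSpec]; exact hWV

lemma leAt_of_comap {I J : X.IdealSheafData} (j : P ⟶ X) [IsOpenImmersion j] (z : P)
    (h : I.comap j ≤ J.comap j) : LeAt I J (j z) := by
  obtain ⟨W, hW, l, hz, hl⟩ := exists_lift_affine j z
  refine ⟨W, hW, hz, ?_⟩
  rw [← ev_fromSpec, ← ev_fromSpec, ← hl, ← ev_comap, ← ev_comap]
  exact ev_mono h l

lemma leOn_range_iff {I J : X.IdealSheafData} (j : P ⟶ X) [IsOpenImmersion j] :
    LeOn I J (Set.range j) ↔ I.comap j ≤ J.comap j :=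
  ⟨comap_le_of_leOn j, by rintro h _ ⟨z, rfl⟩; exact leAt_of_comap j z h⟩

lemma LeOn.trans {I J K : X.IdealSheafData} {V : X.Opens} (h : LeOn I J V) (h' : LeOn J K V) :
    LeOn I K V := by
  intro x hx
  obtain ⟨W, hW, hxW, hWV, hh⟩ := (h x hx).nhds hx
  exact ⟨W, hW, hxW, hh.trans (le_of_leOn_affine hW fun y hy => h' y (hWV hy))⟩

lemma LeOn.inf {I J K : X.IdealSheafData} {V : X.Opens} (h : LeOn I J V) (h' : LeOn I K V) :
    LeOn I (J ⊓ K) V := by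
  intro x hx
  obtain ⟨W, hW, hxW, hWV, hh⟩ := (h x hx).nhds hx
  exact ⟨W, hW, hxW, le_inf hh (le_of_leOn_affine hW fun y hy => h' y (hWV hy))⟩

lemma LeOn.sup {I J K : X.IdealSheafData} {V : X.Opens} (h : LeOn I K V) (h' : LeOn J K V) :
    LeOn (I ⊔ J) K V := by
  intro x hx
  obtain ⟨W, hW, hxW, hWV, hh⟩ := (h x hx).nhds hx
  exact ⟨W, hW, hxW, sup_le hh (le_of_leOn_affine hW fun y hy => h' y (hWV hy))⟩

/-- saturation -/
def sat (V : X.Opens) (J : X.IdealSheafData) : X.IdealSheafData := (J.comap V.ι).map V.ι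

lemma le_sat_iff {V : X.Opens} {I J : X.IdealSheafData} : I ≤ sat V J ↔ LeOn I J V := by
  rw [sat, le_map_iff_comap_le, ← leOn_range_iff, Scheme.Opens.range_ι]

lemma le_sat (V : X.Opens) (J : X.IdealSheafData) : J ≤ sat V J := le_map_comap _ _

lemma sat_comap (f : X ⟶ Y) [Flat f] (V : Y.Opens) [QuasiCompact V.ι] (J : Y.IdealSheafData) :
    (sat V J).comap f = sat (f ⁻¹ᵁ V) (J.comap f) := by
  have H := isPullback_morphismRestrict f V
  rw [sat, sat, map_base_change H, ← comap_comp, ← comap_comp, H.w]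

lemma comap_map_openImm (j : P ⟶ X) [IsOpenImmersion j] [QuasiCompact j] (K : P.IdealSheafData) :
    (K.map j).comap j = K := by
  have H : IsPullback (𝟙 P) (𝟙 P) j j := IsKernelPair.id_of_mono j
  rw [map_base_change H, comap_id, map_id]

/-- finite generation at a point -/
def FGAt (I : X.IdealSheafData) (x : X) : Prop :=
  ∃ (V : X.Opens) (hV : IsAffineOpen V), x ∈ V ∧ (I.ideal ⟨V, hV⟩).FG

/-- finitely generated -/
def FG (I : X.IdealSheafData) : Prop := ∀ x, FGAt I x

lemma FGAt.nhds {I : X.IdealSheafData} {x : X} (h : FGAt I x) {O : X.Opens} (hO : x ∈ O) :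
    ∃ (V : X.Opens) (hV : IsAffineOpen V), x ∈ V ∧ V ≤ O ∧ (I.ideal ⟨V, hV⟩).FG := by
  obtain ⟨V, hV, hx, h⟩ := h
  obtain ⟨V', hV', hx', h'⟩ := exists_isAffineOpen_mem_and_subset (X := X) (x := x) (U := V ⊓ O) ⟨hx, hO⟩
  have hVV : (⟨V', hV'⟩ : X.affineOpens) ≤ ⟨V, hV⟩ := fun z hz => (h' hz).1
  refine ⟨V', hV', hx', fun z hz => (h' hz).2, ?_⟩
  rw [← map_ideal I hVV]
  exact h.map _

lemma fgAt_comap {I : Y.IdealSheafData} (f : X ⟶ Y) {x : X} (h : FGAt I (f x)) :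
    FGAt (I.comap f) x := by
  obtain ⟨V, hV, hx, h⟩ := h
  obtain ⟨W, hW, hxW, hWV⟩ := exists_isAffineOpen_mem_and_subset (X := X) (x := x) (U := f ⁻¹ᵁ V) hx
  refine ⟨W, hW, hxW, ?_⟩
  rw [comap_ideal f hW hV hWV]
  exact h.map _

lemma FG.comap {I : Y.IdealSheafData} (h : FG I) (f : X ⟶ Y) : FG (I.comap f) :=
  fun _ => fgAt_comap f (h _)

lemma fg_affine {I : X.IdealSheafData} {W : X.Opens} (hW : IsAffineOpen W)
    (h : ∀ x ∈ W, FGAt I x) : (I.ideal ⟨W, hW⟩).FG := by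
  have : ∀ x : W, ∃ r : Γ(X, W), x.1 ∈ X.basicOpen r ∧ (I.ideal ⟨_, hW.basicOpen r⟩).FG := by
    rintro ⟨x, hx⟩
    obtain ⟨V, hV, hxV, hV'⟩ := h x hx
    obtain ⟨r, s, hrs, hxr⟩ := exists_basicOpen_le_affine_inter hW hV x ⟨hx, hxV⟩
    refine ⟨r, hxr, ?_⟩
    have : (⟨_, hW.basicOpen r⟩ : X.affineOpens) ≤ ⟨V, hV⟩ := by
      change X.basicOpen r ≤ V
      rw [hrs]; exact X.basicOpen_le s
    rw [← map_ideal I this]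
    exact hV'.map _
  choose r hr hfg using this
  refine Ideal.fg_of_localizationSpan (Set.range r) ?_ ?_
  · rw [← hW.iSup_basicOpen_eq_self_iff]
    refine le_antisymm (iSup_le fun i => X.basicOpen_le _) fun x hx => ?_
    exact TopologicalSpace.Opens.mem_iSup.2 ⟨⟨_, ⟨x, hx⟩, rfl⟩, hr _⟩
  · rintro ⟨_, x, rfl⟩
    have := hW.isLocalization_basicOpen (r x)
    let e := IsLocalization.algEquiv (Submonoid.powers (r x)) Γ(X, X.basicOpen (r x))
      (Localization.Away (r x))
    have h1 : algebraMap Γ(X, W) (Localization.Away (r x)) =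
        (e : _ →+* _).comp (algebraMap Γ(X, W) Γ(X, X.basicOpen (r x))) := by
      ext z; simp
    change (Ideal.map (algebraMap Γ(X, W) (Localization.Away (r x))) _).FG
    rw [h1, ← Ideal.map_map]
    apply Ideal.FG.map
    have h2 := map_ideal I (U := ⟨_, hW.basicOpen (r x)⟩) (V := ⟨W, hW⟩) (X.basicOpen_le _)
    have h3 := hfg x
    rw [← h2] at h3
    exact h3

lemma FG.ideal {I : X.IdealSheafData} (h : FG I) {W : X.Opens} (hW : IsAffineOpen W) :
    (I.ideal ⟨W, hW⟩).FG := fg_affine hW fun x _ => h x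

lemma FG.ev {I : X.IdealSheafData} (h : FG I) {C : CommRingCat.{u}} (f : Spec C ⟶ X) :
    (ev I f).FG := by
  have := (h.comap f).ideal (isAffineOpen_top _)
  unfold EqvThick.ev sI
  convert this.map (Scheme.ΓSpecIso C).hom.hom using 1
  exact Ideal.comap_symm (Scheme.ΓSpecIso C).commRingCatIsoToRingEquiv

lemma fgAt_of_comap {I : X.IdealSheafData} (j : P ⟶ X) [IsOpenImmersion j] (z : P)
    (h : FG (I.comap j)) : FGAt I (j z) := by
  obtain ⟨W, hW, l, hz, hl⟩ := exists_lift_affine j z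
  refine ⟨W, hW, hz, ?_⟩
  rw [← ev_fromSpec, ← hl, ← ev_comap]
  exact h.ev l

lemma FGAt.congr {I J : X.IdealSheafData} {V : X.Opens} (h : LeOn I J V) (h' : LeOn J I V)
    {x : X} (hx : x ∈ V) (hI : FGAt I x) : FGAt J x := by
  obtain ⟨W, hW, hxW, hWV, hh⟩ := hI.nhds hx
  refine ⟨W, hW, hxW, ?_⟩
  rwa [← le_antisymm (le_of_leOn_affine hW fun y hy => h y (hWV hy))
    (le_of_leOn_affine hW fun y hy => h' y (hWV hy))]

lemma FG.sup {I J : X.IdealSheafData} (hI : FG I) (hJ : FG J) : FG (I ⊔ J) := by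
  intro x
  obtain ⟨W, hW, hxW, -⟩ := exists_isAffineOpen_mem_and_subset (X := X) (x := x) (U := ⊤) trivial
  exact ⟨W, hW, hxW, Submodule.FG.sup (hI.ideal hW) (hJ.ideal hW)⟩

lemma FG.mul {I J : X.IdealSheafData} (hI : FG I) (hJ : FG J) : FG (I * J) := by
  intro x
  obtain ⟨W, hW, hxW, -⟩ := exists_isAffineOpen_mem_and_subset (X := X) (x := x) (U := ⊤) trivial
  exact ⟨W, hW, hxW, Submodule.FG.mul (hI.ideal hW) (hJ.ideal hW)⟩

lemma FG.bot : FG (⊥ : X.IdealSheafData) := by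
  intro x
  obtain ⟨W, hW, hxW, -⟩ := exists_isAffineOpen_mem_and_subset (X := X) (x := x) (U := ⊤) trivial
  exact ⟨W, hW, hxW, Submodule.fg_bot⟩

lemma FG.top : FG (⊤ : X.IdealSheafData) := by
  intro x
  obtain ⟨W, hW, hxW, -⟩ := exists_isAffineOpen_mem_and_subset (X := X) (x := x) (U := ⊤) trivial
  exact ⟨W, hW, hxW, ⟨{1}, by simp⟩⟩

lemma FG.of_sI {C : CommRingCat.{u}} {I : (Spec C).IdealSheafData} (h : (sI I).FG) : FG I := by
  intro x
  refine ⟨⊤, isAffineOpen_top _, trivial, ?_⟩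
  have := h.map (Scheme.ΓSpecIso C).inv.hom
  convert this using 1
  have h1 := Ideal.map_symm (I := sI I) (Scheme.ΓSpecIso C).commRingCatIsoToRingEquiv
  refine Eq.trans ?_ h1.symm
  exact (comap_comap_iso (Scheme.ΓSpecIso C) _).symm

lemma FG.shf {C : CommRingCat.{u}} {J : Ideal C} (h : J.FG) : FG (shf C J) :=
  FG.of_sI (by rwa [sI_shf])

end EqvThick

namespace EqvThick

universe u

open Scheme.IdealSheafData

variable {X Y P R : Scheme.{u}}

lemma exists_fg_le {A D : Type*} [CommRing A] [CommRing D] (φ : A →+* D) (E : Ideal A) (J : Ideal D)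
    (M : Ideal D) (hM : M.FG) (h : M ≤ J ⊔ E.map φ) :
    ∃ T : Ideal A, T ≤ E ∧ T.FG ∧ M ≤ J ⊔ T.map φ := by
  classical
  obtain ⟨s, rfl⟩ := hM
  have key : ∀ x ∈ s, ∃ T : Ideal A, T ≤ E ∧ T.FG ∧ x ∈ J ⊔ T.map φ := by
    intro x hx
    obtain ⟨y, hy, z, hz, rfl⟩ := Submodule.mem_sup.1 (h (Ideal.subset_span hx))
    obtain ⟨n, d, a, ha, rfl⟩ := mem_map_exists hz
    refine ⟨Ideal.span (Set.range a), ?_, ?_, ?_⟩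
    · rw [Ideal.span_le]; rintro _ ⟨i, rfl⟩; exact ha i
    · exact Submodule.fg_span (Set.finite_range a)
    · refine Submodule.add_mem_sup hy (Ideal.sum_mem _ fun i _ => Ideal.mul_mem_left _ _ ?_)
      exact Ideal.mem_map_of_mem _ (Ideal.subset_span ⟨i, rfl⟩)
  choose! T hT hfg hx using key
  refine ⟨s.sup T, Finset.sup_le hT, ?_, ?_⟩
  · exact Submodule.fg_finset_sup s T hfg
  · rw [Ideal.span_le]
    intro x hxs
    have h4 : T x ≤ s.sup T := Finset.le_sup hxs
    have h5 : J ⊔ (T x).map φ ≤ J ⊔ (s.sup T).map φ := sup_le_sup_left (Ideal.map_mono h4) _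
    exact h5 (hx x hxs)

lemma le_map_of_leOn (f : P ⟶ X) [QuasiCompact f] {I : X.IdealSheafData} {K : P.IdealSheafData}
    {V : X.Opens} (h : LeOn (I.comap f) K (f ⁻¹ᵁ V : P.Opens)) : LeOn I (K.map f) V := by
  have H := isPullback_morphismRestrict f V
  rw [← Scheme.Opens.range_ι V, leOn_range_iff, map_base_change H.flip, le_map_iff_comap_le,
    ← comap_comp, H.w, comap_comp, ← leOn_range_iff, Scheme.Opens.range_ι]
  exact h

lemma ideal_spec {C : CommRingCat.{u}} {V : (Spec C).Opens}
    (hV : IsAffineOpen V) : ∃ φ : C ⟶ Γ(Spec C, V), ∀ J : (Spec C).IdealSheafData,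
      J.ideal ⟨V, hV⟩ = (sI J).map φ.hom := by
  refine ⟨Spec.preimage hV.fromSpec, fun J => ?_⟩
  rw [← ev_fromSpec, ← ev_id, ← ev_specMap, Spec.map_preimage, Category.comp_id]

lemma exists_fg_spec {C : CommRingCat.{u}} (J : (Spec C).IdealSheafData) {O : Set (Spec C)}
    (hO : IsCompact O) (h : ∀ x ∈ O, FGAt J x) :
    ∃ T : Ideal C, T ≤ sI J ∧ T.FG ∧ LeOn J (shf C T) O := by
  refine IsCompact.induction_on (p := fun s => ∃ T : Ideal C, T ≤ sI J ∧ T.FG ∧ LeOn J (shf C T) s)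
    hO ?_ ?_ ?_ ?_
  · exact ⟨⊥, bot_le, Submodule.fg_bot, fun x hx => hx.elim⟩
  · rintro s t hst ⟨T, h1, h2, h3⟩
    exact ⟨T, h1, h2, fun x hx => h3 x (hst hx)⟩
  · rintro s t ⟨T, h1, h2, h3⟩ ⟨T', h1', h2', h3'⟩
    refine ⟨T ⊔ T', sup_le h1 h1', Submodule.FG.sup h2 h2', ?_⟩
    rintro x (hx | hx)
    · exact (h3 x hx).mono_right (by rw [← sI_le_iff, sI_shf, sI_shf]; exact le_sup_left)
    · exact (h3' x hx).mono_right (by rw [← sI_le_iff, sI_shf, sI_shf]; exact le_sup_right)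
  · intro x hx
    obtain ⟨V, hV, hxV, hfg⟩ := h x hx
    obtain ⟨φ, hφ⟩ := ideal_spec hV
    rw [hφ] at hfg
    obtain ⟨T, h1, h2, h3⟩ := exists_fg_le φ.hom (sI J) ⊥ _ hfg (by simp)
    refine ⟨V, mem_nhdsWithin_of_mem_nhds (V.isOpen.mem_nhds hxV), T, h1, h2, fun y hy => ?_⟩
    refine ⟨V, hV, hy, ?_⟩
    rw [hφ, hφ, sI_shf]
    simpa using h3

lemma ext0 [CompactSpace X] [QuasiSeparatedSpace X] {V : X.Opens} (hV : IsCompact (V : Set X))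
    (E : X.IdealSheafData) (hE : ∀ x ∈ V, FGAt E x) :
    ∃ F, F ≤ E ∧ FG F ∧ LeOn E F V := by
  have key : ∀ V' : X.Opens, IsCompact (V' : Set X) →
      ∃ F, F ≤ E ∧ (∀ x ∈ V', FGAt F x) ∧ LeOn E F V := by
    intro V' hV'
    refine compact_open_induction_on V' hV' ?_ ?_
    · exact ⟨E, le_rfl, fun x hx => hx.elim, fun x hx => leAt_of_le le_rfl _⟩
    · rintro V' hV' ⟨W, hW⟩ ⟨F, hFE, hF, hFV⟩
      change IsAffineOpen W at hW
      have hFV' : ∀ x ∈ V' ⊔ V, FGAt F x := by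
        rintro x (hx | hx)
        · exact hF x hx
        · exact FGAt.congr hFV (fun y hy => leAt_of_le hFE y) hx (hE x hx)
      have hqc : QuasiCompact hW.fromSpec := inferInstance
      have hc : IsCompact ((V' ⊔ V : X.Opens) : Set X) := by
        rw [TopologicalSpace.Opens.coe_sup]; exact hV'.union hV
      obtain ⟨T, h1, h2, h3⟩ := exists_fg_spec (F.comap hW.fromSpec)
        (O := hW.fromSpec ⁻¹ᵁ (V' ⊔ V)) (hW.fromSpec.isCompact_preimage (U := V' ⊔ V) hc)
        (fun x hx => fgAt_comap _ (hFV' _ hx))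
      have h4 := le_map_of_leOn hW.fromSpec h3
      have h5 : LeOn F (F ⊓ (shf _ T).map hW.fromSpec) (V' ⊔ V : X.Opens) :=
        LeOn.inf (fun x _ => leAt_of_le le_rfl x) h4
      refine ⟨F ⊓ (shf _ T).map hW.fromSpec, inf_le_left.trans hFE, ?_, ?_⟩
      · rintro x (hx | hx)
        · exact FGAt.congr h5 (fun y _ => leAt_of_le inf_le_left y)
            (show x ∈ V' ⊔ V from Or.inl hx) (hF x hx)
        · refine ⟨W, hW, hx, ?_⟩
          rw [← ev_fromSpec, ← Category.id_comp hW.fromSpec, ← ev_comap, Category.id_comp, comap_inf,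
            comap_map_openImm, inf_eq_right.2, ev_id, sI_shf]
          · exact h2
          · rw [← sI_le_iff, sI_shf]; exact h1
      · exact LeOn.trans hFV (fun x hx => h5 x (Or.inr hx))
  obtain ⟨F, h1, h2, h3⟩ := key ⊤ isCompact_univ
  exact ⟨F, h1, fun x => h2 x trivial, h3⟩

lemma ext5 [CompactSpace X] [QuasiSeparatedSpace X] (j : P ⟶ X) [IsOpenImmersion j]
    [CompactSpace P] {K : P.IdealSheafData} (hK : FG K)
    {E : X.IdealSheafData} (h : K ≤ E.comap j) : ∃ F, F ≤ E ∧ FG F ∧ F.comap j = K := by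
  have : QuasiCompact j := inferInstance
  have h0 : (E ⊓ K.map j).comap j = K := by
    rw [comap_inf, comap_map_openImm, inf_eq_right.2 h]
  obtain ⟨F, h1, h2, h3⟩ := ext0 (V := j.opensRange) (isCompact_range j.continuous)
    (E ⊓ K.map j) (by
      rintro _ ⟨z, rfl⟩
      exact fgAt_of_comap j z (by rwa [h0]))
  refine ⟨F, h1.trans inf_le_left, h2, le_antisymm ?_ ?_⟩
  · rw [← h0]; exact comap_mono _ h1
  · conv_lhs => rw [← h0]
    exact (leOn_range_iff j).1 h3

lemma ext5' [CompactSpace X] [QuasiSeparatedSpace X] [CompactSpace R] (p : R ⟶ X)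
    {I J : R.IdealSheafData} (hI : FG I) {E : X.IdealSheafData} (h : I ≤ J ⊔ E.comap p) :
    ∃ F, F ≤ E ∧ FG F ∧ I ≤ J ⊔ F.comap p := by
  have key : ∃ F, F ≤ E ∧ FG F ∧ LeOn I (J ⊔ F.comap p) Set.univ := by
    refine IsCompact.induction_on (p := fun s => ∃ F, F ≤ E ∧ FG F ∧ LeOn I (J ⊔ F.comap p) s)
      isCompact_univ ?_ ?_ ?_ ?_
    · exact ⟨⊥, bot_le, FG.bot, fun x hx => hx.elim⟩
    · rintro s t hst ⟨T, h1, h2, h3⟩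
      exact ⟨T, h1, h2, fun x hx => h3 x (hst hx)⟩
    · rintro s t ⟨T, h1, h2, h3⟩ ⟨T', h1', h2', h3'⟩
      refine ⟨T ⊔ T', sup_le h1 h1', h2.sup h2', ?_⟩
      rintro x (hx | hx)
      · exact (h3 x hx).mono_right (sup_le_sup_left (comap_mono _ le_sup_left) _)
      · exact (h3' x hx).mono_right (sup_le_sup_left (comap_mono _ le_sup_right) _)
    · intro x _
      obtain ⟨V, hV, W, hW, hxV, hVW⟩ := exists_affine_pair p x
      have h6 := h ⟨V, hV⟩
      rw [ideal_sup, Pi.sup_apply, comap_ideal p hV hW hVW] at h6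
      obtain ⟨T, h1, h2, h3⟩ := exists_fg_le _ _ _ _ (hI.ideal hV) h6
      obtain ⟨F, h1', h2', h3'⟩ := ext5 hW.fromSpec (K := shf _ T) (FG.shf h2) (E := E)
        (by rw [← sI_le_iff, sI_shf]; exact h1.trans (ev_fromSpec E hW).ge)
      refine ⟨V, mem_nhdsWithin_of_mem_nhds (V.isOpen.mem_nhds hxV), F, h1', h2', fun y hy => ?_⟩
      refine ⟨V, hV, hy, ?_⟩
      rw [ideal_sup, Pi.sup_apply, comap_ideal p hV hW hVW, ← ev_fromSpec F, ev, h3', sI_shf]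
      exact h3
  obtain ⟨F, h1, h2, h3⟩ := key
  exact ⟨F, h1, h2, le_of_leAt fun x => h3 x trivial⟩

/-- pullback of the sheaf attached to an ideal of the base -/
def bc {B : CommRingCat.{u}} (y : X ⟶ Spec B) (c : Ideal B) : X.IdealSheafData := (shf B c).comap y

lemma bc_comp {B : CommRingCat.{u}} (f : P ⟶ X) (y : X ⟶ Spec B) (c : Ideal B) :
    (bc y c).comap f = bc (f ≫ y) c := by
  rw [bc, bc, ← comap_comp]

lemma ev_bc {B C : CommRingCat.{u}} (f : Spec C ⟶ X) (y : X ⟶ Spec B) (φ : B ⟶ C)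
    (h : f ≫ y = Spec.map φ) (c : Ideal B) : ev (bc y c) f = c.map φ.hom := by
  rw [bc, ev_comap, h, ← Category.comp_id (Spec.map φ), ev_specMap, ev_id, sI_shf]

lemma bc_mono {B : CommRingCat.{u}} (y : X ⟶ Spec B) {c d : Ideal B} (h : c ≤ d) :
    bc y c ≤ bc y d := comap_mono _ (by rwa [← sI_le_iff, sI_shf, sI_shf])

lemma le_of_ev' {I J : X.IdealSheafData}
    (h : ∀ (C : CommRingCat.{u}) (f : Spec C ⟶ X), IsOpenImmersion f → ev I f ≤ ev J f) : I ≤ J :=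
  le_of_ev fun _ hW => h _ hW.fromSpec inferInstance

lemma bc_sup {B : CommRingCat.{u}} (y : X ⟶ Spec B) (c d : Ideal B) :
    bc y (c ⊔ d) = bc y c ⊔ bc y d := by
  unfold bc
  rw [← comap_sup]
  congr 1
  apply sI_inj
  have := ev_sup (shf B c) (shf B d) (𝟙 _)
  rw [ev_id, ev_id, ev_id] at this
  rw [this, sI_shf, sI_shf, sI_shf]

lemma ev_mul {C : CommRingCat.{u}} (I J : X.IdealSheafData) (f : Spec C ⟶ X) :
    ev (I * J) f = ev I f * ev J f := by
  rw [ev, comap_mul, ev, ev, sI, sI, sI, ideal_mul, Pi.mul_apply]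
  have h1 := Ideal.comap_symm (I := (I.comap f).ideal ⟨⊤, isAffineOpen_top _⟩)
    (Scheme.ΓSpecIso C).commRingCatIsoToRingEquiv
  have h2 := Ideal.comap_symm (I := (J.comap f).ideal ⟨⊤, isAffineOpen_top _⟩)
    (Scheme.ΓSpecIso C).commRingCatIsoToRingEquiv
  have h3 := Ideal.comap_symm (I := (I.comap f).ideal ⟨⊤, isAffineOpen_top _⟩ * (J.comap f).ideal ⟨⊤, isAffineOpen_top _⟩)
    (Scheme.ΓSpecIso C).commRingCatIsoToRingEquiv
  refine h3.trans (Eq.trans (Ideal.map_mul _ _ _) (congrArg₂ _ h1.symm h2.symm))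

lemma bc_mul {B : CommRingCat.{u}} (y : X ⟶ Spec B) (c d : Ideal B) :
    bc y (c * d) = bc y c * bc y d := by
  unfold bc
  rw [← comap_mul]
  congr 1
  apply sI_inj
  have := ev_mul (shf B c) (shf B d) (𝟙 _)
  rw [ev_id, ev_id, ev_id] at this
  rw [this, sI_shf, sI_shf, sI_shf]

lemma bc_top {B : CommRingCat.{u}} (y : X ⟶ Spec B) : bc y (⊤ : Ideal B) = ⊤ := by
  rw [bc, eq_top_iff, ← comap_top y]
  exact comap_mono _ (by rw [← sI_le_iff, sI_shf]; exact le_top)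

lemma bc_bot {B : CommRingCat.{u}} (y : X ⟶ Spec B) : bc y (⊥ : Ideal B) = ⊥ := by
  rw [bc, eq_bot_iff, ← comap_bot y]
  exact comap_mono _ (by rw [← sI_le_iff, sI_shf]; exact bot_le)

lemma FG.bc {B : CommRingCat.{u}} (y : X ⟶ Spec B) {c : Ideal B} (hc : c.FG) :
    FG (bc y c) := (FG.shf hc).comap y

lemma isMul_le_left (I J : X.IdealSheafData) : I * J ≤ I := fun W => by
  simp only [ideal_mul, Pi.mul_apply]; exact Ideal.mul_le_left (I := I.ideal W) (J := J.ideal W)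

lemma isMul_le_right (I J : X.IdealSheafData) : I * J ≤ J := fun W => by
  simp only [ideal_mul, Pi.mul_apply]; exact Ideal.mul_le_right (I := I.ideal W) (J := J.ideal W)

lemma isMul_mono {I J I' J' : X.IdealSheafData} (h : I ≤ I') (h' : J ≤ J') : I * J ≤ I' * J' :=
  fun W => by rw [ideal_mul, ideal_mul, Pi.mul_apply]; exact Ideal.mul_mono (h W) (h' W)

lemma isMul_sup (I J K : X.IdealSheafData) : I * (J ⊔ K) = I * J ⊔ I * K := by
  apply le_antisymm
  all_goals
    intro W
    simp only [ideal_mul, ideal_sup, Pi.mul_apply, Pi.sup_apply, Ideal.mul_sup, le_refl]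

lemma isSup_mul (I J K : X.IdealSheafData) : (I ⊔ J) * K = I * K ⊔ J * K := by
  apply le_antisymm
  all_goals
    intro W
    simp only [ideal_mul, ideal_sup, Pi.mul_apply, Pi.sup_apply, Ideal.sup_mul, le_refl]

lemma isMul_assoc (I J K : X.IdealSheafData) : (I * J) * K = I * (J * K) := by
  apply le_antisymm
  all_goals
    intro W
    simp only [ideal_mul, Pi.mul_apply, mul_assoc, le_refl]

lemma isTop_mul (I : X.IdealSheafData) : ⊤ * I = I := by
  apply le_antisymm
  all_goals
    intro W
    simp only [ideal_mul, ideal_top, Pi.mul_apply, Pi.top_apply, Ideal.top_mul, le_refl]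

lemma pow_mul_le {A S : Type*} [CommRing A] [CommRing S] [Algebra A S] (h : A)
    [IsLocalization.Away h S] {I J : Ideal A} (hI : I.FG)
    (hIJ : I.map (algebraMap A S) ≤ J.map (algebraMap A S)) :
    ∃ N, ∀ n ≥ N, Ideal.span {h ^ n} * I ≤ J := by
  classical
  obtain ⟨s, rfl⟩ := hI
  have key : ∀ x ∈ s, ∃ N, h ^ N * x ∈ J := by
    intro x hx
    obtain ⟨m, ⟨N, rfl⟩, hm⟩ := (IsLocalization.algebraMap_mem_map_algebraMap_iff
      (Submonoid.powers h) S J x).1 (hIJ (Ideal.mem_map_of_mem _ (Ideal.subset_span hx)))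
    exact ⟨N, hm⟩
  choose! N hN using key
  refine ⟨s.sup N, fun n hn => ?_⟩
  rw [Ideal.span_singleton_mul_le_iff]
  intro z hz
  have : Ideal.span (s : Set A) ≤ J.colon {h ^ n} := by
    rw [Ideal.span_le]
    intro x hx
    rw [SetLike.mem_coe, Submodule.mem_colon_singleton]
    have h1 : N x ≤ n := (Finset.le_sup hx).trans hn
    obtain ⟨k, rfl⟩ := Nat.exists_eq_add_of_le h1
    rw [pow_add, smul_eq_mul]
    have := J.mul_mem_left (h ^ k) (hN x hx)
    convert this using 1; ring
  have := Submodule.mem_colon_singleton.1 (this hz)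
  rwa [smul_eq_mul, mul_comm] at this

/-- basic open of the base -/
def DB {B : CommRingCat.{u}} (h : B) : (Spec B).Opens := PrimeSpectrum.basicOpen h

lemma mem_DB {B : CommRingCat.{u}} (h : B) (z : Spec B) : z ∈ DB h ↔ h ∉ z.asIdeal := Iff.rfl

lemma mem_basicOpen_of_unit {B C : CommRingCat.{u}} (φ : B ⟶ C) (h : B) (hu : IsUnit (φ.hom h))
    (z : Spec C) : (Spec.map φ) z ∈ DB h := by
  rw [mem_DB]
  intro hz
  exact z.2.ne_top (Ideal.eq_top_of_isUnit_mem _ hz hu)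

lemma ext6 {B : CommRingCat.{u}} [CompactSpace R] (y : R ⟶ Spec B) (h : B)
    {I J : R.IdealSheafData} (hI : FG I)
    (hIJ : LeOn I J (y ⁻¹ᵁ DB h : R.Opens)) :
    ∃ N : ℕ, bc y (Ideal.span {h ^ N}) * I ≤ J := by
  have key : ∃ N : ℕ, ∀ n ≥ N, LeOn (bc y (Ideal.span {h ^ n}) * I) J Set.univ := by
    refine IsCompact.induction_on
      (p := fun s => ∃ N : ℕ, ∀ n ≥ N, LeOn (bc y (Ideal.span {h ^ n}) * I) J s)
      isCompact_univ ?_ ?_ ?_ ?_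
    · exact ⟨0, fun n _ x hx => hx.elim⟩
    · rintro s t hst ⟨T, h1⟩
      exact ⟨T, fun n hn x hx => h1 n hn x (hst hx)⟩
    · rintro s t ⟨T, h1⟩ ⟨T', h1'⟩
      refine ⟨max T T', ?_⟩
      rintro n hn x (hx | hx)
      · exact h1 n (le_trans (le_max_left _ _) hn) x hx
      · exact h1' n (le_trans (le_max_right _ _) hn) x hx
    · intro x _
      obtain ⟨V, hV, hxV, -⟩ := exists_isAffineOpen_mem_and_subset (X := R) (x := x) (U := ⊤) trivial
      let φ := Spec.preimage (hV.fromSpec ≫ y)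
      have hφ : hV.fromSpec ≫ y = Spec.map φ := (Spec.map_preimage _).symm
      let L := CommRingCat.of (Localization.Away (φ.hom h))
      let ψ : Γ(R, V) ⟶ L := CommRingCat.ofHom (algebraMap _ (Localization.Away (φ.hom h)))
      have h1 : ev I (Spec.map ψ ≫ hV.fromSpec) ≤ ev J (Spec.map ψ ≫ hV.fromSpec) := by
        refine sI_le_iff.2 (comap_le_of_leOn _ ?_)
        rintro _ ⟨z, rfl⟩
        refine hIJ _ ?_
        change y ((Spec.map ψ ≫ hV.fromSpec) z) ∈ DB h
        have h2 : y ((Spec.map ψ ≫ hV.fromSpec) z) = Spec.map (φ ≫ ψ) z := by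
          rw [Spec.map_comp, ← hφ]; simp
        rw [h2]
        apply mem_basicOpen_of_unit
        exact IsLocalization.Away.algebraMap_isUnit (S := Localization.Away (φ.hom h)) (φ.hom h)
      rw [ev_specMap, ev_specMap, ev_fromSpec, ev_fromSpec] at h1
      obtain ⟨N, hN⟩ := pow_mul_le (S := Localization.Away (φ.hom h)) (φ.hom h) (hI.ideal hV) h1
      refine ⟨V, mem_nhdsWithin_of_mem_nhds (V.isOpen.mem_nhds hxV), N, fun n hn z hz => ?_⟩
      refine ⟨V, hV, hz, ?_⟩
      rw [← ev_fromSpec, ev_mul, ev_bc _ _ _ hφ, ev_fromSpec, Ideal.map_span,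
        Set.image_singleton, map_pow]
      exact hN n hn
  obtain ⟨N, hN⟩ := key
  exact ⟨N, le_of_leAt fun x => hN N le_rfl x trivial⟩

end EqvThick

namespace EqvThick

universe u

open MvPolynomial in
lemma groebner_free {D : Type*} [CommRing D] [IsDomain D] {n : ℕ}
    (I : Ideal (MvPolynomial (Fin n) D)) :
    ∃ (h : D) (Std : Set (Fin n →₀ ℕ)), h ≠ 0 ∧
      (∀ f ∈ I, (∀ c ∈ f.support, c ∈ Std) → f = 0) ∧
      ∀ f, ∃ (k : ℕ) (r : MvPolynomial (Fin n) D), (∀ c ∈ r.support, c ∈ Std) ∧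
        C (h ^ k) * f - r ∈ I := by
  classical
  let m : MonomialOrder (Fin n) := MonomialOrder.lex
  let LM : Set (Fin n →₀ ℕ) := {d | ∃ f ∈ I, f ≠ 0 ∧ m.degree f = d}
  let MLM : Set (Fin n →₀ ℕ) := {d | Minimal (· ∈ LM) d}
  have hfin : MLM.Finite := by
    refine WellQuasiOrderedLE.finite_of_isAntichain ?_
    exact setOfPred_minimal_antichain _
  have hex : ∀ d ∈ MLM, ∃ f ∈ I, f ≠ 0 ∧ m.degree f = d := fun d hd => hd.1
  choose! b hbI hb0 hbd using hex
  let h : D := ∏ d ∈ hfin.toFinset, m.leadingCoeff (b d)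
  have h0 : h ≠ 0 := by
    refine Finset.prod_ne_zero_iff.2 fun d hd => ?_
    rw [MonomialOrder.leadingCoeff_ne_zero_iff]
    exact hb0 d (hfin.mem_toFinset.1 hd)
  have hdvd : ∀ d ∈ MLM, ∃ h', h = m.leadingCoeff (b d) * h' := fun d hd =>
    Finset.dvd_prod_of_mem _ (hfin.mem_toFinset.2 hd)
  refine ⟨h, LMᶜ, h0, ?_, ?_⟩
  · intro f hf hs
    by_contra hne
    exact hs _ (m.degree_mem_support hne) ⟨f, hf, hne, rfl⟩
  · have key : ∀ s : m.syn, ∀ f : MvPolynomial (Fin n) D, (∀ c ∈ f.support, m.toSyn c ≤ s) →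
        ∃ (k : ℕ) (r : MvPolynomial (Fin n) D), (∀ c ∈ r.support, c ∈ LMᶜ) ∧
        C (h ^ k) * f - r ∈ I := by
      intro s
      induction s using WellFoundedLT.induction with
      | ind s ih =>
        intro f hf
        have ih' : ∀ f' : MvPolynomial (Fin n) D, (∀ c ∈ f'.support, m.toSyn c ≤ s) →
            f'.coeff (m.toSyn.symm s) = 0 → ∃ (k : ℕ) (r : MvPolynomial (Fin n) D),
              (∀ c ∈ r.support, c ∈ LMᶜ) ∧ C (h ^ k) * f' - r ∈ I := by
          intro f' h1 h2
          by_cases hf0 : f' = 0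
          · exact ⟨0, 0, by simp, by simp [hf0]⟩
          · have h3 := m.degree_mem_support hf0
            refine ih (m.toSyn (m.degree f')) (lt_of_le_of_ne (h1 _ h3) ?_) f' fun c hc => m.le_degree hc
            rintro rfl
            rw [AddEquiv.symm_apply_apply, ← notMem_support_iff] at h2
            exact h2 h3
        set d := m.toSyn.symm s with hd
        have hds : m.toSyn d = s := by simp [hd]
        by_cases hdL : d ∈ LM
        · obtain ⟨d', hd'd, hd'⟩ := exists_minimal_le_of_wellFoundedLT (· ∈ LM) d hdL
          obtain ⟨h', hh'⟩ := hdvd d' hd'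
          have hdeg := hbd d' hd'
          let g := monomial (d - d') (h' * f.coeff d) * b d'
          have hg1 : m.toSyn (m.degree (monomial (d - d') (h' * f.coeff d))) ≤ m.toSyn (d - d') :=
            m.degree_monomial_le _
          have hg2 : m.toSyn (m.degree g) ≤ m.toSyn d := by
            refine m.degree_mul_le.trans ?_
            rw [map_add, hdeg]
            refine (add_le_add_left hg1 _).trans ?_
            rw [← map_add, tsub_add_cancel_of_le hd'd]
          have hg3 : g.coeff d = h * f.coeff d := by
            have := m.coeff_mul_of_add_of_degree_le (f := monomial (d - d') (h' * f.coeff d))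
              (g := b d') (a := d - d') (b := d') hg1 (by rw [hdeg])
            rw [tsub_add_cancel_of_le hd'd] at this
            rw [this, hh', coeff_monomial, if_pos rfl, MonomialOrder.leadingCoeff, hdeg]; ring
          obtain ⟨k, r, hr, hk⟩ := ih' (C h * f - g) (by
            intro c hc
            rcases Finset.mem_union.1 (support_sub _ _ _ hc) with hc | hc
            · refine hf c ?_
              rw [mem_support_iff, coeff_C_mul] at hc
              rw [mem_support_iff]
              exact right_ne_zero_of_mul hc
            · rw [← hds]; exact (m.le_degree hc).trans hg2) (by
            rw [coeff_sub, hg3, coeff_C_mul, sub_self])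
          refine ⟨k + 1, r, hr, ?_⟩
          have hgI : C (h ^ k) * g ∈ I := I.mul_mem_left _ (I.mul_mem_left _ (hbI d' hd'))
          convert I.add_mem hk hgI using 1
          rw [pow_succ, C_mul]; ring
        · obtain ⟨k, r, hr, hk⟩ := ih' (f - monomial d (f.coeff d)) (by
            intro c hc
            rcases Finset.mem_union.1 (support_sub _ _ _ hc) with hc | hc
            · exact hf c hc
            · have := Finset.mem_singleton.1 (support_monomial_subset hc)
              rw [this, hds]) (by simp)
          refine ⟨k, r + monomial d (h ^ k * f.coeff d), ?_, ?_⟩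
          · intro c hc
            rcases Finset.mem_union.1 (support_add hc) with hc | hc
            · exact hr c hc
            · have := Finset.mem_singleton.1 (support_monomial_subset hc)
              rw [this]; exact hdL
          · convert hk using 1
            rw [mul_sub, C_mul_monomial]; ring
    intro f
    exact key (m.toSyn (m.degree f)) f fun c hc => m.le_degree hc

end EqvThick

namespace EqvThick

universe u

open TensorProduct

/-- generic freeness data -/
structure GD {B₀ Γ₀ : Type*} [CommRing B₀] [CommRing Γ₀] [Algebra B₀ Γ₀] (c : Ideal B₀) (h : B₀)
    {ι : Type*} (γ : ι → Γ₀) : Prop where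
  inj : ∀ a : ι →₀ B₀, Finsupp.linearCombination B₀ γ a ∈ c.map (algebraMap B₀ Γ₀) → ∀ i, a i ∈ c
  tors : ∀ g : Γ₀, ∃ (k : ℕ) (a : ι →₀ B₀),
    algebraMap B₀ Γ₀ (h ^ k) * g - Finsupp.linearCombination B₀ γ a ∈ c.map (algebraMap B₀ Γ₀)

lemma exists_GD {B₀ Γ₀ : Type u} [CommRing B₀] [CommRing Γ₀] [Algebra B₀ Γ₀]
    [Algebra.FiniteType B₀ Γ₀] (c : Ideal B₀) [c.IsPrime] :
    ∃ (h : B₀) (ι : Type) (γ : ι → Γ₀), h ∉ c ∧ GD c h γ := by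
  classical
  obtain ⟨n, π, hπ⟩ := Algebra.FiniteType.iff_quotient_mvPolynomial''.1 ‹Algebra.FiniteType B₀ Γ₀›
  let q := Ideal.Quotient.mk c
  have hq : Function.Surjective q := Ideal.Quotient.mk_surjective
  let Q := MvPolynomial.map (σ := Fin n) q
  have hQ : Function.Surjective Q := MvPolynomial.map_surjective q hq
  let I := (RingHom.ker π.toRingHom).map Q
  obtain ⟨h', Std, h0, H1, H2⟩ := groebner_free I
  obtain ⟨h, rfl⟩ := hq h'
  -- π f ∈ cΓ iff Q f ∈ I
  have key : ∀ f, π f ∈ c.map (algebraMap B₀ Γ₀) ↔ Q f ∈ I := by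
    intro f
    have hker : RingHom.ker Q = c.map MvPolynomial.C := by
      change RingHom.ker (MvPolynomial.map q) = _
      rw [MvPolynomial.ker_map, Ideal.mk_ker]
    have h1 : Q f ∈ I ↔ f ∈ RingHom.ker π.toRingHom ⊔ RingHom.ker Q := by
      rw [← Ideal.comap_map_of_surjective' Q hQ, Ideal.mem_comap]
    have h2 : c.map (algebraMap B₀ Γ₀) = (c.map MvPolynomial.C).map π.toRingHom := by
      rw [Ideal.map_map]
      congr 1
      ext b
      exact (AlgHom.commutes π b).symm
    have h3 : π f ∈ (c.map MvPolynomial.C).map π.toRingHom ↔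
        f ∈ (c.map MvPolynomial.C) ⊔ RingHom.ker π.toRingHom := by
      rw [← Ideal.comap_map_of_surjective' π.toRingHom hπ, Ideal.mem_comap]; rfl
    rw [h1, h2, h3, hker, sup_comm]
  let poly : (Std →₀ B₀) →ₗ[B₀] MvPolynomial (Fin n) B₀ :=
    Finsupp.linearCombination B₀ (fun i : Std => MvPolynomial.monomial i.1 (1 : B₀))
  have hpoly : ∀ a : Std →₀ B₀, Finsupp.linearCombination B₀
      (fun i : Std => π (MvPolynomial.monomial i.1 1)) a = π (poly a) := by
    intro a
    simp only [poly, Finsupp.linearCombination_apply, Finsupp.sum, map_sum, map_smul]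
  have hcoeff : ∀ (a : Std →₀ B₀) (i : Std), (poly a).coeff i.1 = a i := by
    intro a i
    simp only [poly, Finsupp.linearCombination_apply, Finsupp.sum, MvPolynomial.coeff_sum,
      MvPolynomial.coeff_smul, MvPolynomial.coeff_monomial, smul_eq_mul, mul_ite, mul_one, mul_zero]
    simp only [← Subtype.ext_iff, Finset.sum_ite_eq']
    by_cases hi : a i = 0
    · simp [hi]
    · simp [hi]
  have hsupp : ∀ (a : Std →₀ B₀), ∀ d ∉ Std, (poly a).coeff d = 0 := by
    intro a d hd
    simp only [poly, Finsupp.linearCombination_apply, Finsupp.sum, MvPolynomial.coeff_sum,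
      MvPolynomial.coeff_smul, MvPolynomial.coeff_monomial, smul_eq_mul, mul_ite, mul_one, mul_zero]
    refine Finset.sum_eq_zero fun i _ => if_neg ?_
    rintro rfl
    exact hd i.2
  refine ⟨h, Std, fun i => π (MvPolynomial.monomial i.1 1), ?_, ?_, ?_⟩
  · intro hh
    exact h0 (Ideal.Quotient.eq_zero_iff_mem.2 hh)
  · intro a ha i
    rw [hpoly, key] at ha
    have := H1 _ ha (by
      intro d hd
      by_contra hdS
      rw [MvPolynomial.mem_support_iff, MvPolynomial.coeff_map, hsupp a d hdS, map_zero] at hd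
      exact hd rfl)
    have h2 : (Q (poly a)).coeff i.1 = 0 := by rw [this]; rfl
    rw [MvPolynomial.coeff_map, hcoeff] at h2
    exact Ideal.Quotient.eq_zero_iff_mem.1 h2
  · intro g
    obtain ⟨f, rfl⟩ := hπ g
    obtain ⟨k, r, hr, hk⟩ := H2 (Q f)
    obtain ⟨r', rfl⟩ := hQ r
    let a : Std →₀ B₀ := Finsupp.onFinset (r'.support.subtype (· ∈ Std)) (fun i => r'.coeff i.1)
      (fun i hi => by rw [Finset.mem_subtype, MvPolynomial.mem_support_iff]; exact hi)
    have ha : ∀ i : Std, a i = r'.coeff i.1 := fun i => rfl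
    refine ⟨k, a, ?_⟩
    rw [hpoly, ← AlgHom.commutes π, ← map_mul, ← map_sub, key, map_sub, map_mul]
    have h5 : Q (poly a) = Q r' := by
      ext d
      rw [MvPolynomial.coeff_map, MvPolynomial.coeff_map]
      by_cases hd : d ∈ Std
      · rw [hcoeff a ⟨d, hd⟩, ha]
      · rw [hsupp a d hd, map_zero]
        by_contra hne
        exact hd (hr d (by rw [MvPolynomial.mem_support_iff, MvPolynomial.coeff_map]; exact Ne.symm hne))
    rw [h5]
    convert hk using 3
    change MvPolynomial.map q (MvPolynomial.C (h ^ k)) = _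
    rw [MvPolynomial.map_C, map_pow]

section
variable {B₀ Γ₀ A N : Type*} [CommRing B₀] [CommRing Γ₀] [Algebra B₀ Γ₀] {c : Ideal B₀} {h : B₀}
    {ι : Type*} {γ : ι → Γ₀} [AddCommGroup N] [Module B₀ N]

lemma GD.exists_coord (hγ : GD c h γ) (hc : ∀ b ∈ c, ∀ ν : N, b • ν = 0)
    (hh : Function.Bijective (fun ν : N => h • ν)) :
    ∃ ψ : N ⊗[B₀] Γ₀ →ₗ[B₀] (ι →₀ N), ∀ ν i, ψ (ν ⊗ₜ γ i) = Finsupp.single i ν := by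
  classical
  let T : N →ₗ[B₀] (ι →₀ B₀) →ₗ[B₀] (ι →₀ N) := LinearMap.mk₂ B₀
    (fun ν a => Finsupp.mapRange (fun b => b • ν) (zero_smul _ _) a)
    (fun ν ν' a => by ext i; simp) (fun b ν a => by ext i; exact smul_comm _ _ _)
    (fun ν a a' => by ext i; simp [add_smul]) (fun b ν a => by ext i; simp [mul_smul])
  have hT : ∀ ν a i, T ν a i = a i • ν := fun ν a i => rfl
  have hinj : ∀ (k : ℕ) (x y : ι →₀ N), h ^ k • x = h ^ k • y → x = y := by
    intro k x y hxy
    induction k with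
    | zero => simpa using hxy
    | succ k ih =>
      apply ih
      ext i
      have := DFunLike.congr_fun hxy i
      simp only [Finsupp.smul_apply, pow_succ', mul_smul] at this
      exact hh.1 this
  have hsurj : ∀ (k : ℕ) (x : ι →₀ N), ∃ y, h ^ k • y = x := by
    choose g hg using hh.2
    intro k
    induction k with
    | zero => intro x; exact ⟨x, by simp⟩
    | succ k ih =>
      intro x
      obtain ⟨y, hy⟩ := ih x
      refine ⟨Finsupp.mapRange g (hh.1 (by simpa using hg 0)) y, ?_⟩
      rw [← hy]
      ext i
      simp only [Finsupp.smul_apply, Finsupp.mapRange_apply, pow_succ, mul_smul]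
      congr 1
      exact hg _
  choose k a hka using hγ.tors
  choose G' hG' using hsurj
  let G : N → Γ₀ → (ι →₀ N) := fun ν g => G' (k g) (T ν (a g))
  have key : ∀ ν g k' a', algebraMap B₀ Γ₀ (h ^ k') * g - Finsupp.linearCombination B₀ γ a' ∈
      c.map (algebraMap B₀ Γ₀) → h ^ k' • G ν g = T ν a' := by
    intro ν g k' a' h1
    apply hinj (k g)
    rw [smul_comm, hG', ← map_smul, ← map_smul]
    have h2 : Finsupp.linearCombination B₀ γ (h ^ k' • a g - h ^ (k g) • a') ∈
        c.map (algebraMap B₀ Γ₀) := by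
      have := Ideal.sub_mem _ (Ideal.mul_mem_left _ (algebraMap B₀ Γ₀ (h ^ k g)) h1)
        (Ideal.mul_mem_left _ (algebraMap B₀ Γ₀ (h ^ k')) (hka g))
      convert this using 1
      rw [map_sub, map_smul, map_smul, Algebra.smul_def, Algebra.smul_def]; ring
    ext i
    have h3 := hc _ (hγ.inj _ h2 i) ν
    rw [Finsupp.sub_apply, sub_smul, sub_eq_zero] at h3
    rw [hT, hT]; exact h3
  have key2 : ∀ ν g x k' a', algebraMap B₀ Γ₀ (h ^ k') * g - Finsupp.linearCombination B₀ γ a' ∈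
      c.map (algebraMap B₀ Γ₀) → h ^ k' • x = T ν a' → G ν g = x := by
    intro ν g x k' a' h1 h2
    exact hinj k' _ _ ((key ν g k' a' h1).trans h2.symm)
  refine ⟨TensorProduct.lift (LinearMap.mk₂ B₀ G ?_ ?_ ?_ ?_), ?_⟩
  · intro ν ν' g
    refine key2 _ _ _ (k g) (a g) (hka g) ?_
    rw [smul_add, hG', hG', map_add]; rfl
  · intro b ν g
    refine key2 _ _ _ (k g) (a g) (hka g) ?_
    rw [smul_comm, hG', map_smul]; rfl
  · intro ν g g'
    refine key2 _ _ _ (k g + k g') (h ^ k g' • a g + h ^ k g • a g') ?_ ?_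
    · have := Ideal.add_mem _ (Ideal.mul_mem_left _ (algebraMap B₀ Γ₀ (h ^ k g')) (hka g))
        (Ideal.mul_mem_left _ (algebraMap B₀ Γ₀ (h ^ k g)) (hka g'))
      convert this using 1
      rw [map_add, map_smul, map_smul, Algebra.smul_def, Algebra.smul_def, pow_add, map_mul]; ring
    · rw [smul_add, map_add, map_smul, map_smul, pow_add, mul_smul, smul_comm, hG', mul_smul, hG']
  · intro b ν g
    refine key2 _ _ _ (k g) (b • a g) ?_ ?_
    · have := Ideal.mul_mem_left _ (algebraMap B₀ Γ₀ b) (hka g)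
      convert this using 1
      rw [map_smul, Algebra.smul_def, Algebra.smul_def]; ring
    · rw [smul_comm, hG', map_smul]
  · intro ν i
    rw [TensorProduct.lift.tmul, LinearMap.mk₂_apply]
    refine key2 _ _ _ 0 (Finsupp.single i 1) (by simp) ?_
    ext j
    rw [hT, Finsupp.smul_apply, pow_zero, one_smul]
    by_cases hij : i = j
    · subst hij; simp
    · simp [hij]
end

end EqvThick

namespace EqvThick

universe u

open TensorProduct

section
variable {B₀ Γ₀ A : Type u} [CommRing B₀] [CommRing Γ₀] [Algebra B₀ Γ₀] {c : Ideal B₀} {h : B₀}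
    {ι : Type} {γ : ι → Γ₀} [CommRing A] [Algebra B₀ A]

variable (Γ₀) in
/-- the left inclusion as ring hom -/
abbrev inc (A : Type u) [CommRing A] [Algebra B₀ A] : A →+* A ⊗[B₀] Γ₀ :=
  (Algebra.TensorProduct.includeLeft (R := B₀) (S := B₀) (A := A) (B := Γ₀)).toRingHom

lemma inc_apply (x : A) : inc Γ₀ A x = x ⊗ₜ[B₀] (1 : Γ₀) := rfl

lemma tmul_mem (E L : Ideal A) (hcE : c.map (algebraMap B₀ A) * E ≤ L) (e : A) (he : e ∈ E)
    (z : Γ₀) (hz : z ∈ c.map (algebraMap B₀ Γ₀)) : e ⊗ₜ[B₀] z ∈ L.map (inc Γ₀ A) := by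
  induction hz using Submodule.closure_induction with
  | zero => simp
  | add x y _ _ hx hy => rw [tmul_add]; exact Ideal.add_mem _ hx hy
  | smul_mem g y hy =>
    obtain ⟨b, hb, rfl⟩ := hy
    have h1 : e ⊗ₜ[B₀] (g • algebraMap B₀ Γ₀ b) =
        ((1 : A) ⊗ₜ[B₀] g) * inc Γ₀ A (algebraMap B₀ A b * e) := by
      rw [inc_apply, Algebra.TensorProduct.tmul_mul_tmul, ← Algebra.smul_def b e, one_mul, mul_one,
        smul_tmul, smul_eq_mul, Algebra.smul_def, mul_comm]
    rw [h1]
    exact Ideal.mul_mem_left _ _ (Ideal.mem_map_of_mem _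
      (hcE (Ideal.mul_mem_mul (Ideal.mem_map_of_mem _ hb) he)))

lemma exists_coeffs (hγ : GD c h γ) (hh : IsUnit (algebraMap B₀ A h)) (L E : Ideal A)
    (hcE : c.map (algebraMap B₀ A) * E ≤ L) (m : A ⊗[B₀] Γ₀) (hm : m ∈ E.map (inc Γ₀ A)) :
    ∃ r : ι →₀ A, (∀ i, r i ∈ E) ∧ m - r.sum (fun i a => a ⊗ₜ[B₀] γ i) ∈ L.map (inc Γ₀ A) := by
  classical
  have hadd : ∀ r r' : ι →₀ A, (r + r').sum (fun i a => a ⊗ₜ[B₀] γ i) =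
      r.sum (fun i a => a ⊗ₜ[B₀] γ i) + r'.sum (fun i a => a ⊗ₜ[B₀] γ i) := by
    intro r r'
    exact Finsupp.sum_add_index' (by simp) (by intro i a b; exact add_tmul _ _ _)
  have add : ∀ m m' : A ⊗[B₀] Γ₀,
      (∃ r : ι →₀ A, (∀ i, r i ∈ E) ∧ m - r.sum (fun i a => a ⊗ₜ[B₀] γ i) ∈ L.map (inc Γ₀ A)) →
      (∃ r : ι →₀ A, (∀ i, r i ∈ E) ∧ m' - r.sum (fun i a => a ⊗ₜ[B₀] γ i) ∈ L.map (inc Γ₀ A)) →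
      (∃ r : ι →₀ A, (∀ i, r i ∈ E) ∧
        m + m' - r.sum (fun i a => a ⊗ₜ[B₀] γ i) ∈ L.map (inc Γ₀ A)) := by
    rintro m m' ⟨r, hr, h1⟩ ⟨r', hr', h2⟩
    refine ⟨r + r', fun i => Ideal.add_mem _ (hr i) (hr' i), ?_⟩
    rw [hadd, add_sub_add_comm]
    exact Ideal.add_mem _ h1 h2
  obtain ⟨u, hu⟩ := hh.exists_left_inv
  induction hm using Submodule.closure_induction with
  | zero => exact ⟨0, by simp, by simp⟩
  | add x y _ _ hx hy => exact add x y hx hy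
  | smul_mem t y hy =>
    obtain ⟨e, he, rfl⟩ := hy
    rw [smul_eq_mul]
    induction t using TensorProduct.induction_on with
    | zero => exact ⟨0, by simp, by simp⟩
    | add x y hx hy => rw [add_mul]; exact add _ _ hx hy
    | tmul a g =>
      obtain ⟨k, s, hs⟩ := hγ.tors g
      have hu' : u ^ k * algebraMap B₀ A (h ^ k) = 1 := by
        rw [map_pow, ← mul_pow, hu, one_pow]
      refine ⟨s.mapRange (fun b => u ^ k * (algebraMap B₀ A b * (a * e))) (by simp), ?_, ?_⟩
      · intro i
        rw [Finsupp.mapRange_apply]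
        exact Ideal.mul_mem_left _ _ (Ideal.mul_mem_left _ _ (Ideal.mul_mem_left _ _ he))
      · have := tmul_mem E L hcE (u ^ k * (a * e))
          (Ideal.mul_mem_left _ _ (Ideal.mul_mem_left _ _ he)) _ hs
        convert this using 1
        rw [tmul_sub]
        congr 1
        · change (a ⊗ₜ[B₀] g) * (e ⊗ₜ[B₀] (1 : Γ₀)) = _
          rw [Algebra.TensorProduct.tmul_mul_tmul, mul_one, ← Algebra.smul_def (h ^ k) g, ← smul_tmul,
            Algebra.smul_def (h ^ k), ← mul_assoc, mul_comm _ (u ^ k), hu', one_mul]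
        · rw [Finsupp.sum_mapRange_index (by simp), Finsupp.linearCombination_apply, Finsupp.sum,
            Finsupp.sum, tmul_sum]
          refine Finset.sum_congr rfl fun i _ => ?_
          rw [← smul_tmul, Algebra.smul_def (s i)]
          congr 1; ring

lemma one_tmul_eq_zero {A' : Type u} [CommRing A'] [Algebra B₀ A'] (K : Ideal A') (w : A' ⊗[B₀] Γ₀)
    (hw : w ∈ K.map (inc Γ₀ A')) : (1 : A' ⧸ K) ⊗ₜ[A'] w = 0 := by
  induction hw using Submodule.closure_induction with
  | zero => simp
  | add x y _ _ hx hy => rw [tmul_add, hx, hy, add_zero]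
  | smul_mem t y hy =>
    obtain ⟨k, hk, rfl⟩ := hy
    have : t • inc Γ₀ A' k = k • t := by
      rw [smul_eq_mul, mul_comm, Algebra.smul_def]; rfl
    rw [this, ← smul_tmul]
    have : k • (1 : A' ⧸ K) = 0 := by
      rw [Algebra.smul_def, mul_one]
      exact Ideal.Quotient.eq_zero_iff_mem.2 hk
    rw [this, zero_tmul]

lemma coeffs_mem {A' : Type u} [CommRing A'] [Algebra B₀ A'] (hγ : GD c h γ)
    (hh : IsUnit (algebraMap B₀ A' h)) (K E : Ideal A') [Module.Flat A' (A' ⊗[B₀] Γ₀)]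
    (hcE : c.map (algebraMap B₀ A') * E ≤ K) (r : ι →₀ A') (hr : ∀ i, r i ∈ E)
    (hs : r.sum (fun i a => a ⊗ₜ[B₀] γ i) ∈ K.map (inc Γ₀ A')) (i : ι) : r i ∈ K := by
  classical
  let N : Submodule A' (A' ⧸ K) := Submodule.map (Submodule.mkQ K) E
  have hN : ∀ ν : N, ∃ e ∈ E, (Submodule.mkQ K e) = ν.1 := fun ν => ν.2
  have hc : ∀ b ∈ c, ∀ ν : N, b • ν = 0 := by
    intro b hb ν
    obtain ⟨e, he, h1⟩ := hN ν
    apply Subtype.ext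
    change b • ν.1 = 0
    rw [← h1, ← algebraMap_smul A' b, ← map_smul]
    exact (Submodule.Quotient.mk_eq_zero K).2 (hcE (Ideal.mul_mem_mul (Ideal.mem_map_of_mem _ hb) he))
  have hbij : Function.Bijective (fun ν : N => h • ν) := by
    obtain ⟨u, hu⟩ := hh
    have e1 : ∀ ν : N, h • ν = (u : A') • ν := fun ν => by rw [hu, algebraMap_smul]
    simp only [e1]
    exact MulAction.bijective (u : A'ˣ)
  obtain ⟨ψ, hψ⟩ := hγ.exists_coord (N := N) hc hbij
  let ρ : ι → N := fun i => ⟨Submodule.mkQ K (r i), ⟨r i, hr i, rfl⟩⟩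
  let z : N ⊗[A'] (A' ⊗[B₀] Γ₀) := ∑ i ∈ r.support, ρ i ⊗ₜ[A'] ((1 : A') ⊗ₜ[B₀] γ i)
  have hz : z = 0 := by
    apply Module.Flat.rTensor_preserves_injective_linearMap (M := A' ⊗[B₀] Γ₀) N.subtype
      N.injective_subtype
    rw [map_zero]
    simp only [z, map_sum, LinearMap.rTensor_tmul]
    rw [← one_tmul_eq_zero K _ hs, Finsupp.sum, tmul_sum]
    refine Finset.sum_congr rfl fun i _ => ?_
    have : N.subtype (ρ i) = r i • (1 : A' ⧸ K) := by
      rw [Algebra.smul_def, mul_one]; rfl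
    rw [this, smul_tmul, smul_tmul', smul_eq_mul, mul_one]
  have h2 : ψ (AlgebraTensorModule.cancelBaseChange B₀ A' A' N Γ₀ z) = 0 := by rw [hz, map_zero, map_zero]
  simp only [z, map_sum, AlgebraTensorModule.cancelBaseChange_tmul, one_smul, hψ] at h2
  have h3 := DFunLike.congr_fun h2 i
  rw [Finsupp.finsetSum_apply] at h3
  by_cases hi : r i = 0
  · rw [hi]; exact zero_mem _
  · rw [Finset.sum_eq_single i (fun j _ hj => by simp [hj])
      (fun hn => absurd (Finsupp.mem_support_iff.2 hi) hn), Finsupp.single_eq_same] at h3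
    exact (Submodule.Quotient.mk_eq_zero K).1 (congrArg Subtype.val h3)

lemma cont_alg (hγ : GD c h γ) (hh : IsUnit (algebraMap B₀ A h)) (L E : Ideal A)
    (hcE : c.map (algebraMap B₀ A) * E ≤ L) (M : Ideal (A ⊗[B₀] Γ₀)) (hM : M.FG)
    (hME : M ≤ E.map (inc Γ₀ A)) :
    ∃ K₀ : Ideal A, K₀ ≤ E ∧ K₀.FG ∧ M ≤ (K₀ ⊔ L).map (inc Γ₀ A) ∧
      ∀ (A' : Type u) [CommRing A'] [Algebra B₀ A'] (φ : A →ₐ[B₀] A'),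
        Module.Flat A' (A' ⊗[B₀] Γ₀) → ∀ K' : Ideal A', L.map φ ≤ K' →
        M.map (Algebra.TensorProduct.map φ (AlgHom.id B₀ Γ₀)) ≤ K'.map (inc Γ₀ A') →
        K₀.map φ ≤ K' := by
  classical
  obtain ⟨s, rfl⟩ := hM
  have hs : ∀ m : s, m.1 ∈ E.map (inc Γ₀ A) := fun m => hME (Ideal.subset_span m.2)
  choose r hr hmr using fun m => exists_coeffs hγ hh L E hcE m.1 (hs m)
  let S : Finset A := s.attach.biUnion fun m => (r m).support.image (r m)
  have hS : ∀ m i, r m i ∈ Ideal.span (S : Set A) := by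
    intro m i
    by_cases hi : r m i = 0
    · rw [hi]; exact zero_mem _
    · apply Ideal.subset_span
      simp only [S, Finset.coe_biUnion, Set.mem_iUnion, Finset.mem_coe, Finset.mem_image]
      exact ⟨m, Finset.mem_attach _ _, i, Finsupp.mem_support_iff.2 hi, rfl⟩
  refine ⟨Ideal.span S, ?_, ⟨S, rfl⟩, ?_, ?_⟩
  · rw [Ideal.span_le]
    intro x hx
    simp only [S, Finset.coe_biUnion, Set.mem_iUnion, Finset.mem_coe, Finset.mem_image] at hx
    obtain ⟨m, _, i, _, rfl⟩ := hx
    exact hr m i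
  · rw [Ideal.span_le]
    intro m hm
    have h1 := hmr ⟨m, hm⟩
    have h2 : (r ⟨m, hm⟩).sum (fun i a => a ⊗ₜ[B₀] γ i) ∈ (Ideal.span S ⊔ L).map (inc Γ₀ A) := by
      refine Ideal.sum_mem _ fun i _ => ?_
      have : (r ⟨m, hm⟩ i) ⊗ₜ[B₀] γ i = ((1 : A) ⊗ₜ γ i) * inc Γ₀ A (r ⟨m, hm⟩ i) := by
        rw [inc_apply, Algebra.TensorProduct.tmul_mul_tmul, one_mul, mul_one]
      simp only [this]
      exact Ideal.mul_mem_left _ _ (Ideal.mem_map_of_mem _ (Ideal.mem_sup_left (hS _ i)))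
    have h3 := Ideal.add_mem _ (Ideal.map_mono (le_sup_right) h1) h2
    rw [sub_add_cancel] at h3
    exact h3
  · intro A' _ _ φ hfl K' hL hMK
    rw [Ideal.map_le_iff_le_comap, Ideal.span_le]
    intro x hx
    simp only [S, Finset.coe_biUnion, Set.mem_iUnion, Finset.mem_coe, Finset.mem_image] at hx
    obtain ⟨m, _, i, _, rfl⟩ := hx
    let r' : ι →₀ A' := (r m).mapRange φ (map_zero φ)
    have hcomp : (φ.toRingHom.comp (algebraMap B₀ A)) = algebraMap B₀ A' := φ.comp_algebraMap
    have hh' : IsUnit (algebraMap B₀ A' h) := by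
      rw [← hcomp]; exact hh.map φ
    have hcE' : c.map (algebraMap B₀ A') * (E.map φ) ≤ K' := by
      refine le_trans ?_ hL
      rw [← hcomp, ← Ideal.map_map]
      change Ideal.map φ _ * _ ≤ _
      rw [← Ideal.map_mul]
      exact Ideal.map_mono hcE
    refine coeffs_mem hγ hh' K' (E.map φ) hcE' r' (fun i => ?_) ?_ i
    · exact Ideal.mem_map_of_mem _ (hr m i)
    · let Φ := Algebra.TensorProduct.map φ (AlgHom.id B₀ Γ₀)
      have e1 : r'.sum (fun i a => a ⊗ₜ[B₀] γ i) = Φ ((r m).sum (fun i a => a ⊗ₜ[B₀] γ i)) := by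
        simp only [r']
        rw [Finsupp.sum_mapRange_index (by simp), Finsupp.sum, Finsupp.sum, map_sum]
        rfl
      rw [e1]
      have h1 : Φ m.1 ∈ K'.map (inc Γ₀ A') :=
        hMK (Ideal.mem_map_of_mem _ (Ideal.subset_span m.2))
      have h2 : Φ (m.1 - (r m).sum (fun i a => a ⊗ₜ[B₀] γ i)) ∈ K'.map (inc Γ₀ A') := by
        have h3 : (L.map (inc Γ₀ A)).map Φ ≤ K'.map (inc Γ₀ A') := by
          rw [Ideal.map_le_iff_le_comap, Ideal.map_le_iff_le_comap]
          intro x hx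
          change Φ (x ⊗ₜ 1) ∈ K'.map (inc Γ₀ A')
          have : Φ (x ⊗ₜ 1) = inc Γ₀ A' (φ x) := by simp [Φ]
          rw [this]
          exact Ideal.mem_map_of_mem _ (hL (Ideal.mem_map_of_mem _ hx))
        exact h3 (Ideal.mem_map_of_mem _ (hmr m))
      have h4 := Ideal.sub_mem _ h1 h2
      rwa [← map_sub, sub_sub_cancel] at h4
end

end EqvThick

namespace EqvThick

universe u

open TensorProduct

section
variable {B₀ Γ₀ : Type u} [CommRing B₀] [CommRing Γ₀] [Algebra B₀ Γ₀] {c : Ideal B₀} {h : B₀}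
    {ι : Type} {γ : ι → Γ₀} {Y : Scheme.{u}}

variable (Γ₀) in
/-- base change of `Spec Γ₀` -/
abbrev PP (y : Y ⟶ Spec (CommRingCat.of B₀)) : Scheme.{u} :=
  pullback (Spec.map (CommRingCat.ofHom (algebraMap B₀ Γ₀))) y

variable (Γ₀) in
/-- the projection -/
abbrev PPπ (y : Y ⟶ Spec (CommRingCat.of B₀)) : PP Γ₀ y ⟶ Y := pullback.snd _ _

variable (Γ₀) in
/-- functoriality -/
abbrev PPm {Y' : Scheme.{u}} (f : Y' ⟶ Y) (y : Y ⟶ Spec (CommRingCat.of B₀)) :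
    PP Γ₀ (f ≫ y) ⟶ PP Γ₀ y :=
  pullback.lift (pullback.fst _ _) (pullback.snd _ _ ≫ f) (by rw [pullback.condition, Category.assoc])

lemma PPm_π {Y' : Scheme.{u}} (f : Y' ⟶ Y) (y : Y ⟶ Spec (CommRingCat.of B₀)) :
    PPm Γ₀ f y ≫ PPπ Γ₀ y = PPπ Γ₀ (f ≫ y) ≫ f := pullback.lift_snd _ _ _

lemma PPm_comp {Y' Y'' : Scheme.{u}} (g : Y'' ⟶ Y') (f : Y' ⟶ Y)
    (y : Y ⟶ Spec (CommRingCat.of B₀)) : ∃ t : PP Γ₀ ((g ≫ f) ≫ y) ⟶ PP Γ₀ (f ≫ y),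
      t ≫ PPm Γ₀ f y = PPm Γ₀ (g ≫ f) y ∧ t ≫ PPπ Γ₀ (f ≫ y) = PPπ Γ₀ ((g ≫ f) ≫ y) ≫ g := by
  refine ⟨pullback.lift (pullback.fst _ _) (pullback.snd _ _ ≫ g)
      (by rw [pullback.condition]; simp only [Category.assoc]), ?_, pullback.lift_snd _ _ _⟩
  apply pullback.hom_ext
  · refine (Category.assoc _ _ _).trans ?_
    rw [pullback.lift_fst, pullback.lift_fst, pullback.lift_fst]
  · refine (Category.assoc _ _ _).trans ?_
    rw [pullback.lift_snd, pullback.lift_snd, pullback.lift_snd_assoc]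
    exact Category.assoc _ _ _

lemma PPm_isPullback {Y' : Scheme.{u}} (f : Y' ⟶ Y) (y : Y ⟶ Spec (CommRingCat.of B₀)) :
    IsPullback (PPm Γ₀ f y) (PPπ Γ₀ (f ≫ y)) (PPπ Γ₀ y) f := by
  refine IsPullback.of_right (h₁₂ := pullback.fst _ _)
    (h₂₂ := y) (v₁₃ := Spec.map (CommRingCat.ofHom (algebraMap B₀ Γ₀))) ?_ (PPm_π f y) ?_
  · rw [pullback.lift_fst]; exact IsPullback.of_hasPullback _ _
  · exact IsPullback.of_hasPullback _ _

instance PPπ_flat {Y' : Scheme.{u}} (f : Y' ⟶ Y) (y : Y ⟶ Spec (CommRingCat.of B₀))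
    [H : Flat (PPπ Γ₀ y)] : Flat (PPπ Γ₀ (f ≫ y)) :=
  MorphismProperty.of_isPullback (P := @Flat) (PPm_isPullback f y) H

/-- `M ≤ K` on the base change -/
def Good (y : Y ⟶ Spec (CommRingCat.of B₀)) (M : (PP Γ₀ y).IdealSheafData) {A : CommRingCat.{u}}
    (f : Spec A ⟶ Y) (K : Ideal A) : Prop :=
  M.comap (PPm Γ₀ f y) ≤ (shf A K).comap (PPπ Γ₀ (f ≫ y))

lemma specTensor_isPullback (A : Type u) [CommRing A] [Algebra B₀ A] :
    IsPullback (Spec.map (CommRingCat.ofHom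
        (Algebra.TensorProduct.includeRight (R := B₀) (A := A) (B := Γ₀)).toRingHom))
      (Spec.map (CommRingCat.ofHom (inc Γ₀ A)))
      (Spec.map (CommRingCat.ofHom (algebraMap B₀ Γ₀))) (Spec.map (CommRingCat.ofHom (algebraMap B₀ A))) :=
  (isPullback_SpecMap_of_isPushout _ _ _ _ (CommRingCat.isPushout_tensorProduct B₀ A Γ₀)).flip

variable (Γ₀) in
/-- tensor chart -/
def mm (y : Y ⟶ Spec (CommRingCat.of B₀)) {A : Type u} [CommRing A] [Algebra B₀ A]
    (f : Spec (CommRingCat.of A) ⟶ Y) (hf : f ≫ y = Spec.map (CommRingCat.ofHom (algebraMap B₀ A))) :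
    Spec (CommRingCat.of (A ⊗[B₀] Γ₀)) ⟶ PP Γ₀ y :=
  pullback.lift (Spec.map (CommRingCat.ofHom
        (Algebra.TensorProduct.includeRight (R := B₀) (A := A) (B := Γ₀)).toRingHom))
    (Spec.map (CommRingCat.ofHom (inc Γ₀ A)) ≫ f)
    (by rw [Category.assoc, hf]; exact (specTensor_isPullback A).w)

lemma mm_π (y : Y ⟶ Spec (CommRingCat.of B₀)) {A : Type u} [CommRing A] [Algebra B₀ A]
    (f : Spec (CommRingCat.of A) ⟶ Y) (hf : f ≫ y = Spec.map (CommRingCat.ofHom (algebraMap B₀ A))) :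
    mm Γ₀ y f hf ≫ PPπ Γ₀ y = Spec.map (CommRingCat.ofHom (inc Γ₀ A)) ≫ f := pullback.lift_snd _ _ _

lemma mm_comp (y : Y ⟶ Spec (CommRingCat.of B₀)) {A A' : Type u} [CommRing A] [Algebra B₀ A]
    [CommRing A'] [Algebra B₀ A'] (φ : A →ₐ[B₀] A')
    (f : Spec (CommRingCat.of A) ⟶ Y) (hf : f ≫ y = Spec.map (CommRingCat.ofHom (algebraMap B₀ A)))
    (hf' : (Spec.map (CommRingCat.ofHom φ.toRingHom) ≫ f) ≫ y =
      Spec.map (CommRingCat.ofHom (algebraMap B₀ A'))) :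
    mm Γ₀ y (Spec.map (CommRingCat.ofHom φ.toRingHom) ≫ f) hf' =
      Spec.map (CommRingCat.ofHom (Algebra.TensorProduct.map φ (AlgHom.id B₀ Γ₀)).toRingHom) ≫
        mm Γ₀ y f hf := by
  apply pullback.hom_ext
  · simp only [mm, pullback.lift_fst, Category.assoc]
    rw [← Spec.map_comp, ← CommRingCat.ofHom_comp]
    congr 2
    ext g
    simp
  · simp only [mm, pullback.lift_snd, Category.assoc]
    rw [← Spec.map_comp_assoc, ← Spec.map_comp_assoc, ← CommRingCat.ofHom_comp,
      ← CommRingCat.ofHom_comp]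
    congr 3

lemma mm_isPullback (y : Y ⟶ Spec (CommRingCat.of B₀)) {A : Type u} [CommRing A] [Algebra B₀ A]
    (f : Spec (CommRingCat.of A) ⟶ Y) (hf : f ≫ y = Spec.map (CommRingCat.ofHom (algebraMap B₀ A))) :
    IsPullback (mm Γ₀ y f hf) (Spec.map (CommRingCat.ofHom (inc Γ₀ A))) (PPπ Γ₀ y) f := by
  refine IsPullback.of_right (h₁₂ := pullback.fst _ _)
    (h₂₂ := y) (v₁₃ := Spec.map (CommRingCat.ofHom (algebraMap B₀ Γ₀))) ?_ (mm_π y f hf) ?_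
  · rw [mm, pullback.lift_fst, hf]; exact specTensor_isPullback A
  · exact IsPullback.of_hasPullback _ _

lemma mm_flat (y : Y ⟶ Spec (CommRingCat.of B₀)) [H : Flat (PPπ Γ₀ y)] {A : Type u} [CommRing A]
    [Algebra B₀ A] (f : Spec (CommRingCat.of A) ⟶ Y)
    (hf : f ≫ y = Spec.map (CommRingCat.ofHom (algebraMap B₀ A))) : Module.Flat A (A ⊗[B₀] Γ₀) := by
  have h1 : Flat (Spec.map (CommRingCat.ofHom (inc Γ₀ A))) :=
    MorphismProperty.of_isPullback (P := @Flat) (mm_isPullback y f hf) H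
  have h2 : (inc Γ₀ A).Flat := Flat.SpecMap_iff.1 h1
  have e : inc Γ₀ A = algebraMap A (A ⊗[B₀] Γ₀) := rfl
  rw [e] at h2
  exact RingHom.flat_algebraMap_iff.1 h2

lemma good_iff (y : Y ⟶ Spec (CommRingCat.of B₀)) (M : (PP Γ₀ y).IdealSheafData)
    {A : Type u} [CommRing A] [Algebra B₀ A]
    (f : Spec (CommRingCat.of A) ⟶ Y) (hf : f ≫ y = Spec.map (CommRingCat.ofHom (algebraMap B₀ A)))
    (K : Ideal A) : Good y M f K ↔ ev M (mm Γ₀ y f hf) ≤ K.map (inc Γ₀ A) := by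
  let θ := (mm_isPullback (Γ₀ := Γ₀) y f hf).isoIsPullback _ _ (PPm_isPullback (Γ₀ := Γ₀) f y)
  have t1 : θ.hom ≫ PPm Γ₀ f y = mm Γ₀ y f hf := IsPullback.isoIsPullback_hom_fst _ _ _ _
  have t2 : θ.hom ≫ PPπ Γ₀ (f ≫ y) = Spec.map (CommRingCat.ofHom (inc Γ₀ A)) :=
    IsPullback.isoIsPullback_hom_snd _ _ _ _
  have e : Good y M f K ↔ M.comap (mm Γ₀ y f hf) ≤
      (shf (CommRingCat.of A) K).comap (Spec.map (CommRingCat.ofHom (inc Γ₀ A))) := by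
    rw [← t1, ← t2, Scheme.IdealSheafData.comap_comp, Scheme.IdealSheafData.comap_comp]
    constructor
    · intro h1; exact Scheme.IdealSheafData.comap_mono _ h1
    · intro h1; exact comap_le_of_flat_surj θ.hom h1
  rw [e, ← sI_le_iff, sI_comap, sI_shf]
  rfl

lemma Good.map {y : Y ⟶ Spec (CommRingCat.of B₀)} {M : (PP Γ₀ y).IdealSheafData}
    {A A' : CommRingCat.{u}} {f : Spec A ⟶ Y} {K : Ideal A} (hK : Good y M f K) (φ : A ⟶ A') :
    Good y M (Spec.map φ ≫ f) (K.map φ.hom) := by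
  obtain ⟨t, t1, t2⟩ := PPm_comp (Γ₀ := Γ₀) (Spec.map φ) f y
  have : (M.comap (PPm Γ₀ f y)).comap t ≤ ((shf A K).comap (PPπ Γ₀ (f ≫ y))).comap t :=
    Scheme.IdealSheafData.comap_mono t hK
  rw [← Scheme.IdealSheafData.comap_comp, ← Scheme.IdealSheafData.comap_comp, t1, t2,
    Scheme.IdealSheafData.comap_comp] at this
  unfold Good
  refine this.trans (le_of_eq ?_)
  congr 1
  apply sI_inj
  rw [sI_comap, sI_shf, sI_shf]

lemma cont_geo (y : Y ⟶ Spec (CommRingCat.of B₀)) [Flat (PPπ Γ₀ y)] (hγ : GD c h γ)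
    (L E : Y.IdealSheafData) (hcE : bc y c * E ≤ L) (M : (PP Γ₀ y).IdealSheafData) (hM : FG M)
    (hME : M ≤ E.comap (PPπ Γ₀ y)) {A : CommRingCat.{u}} (f : Spec A ⟶ Y)
    (hf : ∀ z, (f ≫ y) z ∈ DB (B := CommRingCat.of B₀) h) :
    ∃ K₀ : Ideal A, K₀ ≤ ev E f ∧ K₀.FG ∧ Good y M f (K₀ ⊔ ev L f) ∧
      ∀ (A' : CommRingCat.{u}) (φ : A ⟶ A') (K' : Ideal A'), (ev L f).map φ.hom ≤ K' →
        Good y M (Spec.map φ ≫ f) K' → K₀.map φ.hom ≤ K' := by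
  obtain ⟨χ, hχ⟩ := Spec.map_surjective (f ≫ y)
  let _ : Algebra B₀ A := χ.hom.toAlgebra
  have hf' : f ≫ y = Spec.map (CommRingCat.ofHom (algebraMap B₀ A)) := hχ.symm
  have hu : IsUnit (algebraMap B₀ A h) := by
    by_contra hn
    obtain ⟨m, hm, hmem⟩ := exists_max_ideal_of_mem_nonunits hn
    have := hf ⟨m, hm.isPrime⟩
    rw [← hχ, mem_DB] at this
    exact this hmem
  have hcE' : c.map (algebraMap B₀ A) * ev E f ≤ ev L f := by
    have := ev_mono hcE f
    rw [ev_mul, ev_bc f y χ hχ.symm] at this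
    exact this
  have hME' : ev M (mm Γ₀ y f hf') ≤ (ev E f).map (inc Γ₀ A) := by
    have := ev_mono hME (mm Γ₀ y f hf')
    rw [ev_comap, mm_π, ev_specMap] at this
    exact this
  obtain ⟨K₀, h1, h2, h3, h4⟩ := cont_alg hγ hu (ev L f) (ev E f) hcE' _ (hM.ev (mm Γ₀ y f hf')) hME'
  refine ⟨K₀, h1, h2, (good_iff y M f hf' _).2 h3, ?_⟩
  intro A' φ K' hL hG
  let _ : Algebra B₀ A' := (φ.hom.comp χ.hom).toAlgebra
  let φ' : A →ₐ[B₀] A' := ⟨φ.hom, fun b => rfl⟩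
  have hf2 : (Spec.map φ ≫ f) ≫ y = Spec.map (CommRingCat.ofHom (algebraMap B₀ A')) := by
    rw [Category.assoc, ← hχ, ← Spec.map_comp]; rfl
  refine h4 A' φ' (mm_flat y _ hf2) K' hL ?_
  have := (good_iff y M _ hf2 K').1 hG
  have e := mm_comp (Γ₀ := Γ₀) y φ' f hf' hf2
  change ev M (mm Γ₀ y (Spec.map (CommRingCat.ofHom φ'.toRingHom) ≫ f) hf2) ≤ _ at this
  rw [e, ev_specMap] at this
  exact this

end

end EqvThick

namespace EqvThick

universe u

open TensorProduct

lemma comap_eq_shf {X : Scheme.{u}} (I : X.IdealSheafData) {C : CommRingCat.{u}} (f : Spec C ⟶ X) :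
    I.comap f = shf C (ev I f) := by
  apply sI_inj; rw [sI_shf]; rfl

section
variable {B₀ Γ₀ : Type u} [CommRing B₀] [CommRing Γ₀] [Algebra B₀ Γ₀] {c : Ideal B₀} {h : B₀}
    {ι : Type} {γ : ι → Γ₀} {Y : Scheme.{u}}

lemma content_sheaf (y : Y ⟶ Spec (CommRingCat.of B₀)) [Flat (PPπ Γ₀ y)] (hγ : GD c h γ)
    (hy : ∀ z, y z ∈ DB (B := CommRingCat.of B₀) h)
    (L E : Y.IdealSheafData) (hLE : L ≤ E) (hcE : bc y c * E ≤ L) (M : (PP Γ₀ y).IdealSheafData)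
    (hM : FG M) (hME : M ≤ E.comap (PPπ Γ₀ y)) :
    ∃ K : Y.IdealSheafData, L ≤ K ∧ K ≤ E ∧ M ≤ K.comap (PPπ Γ₀ y) ∧
      (∀ W : Y.affineOpens, ∃ K₀ : Ideal Γ(Y, W), K₀.FG ∧ K.ideal W = K₀ ⊔ L.ideal W) ∧
      ∀ (Y' : Scheme.{u}) (f : Y' ⟶ Y) (K' : Y'.IdealSheafData), L.comap f ≤ K' →
        M.comap (PPm Γ₀ f y) ≤ K'.comap (PPπ Γ₀ (f ≫ y)) → K.comap f ≤ K' := by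
  choose K₀ h1 h2 h3 h4 using fun W : Y.affineOpens =>
    cont_geo y hγ L E hcE M hM hME W.2.fromSpec (fun z => hy _)
  let k : ∀ W : Y.affineOpens, Ideal Γ(Y, W) := fun W => K₀ W ⊔ ev L W.2.fromSpec
  have u4 : ∀ (W : Y.affineOpens) (A' : CommRingCat.{u}) (φ : Γ(Y, W) ⟶ A') (K' : Ideal A'),
      (ev L W.2.fromSpec).map φ.hom ≤ K' → Good y M (Spec.map φ ≫ W.2.fromSpec) K' →
      (k W).map φ.hom ≤ K' := by
    intro W A' φ K' a1 a2
    rw [Ideal.map_sup]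
    exact sup_le (h4 W A' φ K' a1 a2) a1
  have hle : ∀ W W' : Y.affineOpens, ∀ i : (W' : Y.Opens) ≤ W,
      (k W).map (Y.presheaf.map (homOfLE i).op).hom = k W' := by
    intro W W' i
    have e := IsAffineOpen.map_fromSpec W.2 W'.2 (homOfLE i).op
    apply le_antisymm
    · apply u4
      · rw [← ev_specMap, e]; exact le_sup_right
      · rw [e]; exact h3 W'
    · have := u4 W' _ (𝟙 _) ((k W).map (Y.presheaf.map (homOfLE i).op).hom) ?_ ?_
      · rw [CommRingCat.hom_id, Ideal.map_id] at this; exact this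
      · rw [CommRingCat.hom_id, Ideal.map_id, ← e, ev_specMap]
        exact Ideal.map_mono le_sup_right
      · rw [Spec.map_id, Category.id_comp, ← e]
        exact (h3 W).map _
  let K : Y.IdealSheafData := 
    { ideal := k
      map_ideal_basicOpen := fun U f => hle U (Y.affineBasicOpen f) _
      supportSet := ⋂ U, Y.zeroLocus (U := U.1) (k U) }
  have hK : ∀ W : Y.affineOpens, ev K W.2.fromSpec = k W := fun W => ev_fromSpec K W.2
  refine ⟨K, ?_, ?_, ?_, ?_, ?_⟩
  · apply le_of_ev
    intro W hW
    rw [hK ⟨W, hW⟩]; exact le_sup_right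
  · apply le_of_ev
    intro W hW
    rw [hK ⟨W, hW⟩]
    exact sup_le (h1 ⟨W, hW⟩) (ev_mono hLE _)
  · apply le_of_leAt
    intro x
    obtain ⟨W, hW, hx, -⟩ := exists_isAffineOpen_mem_and_subset (U := ⊤)
      (x := PPπ Γ₀ y x) (TopologicalSpace.Opens.mem_top _)
    have oi : IsOpenImmersion (PPm Γ₀ hW.fromSpec y) :=
      MorphismProperty.of_isPullback (P := @IsOpenImmersion)
        (PPm_isPullback (Γ₀ := Γ₀) hW.fromSpec y).flip inferInstance
    have hr : x ∈ Set.range (PPm Γ₀ hW.fromSpec y) := by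
      obtain ⟨z, hz⟩ : PPπ Γ₀ y x ∈ Set.range hW.fromSpec := by rw [hW.range_fromSpec]; exact hx
      obtain ⟨o, ho, -⟩ := Scheme.exists_preimage_of_isPullback
        (PPm_isPullback (Γ₀ := Γ₀) hW.fromSpec y) x z hz.symm
      exact ⟨o, ho⟩
    refine (leOn_range_iff (PPm Γ₀ hW.fromSpec y)).2 ?_ x hr
    have := h3 ⟨W, hW⟩
    rw [← Scheme.IdealSheafData.comap_comp, PPm_π, Scheme.IdealSheafData.comap_comp,
      comap_eq_shf K, hK ⟨W, hW⟩]
    exact this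
  · intro W
    refine ⟨K₀ W, h2 W, ?_⟩
    rw [← ev_fromSpec L W.2]
  · intro Y' f K' hL hMK
    apply le_of_pair f
    intro V hV W hW e
    have e1 := hW.SpecMap_appLE_fromSpec f hV e
    rw [← ev_fromSpec, ← ev_fromSpec, ev_comap]
    have e2 : ev K (hV.fromSpec ≫ f) = (k ⟨W, hW⟩).map (f.appLE W V e).hom := by
      rw [← e1, ev_specMap, hK ⟨W, hW⟩]
    rw [e2]
    refine u4 ⟨W, hW⟩ _ (f.appLE W V e) _ ?_ ?_
    · rw [← ev_specMap, e1, ← ev_comap]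
      exact ev_mono hL _
    · rw [e1]
      obtain ⟨t, t1, t2⟩ := PPm_comp (Γ₀ := Γ₀) hV.fromSpec f y
      have := Scheme.IdealSheafData.comap_mono t hMK
      beta_reduce at this
      rw [← Scheme.IdealSheafData.comap_comp, ← Scheme.IdealSheafData.comap_comp, t1, t2,
        Scheme.IdealSheafData.comap_comp, comap_eq_shf K'] at this
      exact this
end

end EqvThick

namespace EqvThick

universe u

open Scheme.IdealSheafData

/-- A flat groupoid on `X`. -/
structure Gr (X R : Scheme.{u}) where
  p : R ⟶ X
  a : R ⟶ X
  e : X ⟶ R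
  i : R ⟶ R
  e_p : e ≫ p = 𝟙 X
  e_a : e ≫ a = 𝟙 X
  i_p : i ≫ p = a
  i_a : i ≫ a = p
  comp : ∀ (T : Scheme.{u}) (s t : T ⟶ R), s ≫ p = t ≫ a →
    ∃ v : T ⟶ R, v ≫ p = t ≫ p ∧ v ≫ a = s ≫ a
  flat_p : Flat p
  flat_a : Flat a
  qc_p : QuasiCompact p
  qc_a : QuasiCompact a

attribute [instance] Gr.flat_p Gr.flat_a Gr.qc_p Gr.qc_a

lemma cm {X Y : Scheme.{u}} (f : X ⟶ Y) {I J : Y.IdealSheafData} (h : I ≤ J) :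
    I.comap f ≤ J.comap f := Scheme.IdealSheafData.comap_mono f h

lemma sat_mono {X : Scheme.{u}} (V : X.Opens) {I J : X.IdealSheafData} (h : I ≤ J) :
    sat V I ≤ sat V J := by
  rw [le_sat_iff]
  exact (le_sat_iff.1 (le_refl (sat V I))).trans (le_sat_iff.1 (h.trans (le_sat V J)))

lemma sat_sat {X : Scheme.{u}} (V : X.Opens) (J : X.IdealSheafData) :
    sat V (sat V J) ≤ sat V J := by
  rw [le_sat_iff]
  exact (le_sat_iff.1 (le_refl (sat V (sat V J)))).trans (le_sat_iff.1 (le_refl (sat V J)))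

namespace Gr
variable {X R : Scheme.{u}} (S : Gr X R)

/-- invariant ideal -/
def Inv (I : X.IdealSheafData) : Prop := I.comap S.a ≤ I.comap S.p

/-- largest invariant ideal contained in `I` -/
def int (I : X.IdealSheafData) : X.IdealSheafData := (I.comap S.p).map S.a

lemma le_int_iff {I J : X.IdealSheafData} : J ≤ S.int I ↔ J.comap S.a ≤ I.comap S.p :=
  Scheme.IdealSheafData.le_map_iff_comap_le

lemma le_of_comap {I J : X.IdealSheafData} (h : J.comap S.a ≤ I.comap S.p) : J ≤ I := by
  have := cm S.e h
  rwa [← Scheme.IdealSheafData.comap_comp, ← Scheme.IdealSheafData.comap_comp, S.e_a, S.e_p,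
    Scheme.IdealSheafData.comap_id, Scheme.IdealSheafData.comap_id] at this

lemma int_le (I : X.IdealSheafData) : S.int I ≤ I :=
  S.le_of_comap (S.le_int_iff.1 le_rfl)

lemma int_inv (I : X.IdealSheafData) : S.Inv (S.int I) := by
  let fs := pullback.fst S.a S.p
  let sn := pullback.snd S.a S.p
  obtain ⟨v, hv1, hv2⟩ := S.comp _ sn fs pullback.condition.symm
  have H : IsPullback fs sn S.a S.p := IsPullback.of_hasPullback _ _
  unfold Inv
  nth_rewrite 2 [int]
  rw [map_base_change H, Scheme.IdealSheafData.le_map_iff_comap_le,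
    ← Scheme.IdealSheafData.comap_comp, ← hv2, ← Scheme.IdealSheafData.comap_comp, ← hv1,
    Scheme.IdealSheafData.comap_comp, Scheme.IdealSheafData.comap_comp]
  exact cm v (S.le_int_iff.1 le_rfl)

lemma Inv.sup {I J : X.IdealSheafData} (hI : S.Inv I) (hJ : S.Inv J) : S.Inv (I ⊔ J) := by
  unfold Inv at *
  rw [Scheme.IdealSheafData.comap_sup, Scheme.IdealSheafData.comap_sup]
  exact sup_le_sup hI hJ

lemma Inv.inf {I J : X.IdealSheafData} (hI : S.Inv I) (hJ : S.Inv J) : S.Inv (I ⊓ J) := by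
  unfold Inv at *
  rw [comap_inf S.p]
  exact le_inf ((cm _ inf_le_left).trans hI) ((cm _ inf_le_right).trans hJ)

lemma Inv.bc_mul {B : CommRingCat.{u}} {y : X ⟶ Spec B} (hy : S.p ≫ y = S.a ≫ y) (c : Ideal B)
    {I : X.IdealSheafData} (hI : S.Inv I) : S.Inv (bc y c * I) := by
  unfold Inv at *
  rw [comap_mul, comap_mul, bc_comp, bc_comp, hy]
  exact isMul_mono le_rfl hI

lemma inv_bot : S.Inv ⊥ := by
  unfold Inv; rw [Scheme.IdealSheafData.comap_bot]; exact bot_le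

lemma inv_sat {V : X.Opens} [QuasiCompact V.ι] (hV : S.p ⁻¹ᵁ V = S.a ⁻¹ᵁ V) {J : X.IdealSheafData}
    (hJ : J.comap S.a ≤ (sat V J).comap S.p) : S.Inv (sat V J) := by
  unfold Inv
  rw [sat_comap S.a, ← hV]
  refine (sat_mono _ hJ).trans ?_
  rw [← sat_comap S.p]
  exact cm _ (sat_sat V J)

end Gr

/-- A chart for a groupoid. -/
structure Chart {X R : Scheme.{u}} (S : Gr X R) (B₀ Γ₀ : Type u) [CommRing B₀] [CommRing Γ₀]
    [Algebra B₀ Γ₀] where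
  y : X ⟶ Spec (CommRingCat.of B₀)
  hy : S.p ≫ y = S.a ≫ y
  q : PP Γ₀ y ⟶ R
  q_p : q ≫ S.p = PPπ Γ₀ y
  flat_q : Flat q
  surj_q : Surjective q

attribute [instance] Chart.flat_q Chart.surj_q

lemma qc_DB {X : Scheme.{u}} {B : CommRingCat.{u}} (y : X ⟶ Spec B) (h : B) :
    QuasiCompact (y ⁻¹ᵁ DB h).ι := by
  have : QuasiCompact (DB h).ι := by
    have h1 : IsAffineOpen (DB h) := IsAffineOpen.Spec_basicOpen h
    have := h1.isCompact
    have : CompactSpace (DB h).toScheme := isCompact_iff_compactSpace.1 this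
    rw [quasiCompact_iff_compactSpace]
    infer_instance
  exact MorphismProperty.of_isPullback (P := @QuasiCompact)
    (isPullback_morphismRestrict y (DB h)) this

lemma lift_opens {X T : Scheme.{u}} (V : X.Opens) (f : T ⟶ X) (hf : ∀ z, f z ∈ V) :
    ∃ g : T ⟶ V.toScheme, g ≫ V.ι = f := by
  refine ⟨IsOpenImmersion.lift V.ι f ?_, IsOpenImmersion.lift_fac _ _ _⟩
  rintro _ ⟨z, rfl⟩
  rw [Scheme.Opens.range_ι]
  exact hf z

section
variable {X R : Scheme.{u}} {S : Gr X R} {B₀ Γ₀ : Type u} [CommRing B₀] [CommRing Γ₀]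
    [Algebra B₀ Γ₀] (Ch : Chart S B₀ Γ₀) {c : Ideal B₀} {h : B₀}
    {ι : Type} {γ : ι → Γ₀} [CompactSpace X] [QuasiSeparatedSpace X]

lemma content (hγ : GD c h γ) (L E : X.IdealSheafData) (hLE : L ≤ E) (hL : S.Inv L) (hE : S.Inv E)
    (hcE : bc Ch.y c * E ≤ L) (F : X.IdealSheafData) (hF : FG F) (hFE : F ≤ E) :
    ∃ F₁ : X.IdealSheafData, FG F₁ ∧ F ≤ F₁ ∧ F₁ ≤ E ∧
      F₁.comap S.a ≤ (sat (Ch.y ⁻¹ᵁ DB (B := CommRingCat.of B₀) h) (F₁ ⊔ L)).comap S.p := by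
  set V : X.Opens := Ch.y ⁻¹ᵁ DB (B := CommRingCat.of B₀) h with hVdef
  have : QuasiCompact V.ι := qc_DB Ch.y h
  have : CompactSpace V.toScheme := QuasiCompact.compactSpace_of_compactSpace V.ι
  have fl : Flat (PPπ Γ₀ Ch.y) := by rw [← Ch.q_p]; infer_instance
  let j := V.ι
  let y' := j ≫ Ch.y
  let jR := (S.p ⁻¹ᵁ V).ι
  let pV : (S.p ⁻¹ᵁ V).toScheme ⟶ V.toScheme := S.p ∣_ V
  have hpV : pV ≫ j = jR ≫ S.p := morphismRestrict_ι S.p V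
  have hVV : S.p ⁻¹ᵁ V = S.a ⁻¹ᵁ V := by
    rw [hVdef, ← Scheme.Hom.comp_preimage, ← Scheme.Hom.comp_preimage, Ch.hy]
  obtain ⟨aV, haV⟩ : ∃ aV : (S.p ⁻¹ᵁ V).toScheme ⟶ V.toScheme, aV ≫ j = jR ≫ S.a := by
    apply lift_opens
    intro z
    exact hVV.le (show jR z ∈ S.p ⁻¹ᵁ V from z.2)
  obtain ⟨eV, heV⟩ : ∃ eV : V.toScheme ⟶ (S.p ⁻¹ᵁ V).toScheme, eV ≫ jR = j ≫ S.e := by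
    apply lift_opens
    intro z
    change (((j ≫ S.e) ≫ S.p) z) ∈ V
    rw [Category.assoc, S.e_p, Category.comp_id]
    exact z.2
  have heV' : eV ≫ pV = 𝟙 _ := by
    rw [← cancel_mono j, Category.assoc, hpV, ← Category.assoc, heV, Category.assoc, S.e_p]; simp
  -- pullback of the chart
  obtain ⟨qV, hqV⟩ : ∃ qV : PP Γ₀ y' ⟶ (S.p ⁻¹ᵁ V).toScheme, qV ≫ jR = PPm Γ₀ j Ch.y ≫ Ch.q := by
    apply lift_opens
    intro z
    change (((PPm Γ₀ j Ch.y ≫ Ch.q) ≫ S.p) z) ∈ V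
    rw [Category.assoc, Ch.q_p, PPm_π]
    exact (PPπ Γ₀ (j ≫ Ch.y) z).2
  have hqV' : qV ≫ pV = PPπ Γ₀ y' := by
    rw [← cancel_mono j, Category.assoc, hpV, ← Category.assoc, hqV, Category.assoc, Ch.q_p, PPm_π]
  have Hq : IsPullback (PPm Γ₀ j Ch.y) qV Ch.q jR := by
    refine IsPullback.of_bot (v₂₁ := pV) (v₂₂ := S.p) (h₃₁ := j) ?_ hqV.symm ?_
    · rw [hqV', Ch.q_p]; exact PPm_isPullback j Ch.y
    · exact (isPullback_morphismRestrict S.p V).flip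
  have : Flat qV := MorphismProperty.of_isPullback (P := @Flat) Hq inferInstance
  have : Surjective qV := MorphismProperty.of_isPullback (P := @Surjective) Hq inferInstance
  let M : (PP Γ₀ y').IdealSheafData := F.comap (PPm Γ₀ j Ch.y ≫ Ch.q ≫ S.a)
  have hM : FG M := hF.comap _
  have hME : M ≤ (E.comap j).comap (PPπ Γ₀ y') := by
    refine (cm _ hFE).trans ?_
    rw [Scheme.IdealSheafData.comap_comp, Scheme.IdealSheafData.comap_comp]
    refine (cm _ (cm _ hE)).trans ?_
    rw [← Scheme.IdealSheafData.comap_comp, ← Scheme.IdealSheafData.comap_comp, Category.assoc, Ch.q_p, PPm_π,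
      Scheme.IdealSheafData.comap_comp]
  have hcE' : bc y' c * E.comap j ≤ L.comap j := by
    rw [← bc_comp, ← comap_mul]; exact cm _ hcE
  obtain ⟨K, hLK, hKE, hMK, hKfg, hKu⟩ := content_sheaf (Γ₀ := Γ₀) y' hγ (fun z => z.2)
    (L.comap j) (E.comap j) (cm _ hLE) hcE' M hM hME
  have h1 : F.comap (jR ≫ S.a) ≤ K.comap pV := by
    apply comap_le_of_flat_surj qV
    rw [← Scheme.IdealSheafData.comap_comp, ← Scheme.IdealSheafData.comap_comp, hqV', ← Category.assoc,
      hqV, Category.assoc]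
    exact hMK
  have h2 : F.comap j ≤ K := by
    have := cm eV h1
    rwa [← Scheme.IdealSheafData.comap_comp, ← Scheme.IdealSheafData.comap_comp, heV',
      ← Category.assoc, heV, Category.assoc, S.e_a, Category.comp_id,
      Scheme.IdealSheafData.comap_id] at this
  have h3 : K.comap aV ≤ K.comap pV := by
    apply hKu
    · rw [← Scheme.IdealSheafData.comap_comp, haV, Scheme.IdealSheafData.comap_comp]
      refine (cm _ hL).trans ?_
      rw [← Scheme.IdealSheafData.comap_comp, ← hpV, Scheme.IdealSheafData.comap_comp]
      exact cm _ hLK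
    · have gen : ∀ (T : Scheme.{u}) (π'' : T ⟶ (S.p ⁻¹ᵁ V).toScheme) (s : T ⟶ R),
          s ≫ S.p = (π'' ≫ jR) ≫ S.a → F.comap (s ≫ S.a) ≤ (K.comap pV).comap π'' := by
        intro T π'' s hs
        obtain ⟨v, hv1, hv2⟩ := S.comp _ s (π'' ≫ jR) hs
        obtain ⟨κ, hκ⟩ := lift_opens (S.p ⁻¹ᵁ V) v (fun z => by
          change (v ≫ S.p) z ∈ V
          rw [hv1, Category.assoc, ← hpV]
          exact ((π'' ≫ pV) z).2)
        have hκ' : κ ≫ pV = π'' ≫ pV := by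
          rw [← cancel_mono j, Category.assoc, hpV, ← Category.assoc, hκ, hv1, Category.assoc,
            Category.assoc, hpV]
        have := cm κ h1
        rw [← Scheme.IdealSheafData.comap_comp, ← Scheme.IdealSheafData.comap_comp, hκ',
          ← Category.assoc, hκ, hv2] at this
        rw [← Scheme.IdealSheafData.comap_comp]
        exact this
      have := gen _ (PPπ Γ₀ (aV ≫ y')) (PPm Γ₀ aV y' ≫ PPm Γ₀ j Ch.y ≫ Ch.q) (by
        have e1 : (PPm Γ₀ j Ch.y ≫ Ch.q) ≫ S.p = PPπ Γ₀ y' ≫ j := by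
          rw [Category.assoc, Ch.q_p, PPm_π]
        refine (Category.assoc _ _ _).trans ?_
        rw [e1]
        refine (Category.assoc _ _ _).symm.trans ?_
        rw [PPm_π]
        refine (Category.assoc _ _ _).trans ?_
        rw [haV]
        exact (Category.assoc _ _ _).symm)
      refine le_trans (le_of_eq ?_) this
      rw [← Scheme.IdealSheafData.comap_comp]
      congr 1
  let Eb := E ⊓ K.map j
  have hEb : Eb.comap j = K := by
    simp only [Eb]
    rw [comap_inf, comap_map_openImm]
    exact inf_eq_right.2 hKE
  have hFEb : F ≤ Eb := le_inf hFE (Scheme.IdealSheafData.le_map_iff_comap_le.2 h2)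
  obtain ⟨F', hF'E, hF', hKF⟩ : ∃ F' : X.IdealSheafData, F' ≤ Eb ∧ FG F' ∧
      LeOn K (F'.comap j ⊔ L.comap j) Set.univ := by
    refine IsCompact.induction_on (p := fun s => ∃ F' : X.IdealSheafData, F' ≤ Eb ∧ FG F' ∧
      LeOn K (F'.comap j ⊔ L.comap j) s) isCompact_univ ?_ ?_ ?_ ?_
    · exact ⟨⊥, bot_le, FG.bot, fun x hx => hx.elim⟩
    · rintro s t hst ⟨F', h1, h2, h3⟩
      exact ⟨F', h1, h2, fun x hx => h3 x (hst hx)⟩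
    · rintro s t ⟨F', h1, h2, h3⟩ ⟨F'', h1', h2', h3'⟩
      refine ⟨F' ⊔ F'', sup_le h1 h1', h2.sup h2', ?_⟩
      rw [Scheme.IdealSheafData.comap_sup]
      rintro x (hx | hx)
      · exact (h3 x hx).mono_right (sup_le_sup_right le_sup_left _)
      · exact (h3' x hx).mono_right (sup_le_sup_right le_sup_right _)
    · intro x _
      obtain ⟨W, hW, hx, -⟩ := exists_isAffineOpen_mem_and_subset (U := ⊤)
        (x := x) (TopologicalSpace.Opens.mem_top _)
      obtain ⟨K₀, hK₀, hK₀'⟩ := hKfg ⟨W, hW⟩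
      rw [← ev_fromSpec, ← ev_fromSpec] at hK₀'
      have hle : shf _ K₀ ≤ Eb.comap (hW.fromSpec ≫ j) := by
        rw [Scheme.IdealSheafData.comap_comp, hEb, comap_eq_shf K, hK₀', ← sI_le_iff, sI_shf, sI_shf]
        exact le_sup_left
      obtain ⟨F', g1, g2, g3⟩ := ext5 (hW.fromSpec ≫ j) (FG.shf hK₀) hle
      refine ⟨W, mem_nhdsWithin_of_mem_nhds (W.isOpen.mem_nhds hx), F', g1, g2, ?_⟩
      rw [← hW.range_fromSpec, leOn_range_iff, Scheme.IdealSheafData.comap_sup,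
        ← Scheme.IdealSheafData.comap_comp F', g3, comap_eq_shf K, comap_eq_shf (L.comap j), hK₀',
        ← sI_le_iff, sI_shf]
      have : sI (shf _ K₀ ⊔ shf _ (ev (L.comap j) hW.fromSpec)) =
          K₀ ⊔ ev (L.comap j) hW.fromSpec := by
        rw [← ev_id, ev_sup, ev_id, ev_id, sI_shf, sI_shf]
      rw [this]
  have hKF' : K ≤ F'.comap j ⊔ L.comap j := le_of_leAt fun x => hKF x trivial
  refine ⟨F ⊔ F', hF.sup hF', le_sup_left, sup_le hFE (hF'E.trans inf_le_left), ?_⟩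
  rw [sat_comap S.p, le_sat_iff]
  have : ((S.p ⁻¹ᵁ V : R.Opens) : Set R) = Set.range jR := (Scheme.Opens.range_ι _).symm
  rw [this, leOn_range_iff, ← Scheme.IdealSheafData.comap_comp, ← haV,
    ← Scheme.IdealSheafData.comap_comp, ← hpV, Scheme.IdealSheafData.comap_comp,
    Scheme.IdealSheafData.comap_comp]
  have h5 : (F ⊔ F').comap j ≤ K := by
    rw [← hEb]; exact cm _ (sup_le hFEb hF'E)
  refine (cm aV h5).trans (h3.trans (cm pV (hKF'.trans ?_)))
  rw [Scheme.IdealSheafData.comap_sup, Scheme.IdealSheafData.comap_sup]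
  exact sup_le_sup_right le_sup_right _
end

end EqvThick

namespace EqvThick

universe u

open Scheme.IdealSheafData

section
variable {X R : Scheme.{u}} {S : Gr X R} {B₀ Γ₀ : Type u} [CommRing B₀] [CommRing Γ₀]
    [Algebra B₀ Γ₀] (Ch : Chart S B₀ Γ₀) [CompactSpace X] [QuasiSeparatedSpace X]
    [IsNoetherianRing B₀] [Algebra.FiniteType B₀ Γ₀]

lemma core (c : Ideal B₀) : ∀ (L E : X.IdealSheafData) (_ : L ≤ E) (_ : S.Inv L) (_ : S.Inv E)
    (_ : bc Ch.y c * E ≤ L) (F : X.IdealSheafData) (_ : FG F) (_ : F ≤ E),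
    ∃ F' : X.IdealSheafData, FG F' ∧ F ≤ F' ∧ F' ≤ E ∧ F'.comap S.a ≤ (F' ⊔ L).comap S.p := by
  have : CompactSpace R := QuasiCompact.compactSpace_of_compactSpace S.p
  induction c using WellFoundedGT.induction with
  | ind c IH =>
  intro L E hLE hL hE hcE F hF hFE
  by_cases htop : c = ⊤
  · rw [htop, bc_top, isTop_mul] at hcE
    refine ⟨F, hF, le_rfl, hFE, ?_⟩
    exact (cm _ (hFE.trans hcE)).trans (hL.trans (cm _ le_sup_right))
  by_cases hp : c.IsPrime
  · obtain ⟨h, ι, γ, hhc, hγ⟩ := exists_GD (Γ₀ := Γ₀) c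
    obtain ⟨F₁, hF₁, hFF₁, hF₁E, hF₁a⟩ := content Ch hγ L E hLE hL hE hcE F hF hFE
    set V : X.Opens := Ch.y ⁻¹ᵁ DB (B := CommRingCat.of B₀) h with hVdef
    have : QuasiCompact V.ι := qc_DB Ch.y h
    have hVV : S.p ⁻¹ᵁ V = S.a ⁻¹ᵁ V := by
      rw [hVdef, ← Scheme.Hom.comp_preimage, ← Scheme.Hom.comp_preimage, Ch.hy]
    have hsat : S.Inv (sat V (F₁ ⊔ L)) := by
      apply S.inv_sat hVV
      rw [comap_sup]
      exact sup_le hF₁a (hL.trans (cm _ (le_sup_right.trans (le_sat V _))))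
    have hE' := Gr.Inv.inf S hE hsat
    set E' := E ⊓ sat V (F₁ ⊔ L) with hE'def
    have h1 : F₁ ≤ E' := le_inf hF₁E (le_sup_left.trans (le_sat V _))
    obtain ⟨F₂', hF₂'E, hF₂', hF₂'a⟩ := ext5' S.p (hF₁.comap S.a) (J := F₁.comap S.p) (E := E')
      (((cm _ h1).trans hE').trans le_sup_right)
    rw [← comap_sup] at hF₂'a
    have hF₂ := hF₁.sup hF₂'
    have hF₂E : F₁ ⊔ F₂' ≤ E' := sup_le h1 hF₂'E
    set F₂ := F₁ ⊔ F₂' with hF₂def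
    obtain ⟨N, hN⟩ := ext6 Ch.y h hF₂ (J := F₁ ⊔ L) (le_sat_iff.1 (hF₂E.trans inf_le_right))
    set M := bc Ch.y (Ideal.span {h ^ N}) with hM
    have hMFG : FG M := FG.bc Ch.y ⟨{h ^ N}, by simp⟩
    have hKinv := S.int_inv (F₂ ⊔ L)
    have hKle := S.int_le (F₂ ⊔ L)
    have hleK : F₁ ⊔ L ≤ S.int (F₂ ⊔ L) := by
      rw [S.le_int_iff, comap_sup, comap_sup]
      exact sup_le_sup hF₂'a hL
    set K := S.int (F₂ ⊔ L)
    have hKE : K ≤ E := hKle.trans (sup_le (hF₂E.trans inf_le_left) hLE)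
    have hlt : c < c ⊔ Ideal.span {h ^ N} := by
      refine lt_of_le_of_ne le_sup_left fun he => hhc ?_
      apply hp.mem_of_pow_mem N
      rw [he]
      exact Ideal.mem_sup_right (Ideal.mem_span_singleton_self _)
    have hMK : S.Inv (M * K) := Gr.Inv.bc_mul S Ch.hy _ hKinv
    obtain ⟨F₃, hF₃, hle, hF₃K, hF₃a⟩ := IH _ hlt (L ⊔ M * K) K
      (sup_le (le_sup_right.trans hleK) (isMul_le_right _ _)) (Gr.Inv.sup S hL hMK) hKinv
      (by
        rw [bc_sup, isSup_mul]
        exact sup_le_sup ((isMul_mono le_rfl hKE).trans hcE) le_rfl)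
      (F₁ ⊔ M * F₂) (hF₁.sup (hMFG.mul hF₂))
      (sup_le (le_sup_left.trans hleK) (hN.trans hleK))
    refine ⟨F₃, hF₃, hFF₁.trans (le_sup_left.trans hle), hF₃K.trans hKE, ?_⟩
    refine hF₃a.trans (cm _ ?_)
    refine sup_le le_sup_left (sup_le le_sup_right ?_)
    refine (isMul_mono le_rfl hKle).trans ?_
    rw [isMul_sup]
    exact sup_le_sup (le_sup_right.trans hle) (isMul_le_right _ _)
  · obtain ⟨r, s, hr, hs, hrs⟩ : ∃ r s, r ∉ c ∧ s ∉ c ∧ r * s ∈ c := by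
      by_contra hcon
      push Not at hcon
      exact hp ⟨htop, fun {r s} hrs => by
        by_contra hh
        push Not at hh
        exact hcon r s hh.1 hh.2 hrs⟩
    have lt : ∀ r, r ∉ c → c < c ⊔ Ideal.span {r} := fun r hr =>
      lt_of_le_of_ne le_sup_left fun he => hr (by
        rw [he]; exact Ideal.mem_sup_right (Ideal.mem_span_singleton_self _))
    have hmul : (c ⊔ Ideal.span {s}) * (c ⊔ Ideal.span {r}) ≤ c := by
      rw [Ideal.sup_mul, Ideal.mul_sup, Ideal.mul_sup, Ideal.span_singleton_mul_span_singleton]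
      refine sup_le (sup_le Ideal.mul_le_left Ideal.mul_le_left) (sup_le Ideal.mul_le_right ?_)
      rw [Ideal.span_singleton_le_iff_mem, mul_comm]
      exact hrs
    set c₁ := c ⊔ Ideal.span {r}
    set c₂ := c ⊔ Ideal.span {s}
    have hL₁ : S.Inv (L ⊔ bc Ch.y c₁ * E) :=
      Gr.Inv.sup S hL (Gr.Inv.bc_mul S Ch.hy _ hE)
    have hL₁E : L ⊔ bc Ch.y c₁ * E ≤ E := sup_le hLE (isMul_le_right _ _)
    obtain ⟨F₁, hF₁, hFF₁, hF₁E, hF₁a⟩ := IH c₁ (lt r hr) _ E hL₁E hL₁ hE le_sup_right F hF hFE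
    rw [comap_sup] at hF₁a
    obtain ⟨F₂, hF₂L, hF₂, hF₂a⟩ := ext5' S.p (hF₁.comap S.a) hF₁a
    obtain ⟨F₃, hF₃, hFF₃, hF₃E, hF₃a⟩ := IH c₂ (lt s hs) L _ le_sup_left hL hL₁
      (by
        rw [isMul_sup, ← isMul_assoc, ← bc_mul]
        exact sup_le (isMul_le_right _ _) ((isMul_mono (bc_mono _ hmul) le_rfl).trans hcE))
      F₂ hF₂ hF₂L
    refine ⟨F₁ ⊔ F₃, hF₁.sup hF₃, hFF₁.trans le_sup_left, sup_le hF₁E (hF₃E.trans hL₁E), ?_⟩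
    rw [comap_sup]
    refine sup_le (hF₂a.trans ?_) (hF₃a.trans (cm _ ?_))
    · rw [← comap_sup]
      exact cm _ ((sup_le_sup le_rfl hFF₃).trans le_sup_left)
    · exact sup_le_sup le_sup_right le_rfl

lemma complete (Ch : Chart S B₀ Γ₀) (E : X.IdealSheafData) (hE : S.Inv E) (F : X.IdealSheafData) (hF : FG F)
    (hFE : F ≤ E) : ∃ K : X.IdealSheafData, FG K ∧ F ≤ K ∧ K ≤ E ∧ S.Inv K := by
  obtain ⟨K, h1, h2, h3, h4⟩ := core Ch ⊥ ⊥ E bot_le S.inv_bot hE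
    (by rw [bc_bot]; exact isMul_le_left _ _) F hF hFE
  refine ⟨K, h1, h2, h3, ?_⟩
  rwa [sup_bot_eq] at h4

end

end EqvThick

namespace EqvThick

universe u

open Scheme.IdealSheafData

namespace Gr
variable {X R : Scheme.{u}} (S : Gr X R)

/-- finitely generated invariant ideals are cofinal -/
def Compl : Prop := ∀ (E : X.IdealSheafData) (_ : S.Inv E) (F : X.IdealSheafData) (_ : FG F)
    (_ : F ≤ E), ∃ K : X.IdealSheafData, FG K ∧ F ≤ K ∧ K ≤ E ∧ S.Inv K

/-- the action map restricted to an invariant open -/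
def aR (V : X.Opens) (hV : S.p ⁻¹ᵁ V = S.a ⁻¹ᵁ V) : (S.p ⁻¹ᵁ V).toScheme ⟶ V.toScheme :=
  (Scheme.isoOfEq _ hV).hom ≫ S.a ∣_ V

lemma aR_ι (V : X.Opens) (hV : S.p ⁻¹ᵁ V = S.a ⁻¹ᵁ V) :
    S.aR V hV ≫ V.ι = (S.p ⁻¹ᵁ V).ι ≫ S.a := by
  rw [aR, Category.assoc, morphismRestrict_ι, ← Category.assoc, Scheme.isoOfEq_hom_ι]

lemma exists_e (V : X.Opens) : ∃ eV : V.toScheme ⟶ (S.p ⁻¹ᵁ V).toScheme,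
    eV ≫ (S.p ⁻¹ᵁ V).ι = V.ι ≫ S.e := by
  apply lift_opens
  intro z
  change (((V.ι ≫ S.e) ≫ S.p) z) ∈ V
  rw [Category.assoc, S.e_p, Category.comp_id]
  exact z.2

lemma exists_i (V : X.Opens) (hV : S.p ⁻¹ᵁ V = S.a ⁻¹ᵁ V) :
    ∃ iV : (S.p ⁻¹ᵁ V).toScheme ⟶ (S.p ⁻¹ᵁ V).toScheme,
    iV ≫ (S.p ⁻¹ᵁ V).ι = (S.p ⁻¹ᵁ V).ι ≫ S.i := by
  apply lift_opens
  intro z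
  change ((((S.p ⁻¹ᵁ V).ι ≫ S.i) ≫ S.p) z) ∈ V
  rw [Category.assoc, S.i_p]
  exact hV.le z.2

/-- restriction to an invariant open -/
def restr (V : X.Opens) (hV : S.p ⁻¹ᵁ V = S.a ⁻¹ᵁ V) : Gr V.toScheme (S.p ⁻¹ᵁ V).toScheme where
  p := S.p ∣_ V
  a := S.aR V hV
  e := (S.exists_e V).choose
  i := (S.exists_i V hV).choose
  e_p := by
    rw [← cancel_mono V.ι, Category.assoc, morphismRestrict_ι, ← Category.assoc,
      (S.exists_e V).choose_spec, Category.assoc, S.e_p, Category.comp_id, Category.id_comp]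
  e_a := by
    rw [← cancel_mono V.ι, Category.assoc, aR_ι, ← Category.assoc,
      (S.exists_e V).choose_spec, Category.assoc, S.e_a, Category.comp_id, Category.id_comp]
  i_p := by
    rw [← cancel_mono V.ι, Category.assoc, morphismRestrict_ι, ← Category.assoc,
      (S.exists_i V hV).choose_spec, Category.assoc, S.i_p, aR_ι]
  i_a := by
    rw [← cancel_mono V.ι, Category.assoc, aR_ι, ← Category.assoc,
      (S.exists_i V hV).choose_spec, Category.assoc, S.i_a, morphismRestrict_ι]
  comp := by
    intro T s t hst
    have h1 : (s ≫ (S.p ⁻¹ᵁ V).ι) ≫ S.p = (t ≫ (S.p ⁻¹ᵁ V).ι) ≫ S.a := by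
      rw [Category.assoc, Category.assoc, ← morphismRestrict_ι, ← S.aR_ι V hV, ← Category.assoc,
        hst, Category.assoc]
    obtain ⟨v, hv1, hv2⟩ := S.comp T _ _ h1
    obtain ⟨w, hw⟩ := lift_opens (S.p ⁻¹ᵁ V) v (by
      intro z
      change ((v ≫ S.p) z) ∈ V
      rw [hv1]
      exact (t z).2)
    refine ⟨w, ?_, ?_⟩
    · rw [← cancel_mono V.ι, Category.assoc, Category.assoc, morphismRestrict_ι,
        ← Category.assoc, hw, hv1, Category.assoc]
    · rw [← cancel_mono V.ι, Category.assoc, Category.assoc, aR_ι,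
        ← Category.assoc, hw, hv2, Category.assoc]
  flat_p := MorphismProperty.of_isPullback (P := @Flat)
    (isPullback_morphismRestrict S.p V).flip S.flat_p
  flat_a := by
    have : Flat (S.a ∣_ V) := MorphismProperty.of_isPullback (P := @Flat)
      (isPullback_morphismRestrict S.a V).flip S.flat_a
    unfold aR; infer_instance
  qc_p := MorphismProperty.of_isPullback (P := @QuasiCompact)
    (isPullback_morphismRestrict S.p V).flip S.qc_p
  qc_a := by
    have : QuasiCompact (S.a ∣_ V) := MorphismProperty.of_isPullback (P := @QuasiCompact)
      (isPullback_morphismRestrict S.a V).flip S.qc_a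
    unfold aR; infer_instance

lemma restr_inv_iff (V : X.Opens) (hV : S.p ⁻¹ᵁ V = S.a ⁻¹ᵁ V) (I : X.IdealSheafData) :
    (S.restr V hV).Inv (I.comap V.ι) ↔ LeOn (I.comap S.a) (I.comap S.p) (S.p ⁻¹ᵁ V : R.Opens) := by
  have e1 : (S.restr V hV).a ≫ V.ι = (S.p ⁻¹ᵁ V).ι ≫ S.a := S.aR_ι V hV
  have e2 : (S.restr V hV).p ≫ V.ι = (S.p ⁻¹ᵁ V).ι ≫ S.p := morphismRestrict_ι S.p V
  unfold Inv
  rw [← comap_comp, ← comap_comp, e1, e2, comap_comp, comap_comp]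
  have := leOn_range_iff (S.p ⁻¹ᵁ V).ι (I := I.comap S.a) (J := I.comap S.p)
  rw [Scheme.Opens.range_ι] at this
  exact this.symm

variable [CompactSpace X] [QuasiSeparatedSpace X]

lemma glue_step {W V : X.Opens} (hW : S.p ⁻¹ᵁ W = S.a ⁻¹ᵁ W) (hV : S.p ⁻¹ᵁ V = S.a ⁻¹ᵁ V)
    (hWc : IsCompact (W : Set X)) (hVc : IsCompact (V : Set X)) (hC : (S.restr V hV).Compl)
    (E : X.IdealSheafData) (hE : S.Inv E) (K : X.IdealSheafData) (hK : FG K)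
    (hKE : K ≤ E) (hKW : LeOn (K.comap S.a) (K.comap S.p) (S.p ⁻¹ᵁ W : R.Opens)) :
    ∃ K' : X.IdealSheafData, FG K' ∧ K ≤ K' ∧ K' ≤ E ∧
      LeOn (K'.comap S.a) (K'.comap S.p) (S.p ⁻¹ᵁ (W ⊔ V) : R.Opens) := by
  have : CompactSpace W.toScheme := isCompact_iff_compactSpace.1 hWc
  have : CompactSpace V.toScheme := isCompact_iff_compactSpace.1 hVc
  have : QuasiCompact W.ι := inferInstance
  have h1 : S.Inv (sat W K) := by
    apply S.inv_sat hW
    rw [sat_comap S.p, le_sat_iff]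
    exact hKW
  have hE' := Inv.inf S hE h1
  have hKE' : K ≤ E ⊓ sat W K := le_inf hKE (le_sat W K)
  set E' := E ⊓ sat W K
  have hE'V : (S.restr V hV).Inv (E'.comap V.ι) := by
    rw [restr_inv_iff]
    exact fun x _ => leAt_of_le hE' x
  obtain ⟨K₁, hK₁, hKK₁, hK₁E, hK₁inv⟩ := hC _ hE'V _ (hK.comap V.ι) (cm _ hKE')
  obtain ⟨F, hFE, hF, hFV⟩ := ext5 V.ι hK₁ hK₁E
  refine ⟨K ⊔ F, hK.sup hF, le_sup_left, (sup_le hKE' hFE).trans inf_le_left, ?_⟩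
  have h2 : (S.restr V hV).Inv ((K ⊔ F).comap V.ι) := by
    rw [comap_sup, hFV, sup_eq_right.2 hKK₁]
    exact hK₁inv
  rw [restr_inv_iff] at h2
  rintro z (hz | hz)
  · have h3 : LeOn (K ⊔ F) K W := le_sat_iff.1 ((sup_le hKE' hFE).trans inf_le_right)
    have h4 : LeOn ((K ⊔ F).comap S.a) (K.comap S.a) (S.p ⁻¹ᵁ W : R.Opens) :=
      fun z hz => leAt_comap _ (h3 _ (hW.le hz))
    exact (h4.trans hKW z hz).mono_right (cm _ le_sup_left)
  · exact h2 z hz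

lemma glue {α : Type*} (s : Finset α) (V : α → X.Opens) (hV : ∀ i, S.p ⁻¹ᵁ V i = S.a ⁻¹ᵁ V i)
    (hVc : ∀ i, IsCompact (V i : Set X)) (hC : ∀ i, (S.restr (V i) (hV i)).Compl)
    (htop : ∀ x, ∃ i ∈ s, x ∈ V i) : S.Compl := by
  classical
  intro E hE F hF hFE
  have key : ∀ t : Finset α, ∃ W : X.Opens, (∀ i ∈ t, V i ≤ W) ∧ S.p ⁻¹ᵁ W = S.a ⁻¹ᵁ W ∧
      IsCompact (W : Set X) ∧ ∃ K : X.IdealSheafData, FG K ∧ F ≤ K ∧ K ≤ E ∧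
      LeOn (K.comap S.a) (K.comap S.p) (S.p ⁻¹ᵁ W : R.Opens) := by
    intro t
    induction t using Finset.induction_on with
    | empty =>
      refine ⟨⊥, by simp, rfl, by simp, F, hF, le_rfl, hFE, ?_⟩
      rintro x ⟨⟩
    | insert i t hi ih =>
      obtain ⟨W, h1, h2, h3, K, h4, h5, h6, h7⟩ := ih
      obtain ⟨K', k1, k2, k3, k4⟩ := S.glue_step h2 (hV i) h3 (hVc i) (hC i) E hE K h4 h6 h7
      refine ⟨W ⊔ V i, ?_, ?_, ?_, K', k1, h5.trans k2, k3, k4⟩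
      · intro j hj
        rcases Finset.mem_insert.1 hj with rfl | hj
        · exact le_sup_right
        · exact (h1 j hj).trans le_sup_left
      · change S.p ⁻¹ᵁ W ⊔ S.p ⁻¹ᵁ V i = S.a ⁻¹ᵁ W ⊔ S.a ⁻¹ᵁ V i
        rw [h2, hV i]
      · exact h3.union (hVc i)
  obtain ⟨W, h1, h2, h3, K, h4, h5, h6, h7⟩ := key s
  refine ⟨K, h4, h5, h6, le_of_leAt fun z => h7 z ?_⟩
  obtain ⟨i, hi, hz⟩ := htop (S.p z)
  exact h1 i hi hz

end Gr

end EqvThick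

namespace EqvThick

universe u

open scoped TensorProduct in
lemma noeth_descent {A Γ : CommRingCat.{u}} (φ : A ⟶ Γ) (hφ : φ.hom.FinitePresentation) :
    ∃ (A₀ Γ₀ : Type u) (_ : CommRing A₀) (_ : CommRing Γ₀) (_ : Algebra A₀ Γ₀)
      (_ : IsNoetherianRing A₀) (_ : Algebra.FiniteType A₀ Γ₀) (φ₀ : CommRingCat.of A₀ ⟶ A)
      (ψ : CommRingCat.of Γ₀ ⟶ Γ),
      IsPullback (Spec.map ψ) (Spec.map φ)
        (Spec.map (CommRingCat.ofHom (algebraMap A₀ Γ₀))) (Spec.map φ₀) := by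
  let _ : Algebra A Γ := φ.hom.toAlgebra
  have : Algebra.FinitePresentation A Γ := hφ
  let P := Algebra.Presentation.ofFinitePresentation A Γ
  let A₀ := P.Core
  let Γ₀ := P.ModelOfHasCoeffs A₀
  let e : A ⊗[A₀] Γ₀ ≃ₐ[A] Γ := P.tensorModelOfHasCoeffsEquiv A₀
  have hN : IsNoetherianRing A₀ := Algebra.FiniteType.isNoetherianRing ℤ A₀
  have hFT : Algebra.FiniteType A₀ Γ₀ := inferInstance
  have H := CommRingCat.isPushout_tensorProduct A₀ A Γ₀
  let eI : CommRingCat.of (A ⊗[A₀] Γ₀) ≅ Γ := e.toRingEquiv.toCommRingCatIso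
  have H2 : IsPushout (CommRingCat.ofHom (algebraMap A₀ A)) (CommRingCat.ofHom (algebraMap A₀ Γ₀))
      φ (CommRingCat.ofHom
        (Algebra.TensorProduct.includeRight (R := A₀) (A := A) (B := Γ₀)).toRingHom ≫ eI.hom) := by
    refine IsPushout.of_iso H (Iso.refl _) (Iso.refl _) (Iso.refl _) eI ?_ ?_ ?_ ?_
    · simp
    · simp
    · ext x
      change e (x ⊗ₜ 1) = φ.hom x
      exact e.commutes x
    · simp
  exact ⟨A₀, Γ₀, inferInstance, inferInstance, inferInstance, hN, hFT, _, _,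
    isPullback_SpecMap_of_isPushout _ _ _ _ H2.flip⟩

lemma compl_affine {X R G : Scheme.{u}} (S : Gr X R) [CompactSpace X] [QuasiSeparatedSpace X]
    {A : CommRingCat.{u}} (y : X ⟶ Spec A) (π : G ⟶ Spec A) [Flat π]
    [LocallyOfFinitePresentation π] [QuasiCompact π] (g : R ⟶ G) (H : IsPullback g S.p π y)
    (hy : S.p ≫ y = S.a ≫ y) : S.Compl := by
  have : CompactSpace G := QuasiCompact.compactSpace_of_compactSpace π
  have hid : MorphismProperty.ContainsIdentities @IsLocalIso.{u} :=
    (inferInstance : MorphismProperty.IsMultiplicative @IsLocalIso.{u}).toContainsIdentities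
  have hidf : MorphismProperty.ContainsIdentities @Flat.{u} := ⟨fun _ => inferInstance⟩
  have hidl : MorphismProperty.ContainsIdentities @LocallyOfFinitePresentation.{u} :=
    ⟨fun _ => inferInstance⟩
  obtain ⟨Y, c₀, hc1, hc2, hc3⟩ := G.exists_hom_isAffine_of_isZariskiLocalAtSource @IsLocalIso
  let c := Y.isoSpec.inv ≫ c₀
  have hzf : IsZariskiLocalAtSource @Flat.{u} :=
    HasRingHomProperty.instIsZariskiLocalAtSource (Q := RingHom.Flat)
  have hzl : IsZariskiLocalAtSource @LocallyOfFinitePresentation.{u} :=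
    HasRingHomProperty.instIsZariskiLocalAtSource (Q := RingHom.FinitePresentation)
  have hf0 : Flat c₀ := IsLocalIso.le_of_isZariskiLocalAtSource @Flat.{u} _ _ _ hc2
  have hl0 : LocallyOfFinitePresentation c₀ :=
    IsLocalIso.le_of_isZariskiLocalAtSource @LocallyOfFinitePresentation.{u} _ _ _ hc2
  have hcl : LocallyOfFinitePresentation c := inferInstance
  have hcs : Surjective c := inferInstance
  have hcf : Flat c := inferInstance
  obtain ⟨φ, hφ⟩ := Spec.map_surjective (c ≫ π)
  have hfp : LocallyOfFinitePresentation (Spec.map φ) := by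
    rw [hφ]; infer_instance
  obtain ⟨A₀, Γ₀, _, _, _, _, _, φ₀, ψ, H0⟩ := noeth_descent φ
    (LocallyOfFinitePresentation.SpecMap_iff _ |>.1 hfp)
  let y₀ := y ≫ Spec.map φ₀
  let t : PP Γ₀ y₀ ⟶ Spec _ := H0.lift (pullback.fst _ _) (pullback.snd _ _ ≫ y)
    (by rw [pullback.condition, Category.assoc])
  have ht1 : t ≫ Spec.map ψ = pullback.fst _ _ := H0.lift_fst _ _ _
  have ht2 : t ≫ Spec.map φ = PPπ Γ₀ y₀ ≫ y := H0.lift_snd _ _ _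
  have H1 : IsPullback t (PPπ Γ₀ y₀) (Spec.map φ) y := by
    refine IsPullback.of_right ?_ ht2 H0
    rw [ht1]
    exact IsPullback.of_hasPullback _ _
  let q : PP Γ₀ y₀ ⟶ R := H.lift (t ≫ c) (PPπ Γ₀ y₀) (by rw [Category.assoc, ← hφ, ht2])
  have hq1 : q ≫ g = t ≫ c := H.lift_fst _ _ _
  have hq2 : q ≫ S.p = PPπ Γ₀ y₀ := H.lift_snd _ _ _
  have H2 : IsPullback t q c g := by
    refine IsPullback.of_bot ?_ hq1.symm H
    rw [hq2, ← hφ]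
    exact H1
  let Ch : Chart S A₀ Γ₀ :=
    { y := y₀
      hy := by
        change S.p ≫ y ≫ _ = S.a ≫ y ≫ _
        rw [← Category.assoc, hy, Category.assoc]
      q := q
      q_p := hq2
      flat_q := MorphismProperty.of_isPullback (P := @Flat) H2 hcf
      surj_q := MorphismProperty.of_isPullback (P := @Surjective) H2 hcs }
  exact fun E hE F hF hFE => complete Ch E hE F hF hFE

/-- General completeness. -/
lemma compl_gen {X R G B : Scheme.{u}} (S : Gr X R) [CompactSpace X] [QuasiSeparatedSpace X]
    (y : X ⟶ B) (π : G ⟶ B) [Flat π]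
    [LocallyOfFinitePresentation π] [QuasiCompact π] (g : R ⟶ G) (H : IsPullback g S.p π y)
    (hy : S.p ≫ y = S.a ≫ y) : S.Compl := by
  have hlfp : LocallyOfFinitePresentation S.p :=
    MorphismProperty.of_isPullback (P := @LocallyOfFinitePresentation) H inferInstance
  have hop : IsOpenMap S.p := S.p.isOpenMap
  -- local existence
  have key : ∀ x : X, ∃ V : X.Opens, x ∈ V ∧ ∃ hV : S.p ⁻¹ᵁ V = S.a ⁻¹ᵁ V,
      IsCompact (V : Set X) ∧ (S.restr V hV).Compl := by
    intro x
    obtain ⟨B', hB', hxB', -⟩ := exists_isAffineOpen_mem_and_subset (X := B) (x := y x)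
      (U := ⊤) trivial
    obtain ⟨W, hW, hxW, hWB⟩ := exists_isAffineOpen_mem_and_subset (X := X) (x := x)
      (U := y ⁻¹ᵁ B') hxB'
    let V : X.Opens := ⟨S.p '' (S.a ⁻¹ᵁ W), hop _ (S.a ⁻¹ᵁ W).2⟩
    have hVB : V ≤ y ⁻¹ᵁ B' := by
      rintro _ ⟨w, hw, rfl⟩
      change (S.p ≫ y) w ∈ B'
      rw [hy]
      exact hWB hw
    have half : ∀ z : R, S.p z ∈ V → S.a z ∈ V := by
      rintro z ⟨w, hw, hwz⟩
      obtain ⟨t, ht1, ht2⟩ := Scheme.Pullback.exists_preimage_pullback (f := S.p) (g := S.p) z w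
        hwz.symm
      obtain ⟨v, hv1, hv2⟩ := S.comp _ (pullback.snd S.p S.p) (pullback.fst S.p S.p ≫ S.i) (by
        rw [Category.assoc, S.i_a, pullback.condition])
      rw [Category.assoc, S.i_p] at hv1
      refine ⟨v t, ?_, ?_⟩
      · change (v ≫ S.a) t ∈ W
        rw [hv2, Scheme.Hom.comp_apply, ht2]
        exact hw
      · rw [← Scheme.Hom.comp_apply, hv1, Scheme.Hom.comp_apply, ht1]
    have hV : S.p ⁻¹ᵁ V = S.a ⁻¹ᵁ V := by
      apply le_antisymm
      · exact fun z hz => half z hz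
      · intro z hz
        have := half (S.i z) (by
          rw [← Scheme.Hom.comp_apply, S.i_p]; exact hz)
        rw [← Scheme.Hom.comp_apply, S.i_a] at this
        exact this
    have hVc : IsCompact (V : Set X) :=
      (S.a.isCompact_preimage hW.isCompact).image S.p.continuous
    refine ⟨V, ⟨S.e x, ?_, ?_⟩, hV, hVc, ?_⟩
    · change (S.e ≫ S.a) x ∈ W
      rw [S.e_a]; exact hxW
    · rw [← Scheme.Hom.comp_apply, S.e_p]; rfl
    have : CompactSpace V.toScheme := isCompact_iff_compactSpace.1 hVc
    have : QuasiSeparatedSpace V.toScheme :=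
      V.ι.isOpenEmbedding.quasiSeparatedSpace
    let b := hB'.fromSpec
    have hbr : Set.range b = B' := hB'.range_fromSpec
    let y' : V.toScheme ⟶ Spec Γ(B, B') := IsOpenImmersion.lift b (V.ι ≫ y) (by
      rintro _ ⟨z, rfl⟩
      rw [hbr]
      exact hVB z.2)
    have hy' : y' ≫ b = V.ι ≫ y := IsOpenImmersion.lift_fac _ _ _
    have HG : IsPullback (pullback.fst π b) (pullback.snd π b) π b := IsPullback.of_hasPullback _ _
    have HR : IsPullback ((S.p ⁻¹ᵁ V).ι ≫ g) (S.restr V hV).p π (y' ≫ b) := by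
      rw [hy']
      exact (isPullback_morphismRestrict S.p V).flip.paste_horiz H
    let g' : (S.p ⁻¹ᵁ V).toScheme ⟶ pullback π b := HG.lift ((S.p ⁻¹ᵁ V).ι ≫ g)
      ((S.restr V hV).p ≫ y') (by rw [HR.w, Category.assoc])
    have hg1 : g' ≫ pullback.fst π b = (S.p ⁻¹ᵁ V).ι ≫ g := HG.lift_fst _ _ _
    have hg2 : g' ≫ pullback.snd π b = (S.restr V hV).p ≫ y' := HG.lift_snd _ _ _
    have HR' : IsPullback g' (S.restr V hV).p (pullback.snd π b) y' := by
      refine IsPullback.of_right ?_ hg2 HG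
      rw [hg1]; exact HR
    refine compl_affine (S.restr V hV) y' (pullback.snd π b) g' HR' ?_
    rw [← cancel_mono b, Category.assoc, Category.assoc, hy', ← Category.assoc, ← Category.assoc]
    have e1 : (S.restr V hV).a ≫ V.ι = (S.p ⁻¹ᵁ V).ι ≫ S.a := S.aR_ι V hV
    have e2 : (S.restr V hV).p ≫ V.ι = (S.p ⁻¹ᵁ V).ι ≫ S.p := morphismRestrict_ι S.p V
    rw [e1, e2, Category.assoc, Category.assoc, hy]
  choose V hxV hV hVc hVC using key
  obtain ⟨s, hs⟩ := (isCompact_univ (X := X)).elim_finite_subcover (fun x => (V x : Set X))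
    (fun x => (V x).2) (fun x _ => Set.mem_iUnion.2 ⟨x, hxV x⟩)
  refine S.glue s V hV hVc hVC fun x => ?_
  have := hs (Set.mem_univ x)
  simpa using this

end EqvThick

namespace EqvThick

universe u

open EquivariantSix

variable {B : Scheme.{u}} {G : GrpOver B} (x : GScheme B G)

section
variable {T : Over B}

lemma g_one_mul (g : T ⟶ G.carrier) :
    prod.lift (terminal.from T ≫ G.one) g ≫ G.mul = g := by
  have := congrArg (fun f => g ≫ f) G.one_mul
  simp only [← Category.assoc, prod.comp_lift, Category.comp_id] at this
  rw [← this]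
  congr 3
  exact Subsingleton.elim _ _

lemma g_mul_one (g : T ⟶ G.carrier) :
    prod.lift g (terminal.from T ≫ G.one) ≫ G.mul = g := by
  have := congrArg (fun f => g ≫ f) G.mul_one
  simp only [← Category.assoc, prod.comp_lift, Category.comp_id] at this
  rw [← this]
  congr 3
  exact Subsingleton.elim _ _

lemma g_inv_mul (g : T ⟶ G.carrier) :
    prod.lift (g ≫ G.inv) g ≫ G.mul = terminal.from T ≫ G.one := by
  have := congrArg (fun f => g ≫ f) G.mul_left_inv
  simp only [← Category.assoc, prod.comp_lift, Category.comp_id] at this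
  rw [this]
  congr 1
  exact Subsingleton.elim _ _

lemma g_assoc (g h k : T ⟶ G.carrier) :
    prod.lift (prod.lift g h ≫ G.mul) k ≫ G.mul = prod.lift g (prod.lift h k ≫ G.mul) ≫ G.mul := by
  have := congrArg (fun f => prod.lift (prod.lift g h) k ≫ f) G.mul_assoc
  simpa [prod.comp_lift_assoc, Limits.prod.lift_fst, Limits.prod.lift_snd,
    Limits.prod.lift_fst_assoc, Limits.prod.lift_snd_assoc] using this

lemma g_inv_inv (g : T ⟶ G.carrier) : (g ≫ G.inv) ≫ G.inv = g := by
  have h1 := g_assoc ((g ≫ G.inv) ≫ G.inv) (g ≫ G.inv) g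
  rw [g_inv_mul, g_inv_mul, g_one_mul, g_mul_one] at h1
  exact h1.symm

lemma x_one (z : T ⟶ x.carrier) : prod.lift (terminal.from T ≫ G.one) z ≫ x.act = z := by
  have := congrArg (fun f => z ≫ f) x.one_act
  simp only [← Category.assoc, prod.comp_lift, Category.comp_id] at this
  rw [← this]
  congr 3
  exact Subsingleton.elim _ _

lemma x_mul (g h : T ⟶ G.carrier) (z : T ⟶ x.carrier) :
    prod.lift (prod.lift g h ≫ G.mul) z ≫ x.act = prod.lift g (prod.lift h z ≫ x.act) ≫ x.act := by
  have := congrArg (fun f => prod.lift (prod.lift g h) z ≫ f) x.mul_act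
  simpa [prod.comp_lift_assoc, Limits.prod.lift_fst, Limits.prod.lift_snd,
    Limits.prod.lift_fst_assoc, Limits.prod.lift_snd_assoc] using this

lemma x_inv (g : T ⟶ G.carrier) (z : T ⟶ x.carrier) :
    prod.lift (g ≫ G.inv) (prod.lift g z ≫ x.act) ≫ x.act = z := by
  rw [← x_mul, g_inv_mul, x_one]

end

/-- inverse -/
def gi : G.carrier ⨯ x.carrier ⟶ G.carrier ⨯ x.carrier := prod.lift (prod.fst ≫ G.inv) x.act

lemma gi_snd : gi x ≫ prod.snd = x.act := prod.lift_snd _ _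

lemma gi_act : gi x ≫ x.act = prod.snd := by
  have := x_inv x (prod.fst : G.carrier ⨯ x.carrier ⟶ _) prod.snd
  rw [prod.lift_fst_snd, Category.id_comp] at this
  exact this

lemma gi_gi : gi x ≫ gi x = 𝟙 _ := by
  apply Limits.prod.hom_ext
  · have : gi x ≫ prod.fst = prod.fst ≫ G.inv := prod.lift_fst _ _
    rw [Category.assoc, this, ← Category.assoc, this, g_inv_inv, Category.id_comp]
  · rw [Category.assoc, gi_snd, gi_act, Category.id_comp]

lemma prod_isPullback (X Y : Over B) :
    IsPullback (prod.fst : X ⨯ Y ⟶ X).left (prod.snd : X ⨯ Y ⟶ Y).left X.hom Y.hom := by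
  refine ⟨⟨by rw [Over.w, Over.w]⟩, ⟨PullbackCone.IsLimit.mk _
    (fun s => (prod.lift (Over.homMk (U := Over.mk (s.fst ≫ X.hom)) s.fst rfl)
      (Over.homMk (U := Over.mk (s.fst ≫ X.hom)) s.snd s.condition.symm)).left) ?_ ?_ ?_⟩⟩
  · intro s
    rw [← Over.comp_left, prod.lift_fst]; rfl
  · intro s
    rw [← Over.comp_left, prod.lift_snd]; rfl
  · intro s m h1 h2
    let m' : Over.mk (s.fst ≫ X.hom) ⟶ X ⨯ Y := Over.homMk m (by
      change m ≫ (X ⨯ Y).hom = s.fst ≫ X.hom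
      rw [← h1, Category.assoc, Over.w])
    suffices m' = _ from congrArg (fun f => f.left) this
    apply Limits.prod.hom_ext
    · rw [prod.lift_fst]; ext1; exact h1
    · rw [prod.lift_snd]; ext1; exact h2

/-- the action groupoid -/
def toGr (hG : G.FlatFinPres) : Gr x.carrier.left (G.carrier ⨯ x.carrier).left :=
  have hf : Flat G.π := Flat.of_stalkMap _ hG.1
  have hq : QuasiCompact G.π := hG.2.2.1
  have fp : Flat (prod.snd : G.carrier ⨯ x.carrier ⟶ x.carrier).left :=
    MorphismProperty.of_isPullback (P := @Flat) (prod_isPullback G.carrier x.carrier) hf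
  have qp : QuasiCompact (prod.snd : G.carrier ⨯ x.carrier ⟶ x.carrier).left :=
    MorphismProperty.of_isPullback (P := @QuasiCompact) (prod_isPullback G.carrier x.carrier) hq
  have hi : IsIso (gi x).left :=
    ⟨(gi x).left, by rw [← Over.comp_left, gi_gi]; rfl, by rw [← Over.comp_left, gi_gi]; rfl⟩
  have ea : x.act.left = (gi x).left ≫ (prod.snd : G.carrier ⨯ x.carrier ⟶ x.carrier).left := by
    rw [← Over.comp_left, gi_snd]
  { p := (prod.snd : G.carrier ⨯ x.carrier ⟶ x.carrier).left
    a := x.act.left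
    e := (prod.lift (terminal.from x.carrier ≫ G.one) (𝟙 x.carrier)).left
    i := (gi x).left
    e_p := by rw [← Over.comp_left, prod.lift_snd]; rfl
    e_a := by rw [← Over.comp_left, x.one_act]; rfl
    i_p := by rw [← Over.comp_left, gi_snd]
    i_a := by rw [← Over.comp_left, gi_act]
    comp := by
      intro T s t hst
      let T' : Over B := Over.mk (t ≫ (G.carrier ⨯ x.carrier).hom)
      let t' : T' ⟶ G.carrier ⨯ x.carrier := Over.homMk t rfl
      let s' : T' ⟶ G.carrier ⨯ x.carrier := Over.homMk s (by
        change s ≫ (G.carrier ⨯ x.carrier).hom = t ≫ (G.carrier ⨯ x.carrier).hom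
        rw [← Over.w (prod.snd : G.carrier ⨯ x.carrier ⟶ x.carrier), ← Category.assoc, hst,
          Category.assoc, Over.w, Over.w])
      have hst' : s' ≫ prod.snd = t' ≫ x.act := by ext1; exact hst
      let v : T' ⟶ G.carrier ⨯ x.carrier :=
        prod.lift (prod.lift (s' ≫ prod.fst) (t' ≫ prod.fst) ≫ G.mul) (t' ≫ prod.snd)
      have hv1 : v ≫ prod.snd = t' ≫ prod.snd := prod.lift_snd _ _
      have hl : ∀ r : T' ⟶ G.carrier ⨯ x.carrier, prod.lift (r ≫ prod.fst) (r ≫ prod.snd) = r := by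
        intro r
        rw [← prod.comp_lift, prod.lift_fst_snd, Category.comp_id]
      have hv2 : v ≫ x.act = s' ≫ x.act := by
        change prod.lift _ _ ≫ _ = _
        rw [x_mul, hl, ← hst', hl]
      exact ⟨v.left, congrArg (fun f => f.left) hv1, congrArg (fun f => f.left) hv2⟩
    flat_p := fp
    flat_a := by rw [ea]; infer_instance
    qc_p := qp
    qc_a := by rw [ea]; infer_instance }

end EqvThick

namespace EqvThick

universe u

open EquivariantSix

lemma not_mem_support_of_leAt {X : Scheme.{u}} {K : X.IdealSheafData} {z : X} (h : LeAt ⊤ K z) :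
    z ∉ K.support := by
  obtain ⟨V, hV, hz, hle⟩ := h
  rw [Scheme.IdealSheafData.mem_support_iff_of_mem (U := ⟨V, hV⟩) hz]
  have : K.ideal ⟨V, hV⟩ = ⊤ := top_le_iff.1 hle
  rw [this]
  simp only [Submodule.top_coe, Scheme.zeroLocus_univ]
  intro h; exact h hz

lemma leAt_of_not_mem_support {X : Scheme.{u}} {K : X.IdealSheafData} {z : X}
    (h : z ∉ K.support) : LeAt ⊤ K z := by
  let D : X.Opens := ⟨(K.support : Set X)ᶜ, K.support.isClosed.isOpen_compl⟩
  have hz : z ∈ D := h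
  have h1 : K.comap D.ι = ⊤ := by
    rw [← Scheme.IdealSheafData.support_eq_bot_iff]
    ext w
    rw [Scheme.IdealSheafData.support_comap]
    constructor
    · intro hw; exact (w.2 hw).elim
    · intro hw; exact hw.elim
  refine leAt_of_comap D.ι ⟨z, hz⟩ ?_
  rw [h1]; exact le_top

lemma lfp_subscheme {X : Scheme.{u}} {K : X.IdealSheafData} (hK : FG K) :
    LocallyOfFinitePresentation K.subschemeι := by
  have := HasRingHomProperty.instIsZariskiLocalAtSource
    (P := @LocallyOfFinitePresentation) (Q := RingHom.FinitePresentation)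
  rw [IsZariskiLocalAtSource.iff_of_openCover (P := @LocallyOfFinitePresentation) K.subschemeCover.openCover]
  suffices h : ∀ U : X.affineOpens,
      LocallyOfFinitePresentation (K.subschemeCover.f U ≫ K.subschemeι) from h
  intro U
  have e : K.subschemeCover.f U ≫ K.subschemeι =
      Spec.map (CommRingCat.ofHom (Ideal.Quotient.mk (K.ideal U))) ≫ U.2.fromSpec :=
    (K.subschemeCover_map_subschemeι U).trans (K.glueDataObjι_ι U)
  have h1 : LocallyOfFinitePresentation
      (Spec.map (CommRingCat.ofHom (Ideal.Quotient.mk (K.ideal U)))) := by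
    rw [LocallyOfFinitePresentation.SpecMap_iff]
    apply RingHom.FinitePresentation.of_surjective _ Ideal.Quotient.mk_surjective
    rw [Ideal.mk_ker]
    exact hK.ideal U.2
  have h2 : LocallyOfFinitePresentation
      (Spec.map (CommRingCat.ofHom (Ideal.Quotient.mk (K.ideal U))) ≫ U.2.fromSpec) := by
    have h3 : IsOpenImmersion U.2.fromSpec := IsAffineOpen.isOpenImmersion_fromSpec U.2
    have h4 : LocallyOfFinitePresentation U.2.fromSpec := inferInstance
    exact MorphismProperty.comp_mem (@LocallyOfFinitePresentation) _ _ h1 h4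
  exact e.symm ▸ h2

variable {B : Scheme.{u}} {G : GrpOver B} (x : GScheme B G)

lemma map_pb0 {Y X : Over B} (A : Over B) (f : Y ⟶ X) :
    IsPullback (prod.map (𝟙 A) f).left (prod.snd : A ⨯ Y ⟶ _).left
      (prod.snd : A ⨯ X ⟶ _).left f.left := by
  refine IsPullback.of_right (h₁₂ := (prod.fst : A ⨯ X ⟶ _).left) (h₂₂ := X.hom)
    (v₁₃ := A.hom) ?_ ?_ (prod_isPullback A X)
  · rw [← Over.comp_left, prod.map_fst, Category.comp_id, Over.w]
    exact prod_isPullback A Y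
  · rw [← Over.comp_left, prod.map_snd, Over.comp_left]

lemma map_pb {V : Scheme.{u}} (f : V ⟶ x.carrier.left) :
    IsPullback (prod.map (𝟙 G.carrier) (subHom x f)).left
      (prod.snd : G.carrier ⨯ subOver x f ⟶ _).left
      (prod.snd : G.carrier ⨯ x.carrier ⟶ _).left f := map_pb0 G.carrier (subHom x f)

lemma sub_range {V : Scheme.{u}} (f : V ⟶ x.carrier.left) (h : IsInvariantSub x f)
    (z : (G.carrier ⨯ x.carrier).left)
    (hz : (prod.snd : G.carrier ⨯ x.carrier ⟶ _).left z ∈ Set.range f) :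
    x.act.left z ∈ Set.range f := by
  obtain ⟨r, hr⟩ := h
  obtain ⟨v, hv⟩ := hz
  obtain ⟨w, hw, -⟩ := Scheme.exists_preimage_of_isPullback (map_pb x f) z v hv.symm
  refine ⟨r.left w, ?_⟩
  have := congrArg (fun g => g.left w) hr
  rw [← hw]
  rw [Over.comp_left, Over.comp_left, Scheme.Hom.comp_apply, Scheme.Hom.comp_apply] at this
  exact this

lemma open_inv (U : x.carrier.left.Opens)
    (h : ∀ z : (G.carrier ⨯ x.carrier).left,
      (prod.snd : G.carrier ⨯ x.carrier ⟶ _).left z ∈ U → x.act.left z ∈ U) :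
    IsInvariantOpen x U := by
  obtain ⟨g, hg⟩ := lift_opens U (prod.map (𝟙 G.carrier) (subHom x U.ι) ≫ x.act).left (by
    intro z
    rw [Over.comp_left, Scheme.Hom.comp_apply]
    apply h
    rw [← Scheme.Hom.comp_apply, ← Over.comp_left, prod.map_snd, Over.comp_left,
      Scheme.Hom.comp_apply]
    exact ((prod.snd : G.carrier ⨯ subOver x U.ι ⟶ _).left z).2)
  have e : g ≫ (subOver x U.ι).hom = (G.carrier ⨯ subOver x U.ι).hom := by
    change g ≫ U.ι ≫ x.carrier.hom = _
    rw [← Category.assoc, hg, Over.w]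
  exact ⟨Over.homMk g e, by ext1; exact hg⟩

variable {x} in
lemma closed_inv {hG : G.FlatFinPres} {I : x.carrier.left.IdealSheafData} (h : (toGr x hG).Inv I) :
    IsInvariantSub x (V := I.subscheme) I.subschemeι := by
  let f : I.subscheme ⟶ x.carrier.left := I.subschemeι
  let m := (prod.map (𝟙 G.carrier) (subHom x f)).left
  have hf : I.comap f ≤ ⊥ := by
    rw [← Scheme.IdealSheafData.le_map_iff_comap_le, Scheme.IdealSheafData.map_bot,
      Scheme.IdealSheafData.ker_subschemeι]
  have hm : I.comap (m ≫ x.act.left) ≤ ⊥ := by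
    rw [Scheme.IdealSheafData.comap_comp]
    refine (cm m h).trans ?_
    rw [← Scheme.IdealSheafData.comap_comp]
    obtain ⟨q, hq⟩ : ∃ q : (G.carrier ⨯ subOver x f).left ⟶ I.subscheme,
      m ≫ (toGr x hG).p = q ≫ f := ⟨_, (map_pb x f).w⟩
    rw [hq, Scheme.IdealSheafData.comap_comp]
    refine (cm _ hf).trans ?_
    rw [Scheme.IdealSheafData.comap_bot]
  have hk : I ≤ (m ≫ x.act.left).ker := by
    rw [← Scheme.IdealSheafData.map_bot, Scheme.IdealSheafData.le_map_iff_comap_le]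
    exact hm
  let g := IsClosedImmersion.lift I.subschemeι (m ≫ x.act.left)
    (by rw [Scheme.IdealSheafData.ker_subschemeι]; exact hk)
  have hg : g ≫ f = m ≫ x.act.left := IsClosedImmersion.lift_fac _ _ _
  have e : g ≫ (subOver x f).hom = (G.carrier ⨯ subOver x f).hom := by
    change g ≫ f ≫ x.carrier.hom = _
    rw [← Category.assoc, hg, ← Over.comp_left, Over.w]
  exact ⟨Over.homMk g e, by ext1; exact hg⟩


/-- invariant open: both directions -/
lemma open_stable (hG : G.FlatFinPres) (U : x.carrier.left.Opens) (h : IsInvariantOpen x U)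
    (z : (G.carrier ⨯ x.carrier).left) :
    (toGr x hG).p z ∈ U ↔ (toGr x hG).a z ∈ U := by
  have key : ∀ w, (toGr x hG).p w ∈ U → (toGr x hG).a w ∈ U := by
    intro w hw
    have := sub_range x U.ι h w (by rw [Scheme.Opens.range_ι]; exact hw)
    rw [Scheme.Opens.range_ι] at this
    exact this
  refine ⟨key z, fun hz => ?_⟩
  have := key ((toGr x hG).i z)
  rw [← Scheme.Hom.comp_apply, ← Scheme.Hom.comp_apply, (toGr x hG).i_p, (toGr x hG).i_a] at this
  exact this hz

lemma open_of_closed (hG : G.FlatFinPres) (U : x.carrier.left.Opens) {V : Scheme.{u}}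
    (f : V ⟶ x.carrier.left) (h : IsInvariantSub x f)
    (hU : (U : Set x.carrier.left) = (Set.range f)ᶜ) : IsInvariantOpen x U := by
  have hm : ∀ y, y ∈ U ↔ y ∉ Set.range f := fun y => by
    change y ∈ (U : Set x.carrier.left) ↔ _
    rw [hU]; rfl
  apply open_inv
  intro z hz
  rw [hm] at hz ⊢
  intro hc
  apply hz
  have := sub_range x f h ((toGr x hG).i z) (by
    change (toGr x hG).p _ ∈ _
    rw [← Scheme.Hom.comp_apply, (toGr x hG).i_p]; exact hc)
  change (toGr x hG).a _ ∈ _ at this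
  rw [← Scheme.Hom.comp_apply, (toGr x hG).i_a] at this
  exact this

section

variable {Z : Scheme.{u}} (ι : Z ⟶ x.carrier.left) [IsClosedImmersion ι]

lemma supp_ker {X Z : Scheme.{u}} (ι : Z ⟶ X) [IsClosedImmersion ι] :
    (ι.ker.support : Set X) = Set.range ι := by
  rw [Scheme.Hom.support_ker]
  exact ι.isClosedEmbedding.isClosed_range.closure_eq

lemma int_supp (hG : G.FlatFinPres) (U : x.carrier.left.Opens)
    (hU : (U : Set x.carrier.left) = (Set.range ι)ᶜ) (h : IsInvariantOpen x U) :
    LeOn ⊤ ((toGr x hG).int ι.ker) (U : Set x.carrier.left) := by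
  intro z hz
  apply leAt_of_not_mem_support
  intro hc
  have h1 : ((toGr x hG).int ι.ker).support ≤ ι.ker.support := by
    change ((ι.ker.comap (toGr x hG).p).map (toGr x hG).a).support ≤ _
    rw [Scheme.IdealSheafData.support_map, Scheme.IdealSheafData.support_comap]
    apply closure_minimal _ ι.ker.support.isClosed
    rintro _ ⟨w, hw, rfl⟩
    change (toGr x hG).p w ∈ (ι.ker.support : Set x.carrier.left) at hw
    rw [supp_ker, ← Set.notMem_compl_iff, ← hU] at hw ⊢
    exact fun hc => hw ((open_stable x hG U h w).2 hc)
  have h2 : z ∈ (ι.ker.support : Set x.carrier.left) := h1 hc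
  rw [supp_ker] at h2
  rw [hU] at hz
  exact hz h2

lemma thick (hG : G.FlatFinPres) (U : x.carrier.left.Opens)
    (hU : (U : Set x.carrier.left) = (Set.range ι)ᶜ) {K : x.carrier.left.IdealSheafData}
    (hK : (toGr x hG).Inv K) (hle : K ≤ ι.ker) (hKU : LeOn ⊤ K (U : Set x.carrier.left)) :
    (∃ j : Z ⟶ K.subscheme, j ≫ K.subschemeι = ι) ∧ Set.range K.subschemeι = Set.range ι ∧
      IsInvariantSub x (V := K.subscheme) K.subschemeι := by
  refine ⟨⟨IsClosedImmersion.lift K.subschemeι ι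
    (by rw [Scheme.IdealSheafData.ker_subschemeι]; exact hle), IsClosedImmersion.lift_fac _ _ _⟩,
    ?_, closed_inv hK⟩
  rw [Scheme.IdealSheafData.range_subschemeι]
  apply le_antisymm
  · intro z hz
    rw [← Set.notMem_compl_iff, ← hU]
    exact fun hc => not_mem_support_of_leAt (hKU z hc) hz
  · rw [← supp_ker]
    exact Scheme.IdealSheafData.support_antitone hle

lemma final1 (hG : G.FlatFinPres) (U : x.carrier.left.Opens)
    (hU : (U : Set x.carrier.left) = (Set.range ι)ᶜ) (h : IsInvariantOpen x U) :
    ∃ (Z' : Scheme.{u}) (ι' : Z' ⟶ x.carrier.left), IsClosedImmersion ι' ∧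
        (∃ j : Z ⟶ Z', j ≫ ι' = ι) ∧ Set.range ι' = Set.range ι ∧
        IsInvariantSub x ι' := by
  refine ⟨((toGr x hG).int ι.ker).subscheme, ((toGr x hG).int ι.ker).subschemeι, inferInstance, ?_⟩
  exact thick x ι hG U hU ((toGr x hG).int_inv _) ((toGr x hG).int_le _) (int_supp x ι hG U hU h)

lemma final2 (hG : G.FlatFinPres) (U : x.carrier.left.Opens)
    (hU : (U : Set x.carrier.left) = (Set.range ι)ᶜ) (h : IsInvariantOpen x U)
    [CompactSpace x.carrier.left] [QuasiSeparatedSpace x.carrier.left]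
    (hUc : IsCompact (U : Set x.carrier.left)) :
    ∃ (Z' : Scheme.{u}) (ι' : Z' ⟶ x.carrier.left), IsClosedImmersion ι' ∧
        LocallyOfFinitePresentation ι' ∧
        (∃ j : Z ⟶ Z', j ≫ ι' = ι) ∧ Set.range ι' = Set.range ι ∧
        IsInvariantSub x ι' := by
  have hE := int_supp x ι hG U hU h
  obtain ⟨F, hF1, hF2, hF3⟩ := ext0 hUc ((toGr x hG).int ι.ker) (fun z hz =>
    FGAt.congr hE (fun z _ => leAt_of_le le_top z) hz (FG.top z))
  have f1 : Flat G.carrier.hom := Flat.of_stalkMap _ hG.1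
  have f2 : LocallyOfFinitePresentation G.carrier.hom := hG.2.1
  have f3 : QuasiCompact G.carrier.hom := hG.2.2.1
  obtain ⟨K, hK1, hK2, hK3, hK4⟩ := compl_gen (toGr x hG) x.carrier.hom G.carrier.hom
    (prod.fst : G.carrier ⨯ x.carrier ⟶ _).left (prod_isPullback G.carrier x.carrier) (by
      change (prod.snd : G.carrier ⨯ x.carrier ⟶ _).left ≫ x.carrier.hom =
        x.act.left ≫ x.carrier.hom
      rw [Over.w, Over.w]) _ ((toGr x hG).int_inv ι.ker) F hF2 hF1
  refine ⟨K.subscheme, K.subschemeι, inferInstance, lfp_subscheme hK1, ?_⟩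
  exact thick x ι hG U hU hK4 (hK3.trans ((toGr x hG).int_le _))
    (fun z hz => (hE.trans hF3 z hz).mono_right hK2)

end

lemma final_thm (hG : G.FlatFinPres)
    {Z : Scheme.{u}} (ι : Z ⟶ x.carrier.left) (hι : IsClosedImmersion ι)
    (U : x.carrier.left.Opens) (hU : (U : Set x.carrier.left) = (Set.range ι)ᶜ) :
    (IsInvariantOpen x U ↔
      ∃ (Z' : Scheme.{u}) (ι' : Z' ⟶ x.carrier.left), IsClosedImmersion ι' ∧
        (∃ j : Z ⟶ Z', j ≫ ι' = ι) ∧ Set.range ι' = Set.range ι ∧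
        IsInvariantSub x ι') ∧
    (QCQS x.carrier.left → QCQS U.toScheme → IsInvariantOpen x U →
      ∃ (Z' : Scheme.{u}) (ι' : Z' ⟶ x.carrier.left), IsClosedImmersion ι' ∧
        LocallyOfFinitePresentation ι' ∧
        (∃ j : Z ⟶ Z', j ≫ ι' = ι) ∧ Set.range ι' = Set.range ι ∧
        IsInvariantSub x ι') := by
  refine ⟨⟨final1 x ι hG U hU, ?_⟩, ?_⟩
  · rintro ⟨Z', ι', -, -, hr, hi⟩
    exact open_of_closed x hG U ι' hi (by rw [hr]; exact hU)
  · intro h1 h2 h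
    have := h1.1
    have := h1.2
    exact final2 x ι hG U hU h (isCompact_iff_compactSpace.2 h2.1)

end EqvThick

namespace EquivariantSix

universe u

theorem invariant_complement_iff_invariant_thickening
    {B : Scheme.{u}} {G : GrpOver B} (hG : G.FlatFinPres)
    (x : GScheme B G) {Z : Scheme.{u}} (ι : Z ⟶ x.sch) (hι : IsClosedImmersion ι)
    (U : x.sch.Opens) (hU : (U : Set x.sch) = (Set.range ι.base)ᶜ) :
    (IsInvariantOpen x U ↔
      ∃ (Z' : Scheme.{u}) (ι' : Z' ⟶ x.sch), IsClosedImmersion ι' ∧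
        (∃ j : Z ⟶ Z', j ≫ ι' = ι) ∧ Set.range ι'.base = Set.range ι.base ∧
        IsInvariantSub x ι') ∧
    (QCQS x.sch → QCQS U.toScheme → IsInvariantOpen x U →
      ∃ (Z' : Scheme.{u}) (ι' : Z' ⟶ x.sch), IsClosedImmersion ι' ∧
        LocallyOfFinitePresentation ι' ∧
        (∃ j : Z ⟶ Z', j ≫ ι' = ι) ∧ Set.range ι'.base = Set.range ι.base ∧
        IsInvariantSub x ι') := by
  exact EqvThick.final_thm x hG ι hι U hU

end EquivariantSix
end
end

section
/- Let d_0, d_1 : X_1 ⇉ X_0 be a groupoid scheme in which d_0 and d_1 are flat and of finite presentation. Let Z ⊆ X_0 be a closed subscheme whose open complement U is invariant, i.e. d_0^{-1}(U) = d_1^{-1}(U). Let Z' be the schematic image of the restriction of d_1 to d_0^{-1}(Z). Then Z' is an invariant closed subscheme of X_0 (i.e. d_0^{-1}(Z') = d_1^{-1}(Z')), Z' contains Z, and Z' is disjoint from U; in particular Z' is an invariant thickening of Z. -/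
open CategoryTheory CategoryTheory.Limits AlgebraicGeometry

noncomputable section

namespace EquivariantSix

universe u

/-- A groupoid scheme: schemes `X₁` (morphisms) and `X₀` (objects) with source and target
maps `d₀, d₁ : X₁ ⟶ X₀`, a unit `e`, a composition `comp` and an inversion `inv`, satisfying
the groupoid axioms (stated via generalized elements). -/
structure GroupoidScheme where
  X₀ : Scheme.{u}
  X₁ : Scheme.{u}
  d₀ : X₁ ⟶ X₀
  d₁ : X₁ ⟶ X₀
  e : X₀ ⟶ X₁
  e_d₀ : e ≫ d₀ = 𝟙 X₀
  e_d₁ : e ≫ d₁ = 𝟙 X₀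
  comp : pullback d₁ d₀ ⟶ X₁
  comp_d₀ : comp ≫ d₀ = pullback.fst d₁ d₀ ≫ d₀
  comp_d₁ : comp ≫ d₁ = pullback.snd d₁ d₀ ≫ d₁
  inv : X₁ ⟶ X₁
  inv_d₀ : inv ≫ d₀ = d₁
  inv_d₁ : inv ≫ d₁ = d₀
  comp_assoc : ∀ {T : Scheme.{u}} (f g h : T ⟶ X₁)
    (w₁ : f ≫ d₁ = g ≫ d₀) (w₂ : g ≫ d₁ = h ≫ d₀)
    (w₁₂ : (pullback.lift f g w₁ ≫ comp) ≫ d₁ = h ≫ d₀)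
    (w₂₃ : f ≫ d₁ = (pullback.lift g h w₂ ≫ comp) ≫ d₀),
    pullback.lift (pullback.lift f g w₁ ≫ comp) h w₁₂ ≫ comp =
      pullback.lift f (pullback.lift g h w₂ ≫ comp) w₂₃ ≫ comp
  id_comp : ∀ {T : Scheme.{u}} (f : T ⟶ X₁) (w : (f ≫ d₀ ≫ e) ≫ d₁ = f ≫ d₀),
    pullback.lift (f ≫ d₀ ≫ e) f w ≫ comp = f
  comp_id : ∀ {T : Scheme.{u}} (f : T ⟶ X₁) (w : f ≫ d₁ = (f ≫ d₁ ≫ e) ≫ d₀),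
    pullback.lift f (f ≫ d₁ ≫ e) w ≫ comp = f
  inv_comp : ∀ {T : Scheme.{u}} (f : T ⟶ X₁) (w : (f ≫ inv) ≫ d₁ = f ≫ d₀),
    pullback.lift (f ≫ inv) f w ≫ comp = f ≫ d₁ ≫ e
  comp_inv : ∀ {T : Scheme.{u}} (f : T ⟶ X₁) (w : f ≫ d₁ = (f ≫ inv) ≫ d₀),
    pullback.lift f (f ≫ inv) w ≫ comp = f ≫ d₀ ≫ e

/-- A subscheme `ι : Y ⟶ X₀` is invariant for the groupoid if `d₀⁻¹(Y) = d₁⁻¹(Y)` as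
subschemes of `X₁` (i.e. the two pullbacks are isomorphic over `X₁`). -/
def GroupoidScheme.IsInvariantSub (S : GroupoidScheme.{u}) {Y : Scheme.{u}}
    (ι : Y ⟶ S.X₀) : Prop :=
  ∃ φ : pullback S.d₀ ι ≅ pullback S.d₁ ι,
    φ.hom ≫ pullback.fst S.d₁ ι = pullback.fst S.d₀ ι

/-- `ι : Z ⟶ X` is the schematic image of `f : T ⟶ X`: the smallest closed subscheme of `X`
through which `f` factors. -/
structure IsSchematicImage {T X Z : Scheme.{u}} (f : T ⟶ X) (ι : Z ⟶ X) : Prop where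
  isClosedImmersion : IsClosedImmersion ι
  factors : ∃ g : T ⟶ Z, g ≫ ι = f
  isSmallest : ∀ {W : Scheme.{u}} (ι' : W ⟶ X), IsClosedImmersion ι' →
    (∃ g : T ⟶ W, g ≫ ι' = f) → ∃ h : Z ⟶ W, h ≫ ι' = ι

end EquivariantSix

namespace EquivariantSix

universe u

/-- Let `d₀, d₁ : X₁ ⇉ X₀` be a groupoid scheme with `d₀, d₁` flat and of
finite presentation.  Let `Z ⊆ X₀` be a closed subscheme whose open complement
`U = X₀ ∖ Z` is invariant (`d₀⁻¹(U) = d₁⁻¹(U)`).  Let `Z'` be the schematic image of the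
restriction of `d₁` to `d₀⁻¹(Z)`.  Then `Z'` is an invariant closed subscheme of `X₀`,
`Z'` contains `Z`, and `Z'` is disjoint from `U`; in particular `Z'` is an invariant
thickening of `Z`. -/
theorem schematicImage_invariant_thickening
    (S : GroupoidScheme.{u}) (hd₀ : FlatHom S.d₀ ∧ FinPresHom S.d₀)
    (hd₁ : FlatHom S.d₁ ∧ FinPresHom S.d₁)
    {Z : Scheme.{u}} (ι : Z ⟶ S.X₀) (hι : IsClosedImmersion ι)
    (hU : ⇑S.d₀.base ⁻¹' (Set.range ι.base)ᶜ = ⇑S.d₁.base ⁻¹' (Set.range ι.base)ᶜ)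
    {Z' : Scheme.{u}} (ι' : Z' ⟶ S.X₀)
    (hZ' : IsSchematicImage (pullback.fst S.d₀ ι ≫ S.d₁) ι') :
    S.IsInvariantSub ι' ∧
    (∃ j : Z ⟶ Z', j ≫ ι' = ι) ∧
    Set.range ι'.base ∩ (Set.range ι.base)ᶜ = ∅ ∧
    Set.range ι'.base = Set.range ι.base := by
  obtain ⟨hd₀f, -, hd₀q, -⟩ := hd₀
  obtain ⟨hd₁f, -, hd₁q, -⟩ := hd₁
  have : Flat S.d₀ := Flat.of_stalkMap _ hd₀f
  obtain ⟨hcl, ⟨g, hg⟩, hmin⟩ := hZ'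
  set f := pullback.fst S.d₀ ι ≫ S.d₁ with hf
  have hqf : QuasiCompact f := by rw [hf]; infer_instance
  have hqg : QuasiCompact g := by
    have : QuasiCompact (g ≫ ι') := by rw [hg]; exact hqf
    exact QuasiCompact.of_comp g ι'
  have hker : ι'.ker = f.ker := by
    apply le_antisymm
    · rw [← hg]; exact Scheme.Hom.le_ker_comp _ _
    · obtain ⟨h, hh⟩ := hmin f.imageι inferInstance ⟨f.toImage, f.toImage_imageι⟩
      have h1 := Scheme.Hom.le_ker_comp h f.imageι
      rw [hh] at h1
      have h2 : f.imageι.ker = f.ker := Scheme.IdealSheafData.ker_subschemeι _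
      rwa [h2] at h1
  have hdom : IsSchemeTheoreticallyDominant g := by
    rw [isSchemeTheoreticallyDominant_iff]
    obtain ⟨h, hh⟩ := hmin (g.imageι ≫ ι') inferInstance ⟨g.toImage, by simp [hg]⟩
    have h3 : h ≫ g.imageι = 𝟙 _ := by
      rw [← cancel_mono ι']; simpa using hh
    have h1 := Scheme.Hom.le_ker_comp h g.imageι
    have h2 : g.imageι.ker = g.ker := Scheme.IdealSheafData.ker_subschemeι _
    rw [h3, h2, Scheme.Hom.ker_eq_bot_of_isIso (𝟙 Z')] at h1
    exact le_bot_iff.mp h1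
  have hj : ∃ j : Z ⟶ Z', j ≫ ι' = ι := by
    refine ⟨pullback.lift (ι ≫ S.e) (𝟙 _) (by simp [S.e_d₀]) ≫ g, ?_⟩
    rw [Category.assoc, hg, hf, pullback.lift_fst_assoc, Category.assoc, S.e_d₁, Category.comp_id]
  have hfac : ι'.ker ≤ (pullback.fst S.d₀ ι' ≫ S.d₁).ker := by
    let p := pullback.fst (pullback.snd S.d₀ ι') g
    have hp : IsSchemeTheoreticallyDominant p := inferInstance
    have e1 : (pullback.fst S.d₀ ι' ≫ S.d₁).ker = (p ≫ pullback.fst S.d₀ ι' ≫ S.d₁).ker := by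
      rw [Scheme.Hom.ker_comp p, p.ker_eq_bot, Scheme.IdealSheafData.map_bot]
    let q := pullback.snd (pullback.snd S.d₀ ι') g
    let y := q ≫ pullback.fst S.d₀ ι
    let x := p ≫ pullback.fst S.d₀ ι'
    have hyx : y ≫ S.d₁ = x ≫ S.d₀ := by
      simp only [x, y, Category.assoc]
      rw [pullback.condition (f := S.d₀) (g := ι')]
      have : p ≫ pullback.snd S.d₀ ι' = q ≫ g := pullback.condition
      rw [reassoc_of% this, hg, hf]
    let t : _ ⟶ pullback S.d₀ ι := pullback.lift (pullback.lift y x hyx ≫ S.comp)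
      (q ≫ pullback.snd S.d₀ ι) (by
        rw [Category.assoc, S.comp_d₀, pullback.lift_fst_assoc, Category.assoc, Category.assoc,
          pullback.condition])
    have ht : p ≫ pullback.fst S.d₀ ι' ≫ S.d₁ = t ≫ f := by
      simp only [t, hf]
      rw [pullback.lift_fst_assoc, Category.assoc, S.comp_d₁, pullback.lift_snd_assoc]
      simp [x]
    rw [e1, ht, hker]
    exact Scheme.Hom.le_ker_comp _ _
  have hrange : Set.range ι'.base = Set.range ι.base := by
    apply subset_antisymm
    · have h1 : (ι'.ker.support : Set S.X₀) = closure (Set.range ι') := ι'.support_ker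
      have h2 : (f.ker.support : Set S.X₀) = closure (Set.range f) := f.support_ker
      have h3 : Set.range f ⊆ Set.range ι := by
        rintro _ ⟨t, rfl⟩
        by_contra hn
        have hm : pullback.fst S.d₀ ι t ∈ ⇑S.d₁.base ⁻¹' (Set.range ι.base)ᶜ := by
          simpa [hf] using hn
        rw [← hU] at hm
        apply hm
        refine ⟨pullback.snd S.d₀ ι t, ?_⟩
        change (pullback.snd S.d₀ ι ≫ ι) t = (pullback.fst S.d₀ ι ≫ S.d₀) t
        rw [pullback.condition]
      refine subset_closure.trans ?_
      change closure (Set.range ι') ⊆ _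
      rw [← h1, hker, h2]
      exact closure_minimal h3 ι.isClosedEmbedding.isClosed_range
    · obtain ⟨j, hj⟩ := hj
      rintro _ ⟨z, rfl⟩
      exact ⟨j z, by rw [← hj]; rfl⟩
  refine ⟨?_, hj, ?_, hrange⟩
  · let h := IsClosedImmersion.lift ι' (pullback.fst S.d₀ ι' ≫ S.d₁) hfac
    have hh : h ≫ ι' = pullback.fst S.d₀ ι' ≫ S.d₁ := IsClosedImmersion.lift_fac _ _ _
    let a : pullback S.d₀ ι' ⟶ pullback S.d₁ ι' := pullback.lift (pullback.fst _ _) h hh.symm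
    let k : pullback S.d₁ ι' ⟶ pullback S.d₀ ι' :=
      pullback.lift (pullback.fst _ _ ≫ S.inv) (pullback.snd _ _) (by
        rw [Category.assoc, S.inv_d₀, pullback.condition])
    let b : pullback S.d₁ ι' ⟶ pullback S.d₀ ι' := pullback.lift (pullback.fst _ _) (k ≫ h) (by
        rw [Category.assoc, hh, pullback.lift_fst_assoc, Category.assoc, S.inv_d₁])
    have ha : a ≫ pullback.fst _ _ = pullback.fst _ _ := pullback.lift_fst _ _ _
    have hb : b ≫ pullback.fst _ _ = pullback.fst _ _ := pullback.lift_fst _ _ _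
    refine ⟨⟨a, b, ?_, ?_⟩, ha⟩
    · rw [← cancel_mono (pullback.fst S.d₀ ι'), Category.assoc, hb, ha, Category.id_comp]
    · rw [← cancel_mono (pullback.fst S.d₁ ι'), Category.assoc, ha, hb, Category.id_comp]
  · rw [hrange]; exact Set.inter_compl_self _

end EquivariantSix
end
end
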